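/- Compactness theorem: let c ∈ ℝ, let Ω ⊆ ℝ² be open, and let (u_n) be a sequence of smooth c-translator solutions on Ω that is locally bounded, i.e. for every compact K ⊂ Ω there is M_K > 0 with |u_n| ≤ M_K on K for all n. Then there is a subsequence (u_{n_k}) and a smooth c-translator solution u on Ω such that u_{n_k} → u uniformly on every compact subset of Ω, and moreover all first and second partial derivatives of u_{n_k} converge uniformly on compact subsets of Ω to the corresponding derivatives of u. -/

import Mathlib

open Real Set Filter Topology

/-- The partial derivative in the first (x) direction. -/
noncomputable def pdx (u : ℝ × ℝ → ℝ) (p : ℝ × ℝ) : ℝ := fderiv ℝ u p (1, 0)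

/-- The partial derivative in the second (t) direction. -/
noncomputable def pdt (u : ℝ × ℝ → ℝ) (p : ℝ × ℝ) : ℝ := fderiv ℝ u p (0, 1)

/-- `u` is a smooth c-translator solution on `Ω`: it is C^∞ on `Ω` and satisfies
`(1+u_t²)u_xx - 2u_x u_t u_xt + (1+u_x²)u_tt + c u_t (1+u_x²+u_t²) = 0` there. -/
def IsSmoothTranslator (c : ℝ) (Ω : Set (ℝ × ℝ)) (u : ℝ × ℝ → ℝ) : Prop :=
  ContDiffOn ℝ (⊤ : ℕ∞) u Ω ∧ ∀ p ∈ Ω,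
    (1 + pdt u p ^ 2) * pdx (pdx u) p - 2 * pdx u p * pdt u p * pdx (pdt u) p
      + (1 + pdx u p ^ 2) * pdt (pdt u) p
      + c * pdt u p * (1 + pdx u p ^ 2 + pdt u p ^ 2) = 0

open scoped ContDiff

namespace TranslatorAux

section

/-! ### Directional derivatives -/

/-- The derivative of `f` in the direction `e`. -/
noncomputable def pd (e : ℝ × ℝ) (f : ℝ × ℝ → ℝ) (p : ℝ × ℝ) : ℝ := fderiv ℝ f p e

lemma pdx_eq (f : ℝ × ℝ → ℝ) : pdx f = pd (1, 0) f := rfl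

lemma pdt_eq (f : ℝ × ℝ → ℝ) : pdt f = pd (0, 1) f := rfl

/-- Smoothness at a point. -/
abbrev Sm (f : ℝ × ℝ → ℝ) (p : ℝ × ℝ) : Prop := ContDiffAt ℝ ∞ f p

variable {f g : ℝ × ℝ → ℝ} {p e e' : ℝ × ℝ}

lemma Sm.diff (h : Sm f p) : DifferentiableAt ℝ f p := h.differentiableAt (by simp)

lemma Sm.ev_diff (h : Sm f p) : ∀ᶠ q in 𝓝 p, DifferentiableAt ℝ f q := by
  have h1 : ContDiffAt ℝ 1 f p := h.of_le (by exact_mod_cast le_top)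
  filter_upwards [h1.eventually (by simp)] with q hq
  exact hq.differentiableAt (by simp)

lemma Sm.fderiv (h : Sm f p) : ContDiffAt ℝ ∞ (fderiv ℝ f) p :=
  ContDiffAt.fderiv_right h (by simp)

lemma Sm.pd (h : Sm f p) : Sm (pd e f) p := h.fderiv.clm_apply contDiffAt_const

lemma Sm.pdx (h : Sm f p) : Sm (pdx f) p := h.fderiv.clm_apply contDiffAt_const

lemma Sm.pdt (h : Sm f p) : Sm (pdt f) p := h.fderiv.clm_apply contDiffAt_const

lemma pd_congr (h : f =ᶠ[𝓝 p] g) : pd e f p = pd e g p := by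
  simp only [TranslatorAux.pd, h.fderiv_eq]

lemma pd_congr_ev (h : f =ᶠ[𝓝 p] g) : pd e f =ᶠ[𝓝 p] pd e g := by
  filter_upwards [eventually_eventually_nhds.2 h] with q hq
  exact pd_congr hq

lemma pd_const (a : ℝ) : pd e (fun _ => a) p = 0 := by simp [TranslatorAux.pd]

lemma pd_add (hf : DifferentiableAt ℝ f p) (hg : DifferentiableAt ℝ g p) :
    pd e (fun q => f q + g q) p = pd e f p + pd e g p := by
  simp [TranslatorAux.pd, fderiv_fun_add hf hg]

lemma pd_mul (hf : DifferentiableAt ℝ f p) (hg : DifferentiableAt ℝ g p) :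
    pd e (fun q => f q * g q) p = f p * pd e g p + pd e f p * g p := by
  simp [TranslatorAux.pd, fderiv_fun_mul hf hg]; ring

lemma pd_const_mul (a : ℝ) (hf : DifferentiableAt ℝ f p) :
    pd e (fun q => a * f q) p = a * pd e f p := by
  rw [pd_mul (differentiableAt_const a) hf, pd_const]; ring

lemma pd_sum {ι : Type*} (s : Finset ι) {F : ι → ℝ × ℝ → ℝ}
    (h : ∀ i ∈ s, DifferentiableAt ℝ (F i) p) :
    pd e (fun q => ∑ i ∈ s, F i q) p = ∑ i ∈ s, pd e (F i) p := by
  simp [TranslatorAux.pd, fderiv_fun_sum h]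

lemma pd_comp {φ : ℝ → ℝ} {φ' : ℝ} (hφ : HasDerivAt φ φ' (f p)) (hf : DifferentiableAt ℝ f p) :
    pd e (fun q => φ (f q)) p = φ' * pd e f p := by
  have := (hφ.comp_hasFDerivAt p hf.hasFDerivAt).fderiv
  simp only [TranslatorAux.pd]
  rw [show (fun q => φ (f q)) = φ ∘ f from rfl, this]; simp

lemma pd_comm_of_two (h : ContDiffAt ℝ 2 f p) : pd e (pd e' f) p = pd e' (pd e f) p := by
  have hs : IsSymmSndFDerivAt ℝ f p := h.isSymmSndFDerivAt (by simp)
  have hd : DifferentiableAt ℝ (_root_.fderiv ℝ f) p :=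
    (h.fderiv_right (m := 1) (by norm_num)).differentiableAt (by simp)
  have key : ∀ a b : ℝ × ℝ, pd a (pd b f) p = _root_.fderiv ℝ (_root_.fderiv ℝ f) p a b := by
    intro a b
    have : pd b f = fun q => (_root_.fderiv ℝ f q) b := rfl
    rw [this]
    simp only [TranslatorAux.pd]
    rw [fderiv_clm_apply hd (differentiableAt_const b)]
    simp
  rw [key, key]; exact hs _ _

lemma pd_comm (h : Sm f p) : pd e (pd e' f) p = pd e' (pd e f) p :=
  pd_comm_of_two (h.of_le (WithTop.coe_le_coe.2 le_top))

lemma pd_add_ev (hf : Sm f p) (hg : Sm g p) :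
    pd e (fun q => f q + g q) =ᶠ[𝓝 p] fun q => pd e f q + pd e g q := by
  filter_upwards [hf.ev_diff, hg.ev_diff] with q h1 h2 using pd_add h1 h2

lemma pd_mul_ev (hf : Sm f p) (hg : Sm g p) :
    pd e (fun q => f q * g q) =ᶠ[𝓝 p] fun q => f q * pd e g q + pd e f q * g q := by
  filter_upwards [hf.ev_diff, hg.ev_diff] with q h1 h2 using pd_mul h1 h2

lemma pd_const_mul_ev (a : ℝ) (hf : Sm f p) :
    pd e (fun q => a * f q) =ᶠ[𝓝 p] fun q => a * pd e f q := by
  filter_upwards [hf.ev_diff] with q h1 using pd_const_mul a h1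

lemma pd_sum_ev {ι : Type*} (s : Finset ι) {F : ι → ℝ × ℝ → ℝ} (h : ∀ i ∈ s, Sm (F i) p) :
    pd e (fun q => ∑ i ∈ s, F i q) =ᶠ[𝓝 p] fun q => ∑ i ∈ s, pd e (F i) q := by
  have : ∀ᶠ q in 𝓝 p, ∀ i ∈ s, DifferentiableAt ℝ (F i) q :=
    (Finset.eventually_all s).2 fun i hi => (h i hi).ev_diff
  filter_upwards [this] with q hq using pd_sum s hq

/-! ### Second order operators -/

/-- The operator `a ∂ₓₓ + 2 b ∂ₓₜ + d ∂ₜₜ` at a point. -/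
noncomputable def LL (a b d : ℝ) (f : ℝ × ℝ → ℝ) (p : ℝ × ℝ) : ℝ :=
  a * pdx (pdx f) p + 2 * b * pdx (pdt f) p + d * pdt (pdt f) p

/-- The bilinear form with coefficients `a, b, d` on gradients. -/
noncomputable def GG (a b d : ℝ) (f g : ℝ × ℝ → ℝ) (p : ℝ × ℝ) : ℝ :=
  a * (pdx f p * pdx g p) + b * (pdx f p * pdt g p + pdt f p * pdx g p) + d * (pdt f p * pdt g p)

variable {a b d : ℝ}

lemma pdpd_add (hf : Sm f p) (hg : Sm g p) :
    pd e (pd e' (fun q => f q + g q)) p = pd e (pd e' f) p + pd e (pd e' g) p := by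
  rw [pd_congr (pd_add_ev hf hg), pd_add (Sm.diff hf.pd) (Sm.diff hg.pd)]

lemma pdpd_const_mul (k : ℝ) (hf : Sm f p) :
    pd e (pd e' (fun q => k * f q)) p = k * pd e (pd e' f) p := by
  rw [pd_congr (pd_const_mul_ev k hf), pd_const_mul k (Sm.diff hf.pd)]

lemma pdpd_mul (hf : Sm f p) (hg : Sm g p) :
    pd e (pd e' (fun q => f q * g q)) p = f p * pd e (pd e' g) p + pd e f p * pd e' g p
      + pd e' f p * pd e g p + pd e (pd e' f) p * g p := by
  rw [pd_congr (pd_mul_ev hf hg), pd_add (f := fun q => f q * pd e' g q)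
    (g := fun q => pd e' f q * g q) (hf.diff.mul (Sm.diff hg.pd)) ((Sm.diff hf.pd).mul hg.diff),
    pd_mul hf.diff (Sm.diff hg.pd), pd_mul (Sm.diff hf.pd) hg.diff]
  ring

lemma pdpd_sum {ι : Type*} (s : Finset ι) {F : ι → ℝ × ℝ → ℝ} (h : ∀ i ∈ s, Sm (F i) p) :
    pd e (pd e' (fun q => ∑ i ∈ s, F i q)) p = ∑ i ∈ s, pd e (pd e' (F i)) p := by
  rw [pd_congr (pd_sum_ev s h), pd_sum s fun i hi => Sm.diff (h i hi).pd]

lemma pdpd_comp {φ φ' : ℝ → ℝ} {φ'' : ℝ} (h1 : ∀ᶠ y in 𝓝 (f p), HasDerivAt φ (φ' y) y)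
    (h2 : HasDerivAt φ' φ'' (f p)) (hf : Sm f p) :
    pd e (pd e' (fun q => φ (f q))) p
      = φ' (f p) * pd e (pd e' f) p + φ'' * (pd e f p * pd e' f p) := by
  have : pd e' (fun q => φ (f q)) =ᶠ[𝓝 p] fun q => φ' (f q) * pd e' f q := by
    filter_upwards [hf.ev_diff, hf.continuousAt.eventually h1] with q h3 h4 using pd_comp h4 h3
  rw [pd_congr this, pd_mul (f := fun q => φ' (f q))
    (h2.differentiableAt.comp p hf.diff) (Sm.diff hf.pd), pd_comp h2 hf.diff]
  ring

lemma LL_add (hf : Sm f p) (hg : Sm g p) :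
    LL a b d (fun q => f q + g q) p = LL a b d f p + LL a b d g p := by
  simp only [LL, pdx_eq, pdt_eq, pdpd_add hf hg]; ring

lemma LL_const_mul (k : ℝ) (hf : Sm f p) :
    LL a b d (fun q => k * f q) p = k * LL a b d f p := by
  simp only [LL, pdx_eq, pdt_eq, pdpd_const_mul k hf]; ring

lemma LL_mul (hf : Sm f p) (hg : Sm g p) :
    LL a b d (fun q => f q * g q) p
      = f p * LL a b d g p + g p * LL a b d f p + 2 * GG a b d f g p := by
  simp only [LL, GG, pdx_eq, pdt_eq, pdpd_mul hf hg]; ring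

lemma LL_sum {ι : Type*} (s : Finset ι) {F : ι → ℝ × ℝ → ℝ} (h : ∀ i ∈ s, Sm (F i) p) :
    LL a b d (fun q => ∑ i ∈ s, F i q) p = ∑ i ∈ s, LL a b d (F i) p := by
  simp only [LL, pdx_eq, pdt_eq, pdpd_sum s h, Finset.mul_sum, Finset.sum_add_distrib]

lemma LL_comp {φ φ' : ℝ → ℝ} {φ'' : ℝ} (h1 : ∀ᶠ y in 𝓝 (f p), HasDerivAt φ (φ' y) y)
    (h2 : HasDerivAt φ' φ'' (f p)) (hf : Sm f p) :
    LL a b d (fun q => φ (f q)) p = φ' (f p) * LL a b d f p + φ'' * GG a b d f f p := by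
  simp only [LL, GG, pdx_eq, pdt_eq, pdpd_comp h1 h2 hf]; ring

/-! ### Maximum principle at a point -/

lemma pd_eq_zero_of_isLocalMax (h : IsLocalMax f p) : pd e f p = 0 := by
  simp [TranslatorAux.pd, h.fderiv_eq_zero]

lemma hasDerivAt_line {s : ℝ} (hf : DifferentiableAt ℝ f (p + s • e)) :
    HasDerivAt (fun s : ℝ => f (p + s • e)) (pd e f (p + s • e)) s := by
  have h1 : HasDerivAt (fun s : ℝ => p + s • e) e s := by
    simpa using ((hasDerivAt_id s).smul_const e).const_add p
  exact hf.hasFDerivAt.comp_hasDerivAt s h1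

lemma pdpd_nonpos_of_isLocalMax (hf : Sm f p) (h : IsLocalMax f p) : pd e (pd e f) p ≤ 0 := by
  have hc : Tendsto (fun s : ℝ => p + s • e) (𝓝 0) (𝓝 p) := by
    have : Continuous fun s : ℝ => p + s • e := by fun_prop
    simpa using this.tendsto 0
  set φ : ℝ → ℝ := fun s => f (p + s • e)
  have hp : p + (0 : ℝ) • e = p := by simp
  have hmax : IsLocalMax φ 0 := by
    have := hc.eventually h
    filter_upwards [this] with s hs
    simpa [φ] using hs
  have hd : deriv φ =ᶠ[𝓝 0] fun s => pd e f (p + s • e) := by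
    filter_upwards [hc.eventually hf.ev_diff] with s hs using (hasDerivAt_line hs).deriv
  have hdd : deriv (deriv φ) 0 = pd e (pd e f) p := by
    rw [hd.deriv_eq]
    have := (hasDerivAt_line (f := pd e f) (p := p) (e := e) (s := 0)
      (by rw [hp]; exact Sm.diff hf.pd)).deriv
    rw [hp] at this
    exact this
  by_contra! hpos
  have hφc : ContinuousAt φ 0 := by
    have : DifferentiableAt ℝ f (p + (0 : ℝ) • e) := by rw [hp]; exact hf.diff
    exact (hasDerivAt_line this).continuousAt
  have hmin := isLocalMin_of_deriv_deriv_pos (hdd ▸ hpos) hmax.deriv_eq_zero hφc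
  have hconst : φ =ᶠ[𝓝 0] fun _ => φ 0 := by
    filter_upwards [hmin, hmax] with s h1 h2 using le_antisymm h2 h1
  have : deriv φ =ᶠ[𝓝 0] fun _ => 0 := by
    filter_upwards [eventually_eventually_nhds.2 hconst] with s hs
    rw [Filter.EventuallyEq.deriv_eq hs]; simp
  rw [this.deriv_eq] at hdd
  simp at hdd
  linarith

lemma pd_linear (r s : ℝ) : pd (r, s) f p = r * pdx f p + s * pdt f p := by
  have : ((r, s) : ℝ × ℝ) = r • (1, 0) + s • (0, 1) := by ext <;> simp
  simp only [TranslatorAux.pd, _root_.pdx, _root_.pdt, this, map_add, map_smul, smul_eq_mul]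

lemma LL_nonpos_of_isLocalMax (ha : 0 < a) (hD : 0 ≤ a * d - b ^ 2) (hf : Sm f p)
    (h : IsLocalMax f p) : LL a b d f p ≤ 0 := by
  have h1 := pdpd_nonpos_of_isLocalMax (e := (1, b / a)) hf h
  have h2 := pdpd_nonpos_of_isLocalMax (e := (0, 1)) hf h
  have hfun : pd (1, b / a) f = fun q => pdx f q + b / a * pdt f q := by
    ext q; rw [pd_linear]; ring
  have hx : DifferentiableAt ℝ (pdx f) p := Sm.diff hf.pdx
  have ht : DifferentiableAt ℝ (pdt f) p := Sm.diff hf.pdt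
  rw [hfun, pd_add hx (ht.const_mul _), pd_const_mul _ ht, pd_linear, pd_linear] at h1
  have hc : pdt (pdx f) p = pdx (pdt f) p := pd_comm hf
  rw [hc] at h1
  rw [← pdt_eq, ← pdt_eq] at h2
  have key : LL a b d f p = a * (1 * pdx (pdx f) p + b / a * pdx (pdt f) p
      + b / a * (1 * pdx (pdt f) p + b / a * pdt (pdt f) p))
      + (a * d - b ^ 2) / a * pdt (pdt f) p := by
    simp only [LL]; field_simp; ring
  rw [key]
  have : 0 ≤ (a * d - b ^ 2) / a := by positivity
  nlinarith [mul_nonneg this (neg_nonneg.2 h2), mul_nonneg ha.le (neg_nonneg.2 h1)]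

end

section

/-! ### The equation and its first derivatives -/

variable {f g : ℝ × ℝ → ℝ} {p e e' : ℝ × ℝ} {c : ℝ} {u : ℝ × ℝ → ℝ}

lemma pd_LL_var {A B C w : ℝ × ℝ → ℝ} (hA : DifferentiableAt ℝ A p)
    (hB : DifferentiableAt ℝ B p) (hC : DifferentiableAt ℝ C p) (hw : Sm w p) :
    pd e (fun y => LL (A y) (B y) (C y) w y) p
      = LL (A p) (B p) (C p) (pd e w) p
        + (pd e A p * pdx (pdx w) p + 2 * pd e B p * pdx (pdt w) p
          + pd e C p * pdt (pdt w) p) := by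
  have h3 : ∀ {a b : ℝ × ℝ}, pd e (pd a (pd b w)) p = pd a (pd b (pd e w)) p := by
    intro a b
    rw [pd_comm hw.pd]
    apply pd_congr
    have h2 : ContDiffAt ℝ ∞ w p := hw
    have h2' : ∀ᶠ y in 𝓝 p, ContDiffAt ℝ 2 w y :=
      (h2.of_le (WithTop.coe_le_coe.2 le_top)).eventually (by simp)
    filter_upwards [h2'] with y hy
    exact pd_comm_of_two hy
  have hxx : DifferentiableAt ℝ (pdx (pdx w)) p := Sm.diff hw.pdx.pdx
  have hxt : DifferentiableAt ℝ (pdx (pdt w)) p := Sm.diff hw.pdt.pdx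
  have htt : DifferentiableAt ℝ (pdt (pdt w)) p := Sm.diff hw.pdt.pdt
  have hBB : DifferentiableAt ℝ (fun y => 2 * B y) p := hB.const_mul 2
  have e1 := pd_mul (e := e) hA hxx
  have e2 := pd_mul (e := e) hBB hxt
  have e3 := pd_mul (e := e) hC htt
  have e4 := pd_add (e := e) (hA.fun_mul hxx) (hBB.fun_mul hxt)
  have e5 := pd_add (e := e) ((hA.fun_mul hxx).add (hBB.fun_mul hxt)) (hC.fun_mul htt)
  simp only [LL]
  simp only [Pi.add_apply, Pi.add_def] at e4 e5
  rw [e5, e4, e1, e2, e3, pd_const_mul 2 hB]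
  simp only [pdx_eq, pdt_eq] at *
  rw [h3, h3, h3]
  ring

/-- `u` is smooth at `p` and satisfies the translator equation near `p`. -/
def Sol (c : ℝ) (u : ℝ × ℝ → ℝ) (p : ℝ × ℝ) : Prop :=
  Sm u p ∧ ∀ᶠ y in 𝓝 p, LL (1 + pdt u y ^ 2) (-(pdx u y * pdt u y)) (1 + pdx u y ^ 2) u y
    + c * pdt u y * (1 + pdx u y ^ 2 + pdt u y ^ 2) = 0

lemma pd_sq (hf : DifferentiableAt ℝ f p) : pd e (fun y => f y ^ 2) p = 2 * f p * pd e f p := by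
  have := pd_mul (e := e) hf hf
  simp only [sq]; rw [this]; ring

lemma pd_one_add_sq (hf : DifferentiableAt ℝ f p) :
    pd e (fun y => 1 + f y ^ 2) p = 2 * f p * pd e f p := by
  rw [pd_add (differentiableAt_const 1) (hf.fun_pow 2), pd_const, pd_sq hf]; ring

lemma pd_gradSq (hu : Sm u p) :
    pd e (fun y => 1 + pdx u y ^ 2 + pdt u y ^ 2) p
      = 2 * pdx u p * pd e (pdx u) p + 2 * pdt u p * pd e (pdt u) p := by
  have hx : DifferentiableAt ℝ (pdx u) p := Sm.diff hu.pdx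
  have ht : DifferentiableAt ℝ (pdt u) p := Sm.diff hu.pdt
  have := pd_add (e := e) (f := fun y => 1 + pdx u y ^ 2) ((differentiableAt_const 1).add (hx.fun_pow 2))
    (ht.fun_pow 2)
  rw [this, pd_one_add_sq hx, pd_sq ht]

lemma Sol.eq (h : Sol c u p) :
    LL (1 + pdt u p ^ 2) (-(pdx u p * pdt u p)) (1 + pdx u p ^ 2) u p
    + c * pdt u p * (1 + pdx u p ^ 2 + pdt u p ^ 2) = 0 := h.2.self_of_nhds

lemma Sol.pd_eq (h : Sol c u p) (e : ℝ × ℝ) :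
    LL (1 + pdt u p ^ 2) (-(pdx u p * pdt u p)) (1 + pdx u p ^ 2) (pd e u) p
    + (2 * pdt u p * pd e (pdt u) p * pdx (pdx u) p
      - 2 * (pdx u p * pd e (pdt u) p + pd e (pdx u) p * pdt u p) * pdx (pdt u) p
      + 2 * pdx u p * pd e (pdx u) p * pdt (pdt u) p)
    + c * (pd e (pdt u) p * (1 + pdx u p ^ 2 + pdt u p ^ 2)
      + pdt u p * (2 * pdx u p * pd e (pdx u) p + 2 * pdt u p * pd e (pdt u) p)) = 0 := by
  obtain ⟨hu, heq⟩ := h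
  have hx : DifferentiableAt ℝ (pdx u) p := Sm.diff hu.pdx
  have ht : DifferentiableAt ℝ (pdt u) p := Sm.diff hu.pdt
  have h0 : pd e (fun y => LL (1 + pdt u y ^ 2) (-(pdx u y * pdt u y)) (1 + pdx u y ^ 2) u y
    + c * (pdt u y * (1 + pdx u y ^ 2 + pdt u y ^ 2))) p = 0 := by
    rw [← pd_const (e := e) (p := p) 0]
    apply pd_congr
    filter_upwards [heq] with y hy
    rw [← hy]; ring
  have dS : DifferentiableAt ℝ (fun y => 1 + pdx u y ^ 2 + pdt u y ^ 2) p := by fun_prop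
  have dA : DifferentiableAt ℝ (fun y => 1 + pdt u y ^ 2) p := by fun_prop
  have dC : DifferentiableAt ℝ (fun y => 1 + pdx u y ^ 2) p := by fun_prop
  have dB : DifferentiableAt ℝ (fun y => (-(pdx u y * pdt u y))) p := by fun_prop
  have hxx : DifferentiableAt ℝ (pdx (pdx u)) p := Sm.diff hu.pdx.pdx
  have hxt : DifferentiableAt ℝ (pdx (pdt u)) p := Sm.diff hu.pdt.pdx
  have htt : DifferentiableAt ℝ (pdt (pdt u)) p := Sm.diff hu.pdt.pdt
  have dL : DifferentiableAt ℝ (fun y => LL (1 + pdt u y ^ 2) (-(pdx u y * pdt u y))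
      (1 + pdx u y ^ 2) u y) p := by simp only [LL]; fun_prop
  have hB : pd e (fun y => (-(pdx u y * pdt u y))) p
      = - (pdx u p * pd e (pdt u) p + pd e (pdx u) p * pdt u p) := by
    have := pd_const_mul (e := e) (-1) (hx.fun_mul ht)
    simp only [neg_mul, one_mul] at this
    rw [this, pd_mul hx ht]
  rw [pd_add dL ((ht.fun_mul dS).const_mul c), pd_const_mul c (ht.fun_mul dS), pd_LL_var dA dB dC hu,
    pd_mul ht dS, pd_gradSq hu, hB, pd_one_add_sq ht, pd_one_add_sq hx] at h0
  rw [← h0]; ring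

/-! ### The squared distance function -/

/-- The squared Euclidean distance to `z`. -/
def sqd (z p : ℝ × ℝ) : ℝ := (p.1 - z.1) ^ 2 + (p.2 - z.2) ^ 2

lemma sqd_self (z : ℝ × ℝ) : sqd z z = 0 := by simp [sqd]

lemma sqd_nonneg (z p : ℝ × ℝ) : 0 ≤ sqd z p := by unfold sqd; positivity

lemma continuous_sqd (z : ℝ × ℝ) : Continuous (sqd z) := by unfold sqd; fun_prop

lemma sm_sqd (z p : ℝ × ℝ) : Sm (sqd z) p := by
  unfold sqd Sm; fun_prop

lemma pd_fst : pd e (fun q : ℝ × ℝ => q.1) p = e.1 := by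
  simp [pd, fderiv_fst]

lemma pd_snd : pd e (fun q : ℝ × ℝ => q.2) p = e.2 := by
  simp [pd, fderiv_snd]

lemma pd_sqd (z : ℝ × ℝ) :
    pd e (sqd z) = fun q => 2 * e.1 * (q.1 - z.1) + 2 * e.2 * (q.2 - z.2) := by
  ext q
  have h1 : DifferentiableAt ℝ (fun q : ℝ × ℝ => q.1 - z.1) q := by fun_prop
  have h2 : DifferentiableAt ℝ (fun q : ℝ × ℝ => q.2 - z.2) q := by fun_prop
  have e1 : pd e (fun q : ℝ × ℝ => q.1 - z.1) q = e.1 := by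
    simp only [sub_eq_add_neg]
    rw [pd_add (by fun_prop) (by fun_prop), pd_const, pd_fst]; ring
  have e2 : pd e (fun q : ℝ × ℝ => q.2 - z.2) q = e.2 := by
    simp only [sub_eq_add_neg]
    rw [pd_add (by fun_prop) (by fun_prop), pd_const, pd_snd]; ring
  have : sqd z = fun q => (q.1 - z.1) ^ 2 + (q.2 - z.2) ^ 2 := rfl
  rw [this, pd_add (h1.fun_pow 2) (h2.fun_pow 2), pd_sq h1, pd_sq h2, e1, e2]; ring

lemma pdpd_sqd (z : ℝ × ℝ) :
    pd e' (pd e (sqd z)) p = 2 * e.1 * e'.1 + 2 * e.2 * e'.2 := by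
  rw [pd_sqd]
  have h1 : DifferentiableAt ℝ (fun q : ℝ × ℝ => q.1 - z.1) p := by fun_prop
  have h2 : DifferentiableAt ℝ (fun q : ℝ × ℝ => q.2 - z.2) p := by fun_prop
  rw [pd_add (h1.const_mul _) (h2.const_mul _), pd_const_mul _ h1, pd_const_mul _ h2]
  simp only [sub_eq_add_neg]
  rw [pd_add (by fun_prop) (by fun_prop), pd_add (by fun_prop) (by fun_prop), pd_const, pd_const,
    pd_fst, pd_snd]; ring

lemma isCompact_disc (z : ℝ × ℝ) (R : ℝ) : IsCompact {p | sqd z p ≤ R ^ 2} := by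
  refine (isCompact_closedBall z |R|).of_isClosed_subset
    (isClosed_le (continuous_sqd z) continuous_const) ?_
  intro p hp
  simp only [mem_ofPred_eq, sqd] at hp
  rw [Metric.mem_closedBall, Prod.dist_eq, max_le_iff, Real.dist_eq, Real.dist_eq]
  constructor <;> refine sq_le_sq.1 ?_ <;> nlinarith [sq_nonneg (p.1 - z.1), sq_nonneg (p.2 - z.2)]

end

section

/-! ### Interior gradient estimate -/

variable {f g : ℝ × ℝ → ℝ} {p e e' : ℝ × ℝ} {c : ℝ} {u : ℝ × ℝ → ℝ} {a b d : ℝ}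

lemma LL_const (k : ℝ) : LL a b d (fun _ => k) p = 0 := by
  have h : ∀ e, pd e (fun _ : ℝ × ℝ => k) = fun _ => 0 := fun e => by ext q; exact pd_const k
  simp only [LL, pdx_eq, pdt_eq, h, pd_const]; ring

/-- The squared area element `1 + u_x² + u_t²`. -/
noncomputable def area (u : ℝ × ℝ → ℝ) (p : ℝ × ℝ) : ℝ := 1 + pdx u p ^ 2 + pdt u p ^ 2

lemma one_le_area : 1 ≤ area u p := by unfold area; nlinarith [sq_nonneg (pdx u p), sq_nonneg (pdt u p)]

lemma sm_area (hu : Sm u p) : Sm (area u) p := by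
  have h1 : ContDiffAt ℝ ∞ (pdx u) p := hu.pdx
  have h2 : ContDiffAt ℝ ∞ (pdt u) p := hu.pdt
  unfold area Sm; fun_prop

lemma LL_area (hu : Sm u p) : LL a b d (area u) p
    = 2 * pdx u p * LL a b d (pdx u) p + 2 * pdt u p * LL a b d (pdt u) p
      + 2 * GG a b d (pdx u) (pdx u) p + 2 * GG a b d (pdt u) (pdt u) p := by
  have h : area u = fun y => (1 + pdx u y * pdx u y) + pdt u y * pdt u y := by
    ext y; simp only [area]; ring
  have h1 : Sm (fun y => pdx u y * pdx u y) p := ContDiffAt.mul hu.pdx hu.pdx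
  have h2 : Sm (fun y => pdt u y * pdt u y) p := ContDiffAt.mul hu.pdt hu.pdt
  have h0 : Sm (fun _ => (1 : ℝ)) p := contDiffAt_const
  rw [h, LL_add (h0.add h1) h2, LL_add h0 h1, LL_const, LL_mul hu.pdx hu.pdx, LL_mul hu.pdt hu.pdt]
  ring

lemma Sol.area_ineq (h : Sol c u p) :
    3 / 2 * GG (1 + pdt u p ^ 2) (-(pdx u p * pdt u p)) (1 + pdx u p ^ 2) (area u) (area u) p
    ≤ area u p * (LL (1 + pdt u p ^ 2) (-(pdx u p * pdt u p)) (1 + pdx u p ^ 2) (area u) p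
      + c * area u p * pdt (area u) p) := by
  have e0 := h.eq
  have ex := h.pd_eq (1, 0)
  have et := h.pd_eq (0, 1)
  have hx : pdx (area u) p = 2 * pdx u p * pdx (pdx u) p + 2 * pdt u p * pdx (pdt u) p :=
    pd_gradSq h.1
  have ht : pdt (area u) p = 2 * pdx u p * pdt (pdx u) p + 2 * pdt u p * pdt (pdt u) p :=
    pd_gradSq h.1
  have hc : pdt (pdx u) p = pdx (pdt u) p := pd_comm h.1
  rw [LL_area h.1]
  simp only [← pdx_eq, ← pdt_eq] at ex et
  simp only [GG, hx, ht, hc] at *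
  generalize LL (1 + pdt u p ^ 2) (-(pdx u p * pdt u p)) (1 + pdx u p ^ 2) (pdx u) p = Lp at *
  generalize LL (1 + pdt u p ^ 2) (-(pdx u p * pdt u p)) (1 + pdx u p ^ 2) (pdt u) p = Lq at *
  simp only [LL, area] at *
  generalize pdx (pdx u) p = r at *
  generalize pdx (pdt u) p = s at *
  generalize pdt (pdt u) p = t at *
  generalize pdx u p = P at *
  generalize pdt u p = Q at *
  have hLp : Lp = -(2 * P * (r * t - s ^ 2) + c * (s * (1 + P ^ 2 + Q ^ 2)
    + Q * (2 * P * r + 2 * Q * s))) := by linear_combination ex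
  have hLq : Lq = -(2 * Q * (r * t - s ^ 2) + c * (t * (1 + P ^ 2 + Q ^ 2)
    + Q * (2 * P * s + 2 * Q * t))) := by linear_combination et
  rw [hLp, hLq]
  have key : 0 ≤ 2 * (r ^ 2 + 2 * s ^ 2 + t ^ 2 + 2 * ((Q * r - P * s) ^ 2 + (Q * s - P * t) ^ 2)
    + (Q ^ 2 * r - 2 * P * Q * s + P ^ 2 * t) ^ 2) := by positivity
  rw [← sub_nonneg]
  refine key.trans_eq ?_
  linear_combination (2 * (P * (2 * P * r + 2 * Q * s) + Q * (2 * P * s + 2 * Q * t))) * e0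

lemma exists_isLocalMax_disc {z : ℝ × ℝ} {R : ℝ} {F φ : ℝ × ℝ → ℝ} 
    (hF : ContinuousOn F {p | sqd z p ≤ R ^ 2}) (hφ : ContinuousOn φ {p | sqd z p ≤ R ^ 2})
    (hb : ∀ p, sqd z p ≤ R ^ 2 → φ p ≤ 1 - sqd z p / R ^ 2) (hR : 0 < R)
    (h0 : ∀ p, sqd z p ≤ R ^ 2 → φ p = 0 → F p = 0) (hz : 0 ≤ φ z) (hFz : 0 < F z) :
    ∃ p, sqd z p ≤ R ^ 2 ∧ 0 < φ p ∧ IsLocalMax F p ∧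
      ∀ q, sqd z q ≤ R ^ 2 → 0 ≤ φ q → F q ≤ F p := by
  have hT : IsCompact ({p | sqd z p ≤ R ^ 2} ∩ φ ⁻¹' Ici 0) :=
    (isCompact_disc z R).of_isClosed_subset
      (hφ.preimage_isClosed_of_isClosed (isCompact_disc z R).isClosed isClosed_Ici)
      inter_subset_left
  have hzT : z ∈ {p | sqd z p ≤ R ^ 2} ∩ φ ⁻¹' Ici 0 :=
    ⟨by simp [sqd_self]; positivity, hz⟩
  obtain ⟨p, ⟨hp1, hp2⟩, hmax⟩ := hT.exists_isMaxOn ⟨z, hzT⟩ (hF.mono inter_subset_left)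
  have hp1 : sqd z p ≤ R ^ 2 := hp1
  have hp2 : 0 ≤ φ p := hp2
  have hle : ∀ q, sqd z q ≤ R ^ 2 → 0 ≤ φ q → F q ≤ F p := fun q h1 h2 => hmax ⟨h1, h2⟩
  have hpos : 0 < φ p := by
    refine lt_of_le_of_ne hp2 fun h => ?_
    have h1 := hle z hzT.1 hz
    rw [h0 p hp1 h.symm] at h1
    linarith
  have hlt : sqd z p < R ^ 2 := by
    have h1 := hb p hp1
    by_contra! h2
    have : 1 ≤ sqd z p / R ^ 2 := by rw [le_div_iff₀ (by positivity)]; linarith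
    linarith
  have hnhds : ∀ᶠ q in 𝓝 p, sqd z q < R ^ 2 :=
    (continuous_sqd z).continuousAt.eventually_lt continuousAt_const hlt
  have hD : {p | sqd z p ≤ R ^ 2} ∈ 𝓝 p := by
    filter_upwards [hnhds] with q hq using hq.le
  have hφp : ∀ᶠ q in 𝓝 p, 0 < φ q :=
    continuousAt_const.eventually_lt (hφ.continuousAt hD) hpos
  refine ⟨p, hp1, hpos, ?_, hle⟩
  filter_upwards [hnhds, hφp] with q h1 h2 using hle q h1.le h2.le

lemma coef_det (P Q : ℝ) : 0 ≤ (1 + Q ^ 2) * (1 + P ^ 2) - (-(P * Q)) ^ 2 := by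
  nlinarith [sq_nonneg P, sq_nonneg Q]

lemma coef_pos (Q : ℝ) : 0 < 1 + Q ^ 2 := by positivity

/-- If `η² (1 + |Du|²)` has a local maximum where `η > 0`, then `η` is a supersolution there. -/
lemma Sol.cutoff_nonpos {η : ℝ × ℝ → ℝ} (h : Sol c u p) (hη : Sm η p) (hpos : 0 < η p)
    (hmax : IsLocalMax (fun q => η q * η q * area u q) p) :
    LL (1 + pdt u p ^ 2) (-(pdx u p * pdt u p)) (1 + pdx u p ^ 2) η p
      + c * area u p * pdt η p ≤ 0 := by
  have hS := one_le_area (u := u) (p := p)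
  have hSm := sm_area h.1
  have hζ : Sm (fun q => η q * η q) p := hη.mul hη
  have hF : Sm (fun q => η q * η q * area u q) p := hζ.mul hSm
  have hLL := LL_nonpos_of_isLocalMax (coef_pos (pdt u p)) (coef_det (pdx u p) (pdt u p)) hF hmax
  have hD : ∀ e, η p * pd e (area u) p = -2 * area u p * pd e η p := by
    intro e
    have h1 := pd_eq_zero_of_isLocalMax (e := e) hmax
    rw [pd_mul hζ.diff hSm.diff, pd_mul hη.diff hη.diff] at h1
    have : η p * (η p * pd e (area u) p + 2 * area u p * pd e η p) = 0 := by rw [← h1]; ring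
    rcases mul_eq_zero.1 this with h2 | h2
    · exact absurd h2 hpos.ne'
    · linarith
  have hx : η p * pdx (area u) p = -2 * area u p * pdx η p := hD _
  have ht : η p * pdt (area u) p = -2 * area u p * pdt η p := hD _
  have hineq := h.area_ineq
  rw [LL_mul hζ hSm, LL_mul hη hη] at hLL
  have hζx : pdx (fun q => η q * η q) p = 2 * η p * pdx η p := by
    simp only [pdx_eq]; rw [pd_mul hη.diff hη.diff]; ring
  have hζt : pdt (fun q => η q * η q) p = 2 * η p * pdt η p := by
    simp only [pdt_eq]; rw [pd_mul hη.diff hη.diff]; ring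
  simp only [GG, hζx, hζt] at hLL hineq
  generalize LL (1 + pdt u p ^ 2) (-(pdx u p * pdt u p)) (1 + pdx u p ^ 2) η p = Lη at *
  generalize LL (1 + pdt u p ^ 2) (-(pdx u p * pdt u p)) (1 + pdx u p ^ 2) (area u) p = LS at *
  generalize area u p = S at *
  generalize pdx (area u) p = Sx at *
  generalize pdt (area u) p = St at *
  generalize 1 + pdt u p ^ 2 = A at *
  generalize -(pdx u p * pdt u p) = B at *
  generalize 1 + pdx u p ^ 2 = C at *
  generalize pdx η p = ηx at *
  generalize pdt η p = ηt at *
  generalize η p = y at *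
  have hxx : y ^ 2 * (Sx * Sx) = 4 * S ^ 2 * (ηx * ηx) := by
    linear_combination (y * Sx - 2 * S * ηx) * hx
  have htt : y ^ 2 * (St * St) = 4 * S ^ 2 * (ηt * ηt) := by
    linear_combination (y * St - 2 * S * ηt) * ht
  have hxt : y ^ 2 * (Sx * St) = 4 * S ^ 2 * (ηx * ηt) := by
    linear_combination (y * St) * hx - 2 * S * ηx * ht
  have key : S * (2 * y * S) * (Lη + c * S * ηt) ≤ 0 := by
    have h1 : 3 / 2 * (4 * S ^ 2 * (A * (ηx * ηx) + B * (ηx * ηt + ηt * ηx) + C * (ηt * ηt)))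
        ≤ S * (y ^ 2 * LS + c * S * y * (-2 * S * ηt)) := by
      have := mul_le_mul_of_nonneg_left hineq (sq_nonneg y)
      have e1 : y ^ 2 * (3 / 2 * (A * (Sx * Sx) + B * (Sx * St + St * Sx) + C * (St * St)))
        = 3 / 2 * (4 * S ^ 2 * (A * (ηx * ηx) + B * (ηx * ηt + ηt * ηx) + C * (ηt * ηt))) := by
        linear_combination 3 / 2 * A * hxx + 3 * B * hxt + 3 / 2 * C * htt
      have e2 : y ^ 2 * (S * (LS + c * S * St)) = S * (y ^ 2 * LS + c * S * y * (-2 * S * ηt)) := by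
        linear_combination S * c * S * y * ht
      linarith
    have h2 := mul_le_mul_of_nonneg_left hLL (by linarith : (0 : ℝ) ≤ S)
    have e3 : S * (y * y * LS + S * (y * Lη + y * Lη
          + 2 * (A * (ηx * ηx) + B * (ηx * ηt + ηt * ηx) + C * (ηt * ηt)))
        + 2 * (A * (2 * y * ηx * Sx) + B * (2 * y * ηx * St + 2 * y * ηt * Sx)
          + C * (2 * y * ηt * St)))
        = S * (y ^ 2 * LS) + 2 * y * S ^ 2 * Lη
          - 6 * S ^ 2 * (A * (ηx * ηx) + B * (ηx * ηt + ηt * ηx) + C * (ηt * ηt)) := by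
      linear_combination (4 * S * A * ηx + 4 * S * B * ηt) * hx
        + (4 * S * B * ηx + 4 * S * C * ηt) * ht
    nlinarith
  by_contra! hcon
  have : 0 < S * (2 * y * S) * (Lη + c * S * ηt) := by positivity
  linarith

lemma hasDerivAt_mul_exp (a K y : ℝ) :
    HasDerivAt (fun y => a * rexp (K * y)) (a * K * rexp (K * y)) y := by
  have h : HasDerivAt (fun y => K * y) K y := by simpa using (hasDerivAt_id y).const_mul K
  exact (h.exp.const_mul a).congr_deriv (by ring)

lemma gradient_bound_aux {k R C1 K S0 E P Q X T c : ℝ} (hkp : 0 < k) (hR : 0 < R)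
    (hC1 : C1 = (4 + 2 * |c| * R) / R ^ 2) (hC1p : 0 < C1) (hK : K = 4 * C1 / k ^ 2)
    (hKp : 0 < K) (hS0 : S0 = 2 + 32 / (k ^ 2 * R ^ 2)) (hexp : 0 < E)
    (hsq' : X ^ 2 + T ^ 2 ≤ R ^ 2)
    (hsup : K * E * (k * -(c * Q * (1 + P ^ 2 + Q ^ 2))
          + -1 / R ^ 2 * (2 * (1 + Q ^ 2) + 2 * (1 + P ^ 2)))
        + K ^ 2 * E *
          ((1 + Q ^ 2) * ((k * P + -1 / R ^ 2 * (2 * X)) * (k * P + -1 / R ^ 2 * (2 * X))) +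
              -(P * Q) *
                ((k * P + -1 / R ^ 2 * (2 * X)) * (k * Q + -1 / R ^ 2 * (2 * T)) +
                  (k * Q + -1 / R ^ 2 * (2 * T)) * (k * P + -1 / R ^ 2 * (2 * X))) +
            (1 + P ^ 2) * ((k * Q + -1 / R ^ 2 * (2 * T)) * (k * Q + -1 / R ^ 2 * (2 * T))))
        + c * (1 + P ^ 2 + Q ^ 2) * (K * E * (k * Q + -1 / R ^ 2 * (2 * T))) ≤ 0) :
    1 + P ^ 2 + Q ^ 2 ≤ S0 := by
  obtain ⟨i, hi⟩ : ∃ i, i = 1 / R ^ 2 := ⟨_, rfl⟩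
  have hip : 0 < i := by rw [hi]; positivity
  have hiR : i * R ^ 2 = 1 := by rw [hi]; field_simp
  have hi' : -1 / R ^ 2 = -i := by rw [hi]; ring
  rw [hi'] at hsup
  have h1 : K * (k ^ 2 * (P ^ 2 + Q ^ 2) - 4 * k * i * (P * X + Q * T))
      ≤ i * (2 * (1 + Q ^ 2) + 2 * (1 + P ^ 2)) + 2 * i * c * T * (1 + P ^ 2 + Q ^ 2) := by
    by_contra! hcon
    have h2 : 0 ≤ 4 * i ^ 2 * (X ^ 2 + T ^ 2 + (Q * X - P * T) ^ 2) := by positivity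
    have h3 : 0 < E * K * (K * (k ^ 2 * (P ^ 2 + Q ^ 2) - 4 * k * i * (P * X + Q * T)
        + 4 * i ^ 2 * (X ^ 2 + T ^ 2 + (Q * X - P * T) ^ 2))
      - (i * (2 * (1 + Q ^ 2) + 2 * (1 + P ^ 2)) + 2 * i * c * T * (1 + P ^ 2 + Q ^ 2))) := by
      have : 0 ≤ K * (4 * i ^ 2 * (X ^ 2 + T ^ 2 + (Q * X - P * T) ^ 2)) := by positivity
      apply mul_pos (by positivity)
      linarith
    refine absurd hsup (not_le.2 (h3.trans_eq ?_))
    ring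
  have h2 : i * (2 * (1 + Q ^ 2) + 2 * (1 + P ^ 2)) + 2 * i * c * T * (1 + P ^ 2 + Q ^ 2)
      ≤ C1 * (1 + P ^ 2 + Q ^ 2) := by
    have hT : |T| ≤ R := abs_le_of_sq_le_sq (by nlinarith [sq_nonneg X]) hR.le
    have hcT : c * T ≤ |c| * R := (le_abs_self _).trans (by rw [abs_mul]; gcongr)
    have : C1 = i * (4 + 2 * |c| * R) := by rw [hC1, hi]; ring
    rw [this]
    have h3 : 0 ≤ i * (1 + P ^ 2 + Q ^ 2) * (|c| * R - c * T) :=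
      mul_nonneg (by positivity) (by linarith)
    have h4 := mul_nonneg hip.le (add_nonneg (sq_nonneg P) (sq_nonneg Q))
    have h5 : i * (4 + 2 * |c| * R) * (1 + P ^ 2 + Q ^ 2) -
      (i * (2 * (1 + Q ^ 2) + 2 * (1 + P ^ 2)) + 2 * i * c * T * (1 + P ^ 2 + Q ^ 2))
      = 2 * (i * (P ^ 2 + Q ^ 2)) + 2 * (i * (1 + P ^ 2 + Q ^ 2) * (|c| * R - c * T)) := by ring
    linarith
  have h3 : 4 * k * i * (P * X + Q * T) ≤ k ^ 2 / 2 * (P ^ 2 + Q ^ 2) + 8 * i := by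
    have : 8 * i ^ 2 * (X ^ 2 + T ^ 2) ≤ 8 * i := by
      calc 8 * i ^ 2 * (X ^ 2 + T ^ 2) ≤ 8 * i ^ 2 * R ^ 2 := by gcongr
        _ = 8 * i := by linear_combination 8 * i * hiR
    have h4 : 0 ≤ (k * P - 4 * i * X) ^ 2 + (k * Q - 4 * i * T) ^ 2 := by positivity
    have h5 : (k * P - 4 * i * X) ^ 2 + (k * Q - 4 * i * T) ^ 2 = k ^ 2 * (P ^ 2 + Q ^ 2)
      - 2 * (4 * k * i * (P * X + Q * T)) + 2 * (8 * i ^ 2 * (X ^ 2 + T ^ 2)) := by ring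
    linarith
  have h4 : K * (k ^ 2 / 2 * (P ^ 2 + Q ^ 2) - 8 * i) ≤ C1 * (1 + P ^ 2 + Q ^ 2) := by
    exact (mul_le_mul_of_nonneg_left (by linarith) hKp.le).trans (h1.trans h2)
  have hKk : K * k ^ 2 = 4 * C1 := by rw [hK]; field_simp
  have hKi : K * i = C1 * (4 / (k ^ 2 * R ^ 2)) := by rw [hK, hi]; field_simp
  have h5 : C1 * (2 * (P ^ 2 + Q ^ 2) - 32 / (k ^ 2 * R ^ 2)) ≤ C1 * (1 + P ^ 2 + Q ^ 2) := by
    refine le_trans (le_of_eq ?_) h4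
    have : (32 : ℝ) / (k ^ 2 * R ^ 2) = 8 * (4 / (k ^ 2 * R ^ 2)) := by ring
    rw [this]
    linear_combination -(P ^ 2 + Q ^ 2) / 2 * hKk + 8 * hKi
  have h6 := le_of_mul_le_mul_left h5 hC1p
  rw [hS0]; linarith

set_option maxHeartbeats 1000000 in
/-- Interior gradient estimate for translator graphs. -/
lemma gradient_estimate (c : ℝ) {M R : ℝ} (hM : 0 < M) (hR : 0 < R) :
    ∃ G, ∀ (u : ℝ × ℝ → ℝ) (z : ℝ × ℝ), (∀ p, sqd z p ≤ R ^ 2 → Sol c u p ∧ |u p| ≤ M) →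
      ∀ p, sqd z p ≤ R ^ 2 / 4 → area u p ≤ G := by
  obtain ⟨k, hk⟩ : ∃ k, k = 1 / (4 * M) := ⟨_, rfl⟩
  have hkp : 0 < k := by rw [hk]; positivity
  have hkM : k * M = 1 / 4 := by rw [hk]; field_simp
  obtain ⟨C1, hC1⟩ : ∃ C1, C1 = (4 + 2 * |c| * R) / R ^ 2 := ⟨_, rfl⟩
  have hC1p : 0 < C1 := by rw [hC1]; positivity
  obtain ⟨K, hK⟩ : ∃ K, K = 4 * C1 / k ^ 2 := ⟨_, rfl⟩
  have hKp : 0 < K := by rw [hK]; positivity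
  obtain ⟨S0, hS0⟩ : ∃ S0, S0 = 2 + 32 / (k ^ 2 * R ^ 2) := ⟨_, rfl⟩
  obtain ⟨h, hh⟩ : ∃ h, h = rexp (K * (1 / 4)) - 1 := ⟨_, rfl⟩
  have hhp : 0 < h := by
    have : 1 < rexp (K * (1 / 4)) := Real.one_lt_exp_iff.2 (by positivity)
    rw [hh]; linarith
  refine ⟨rexp K ^ 2 * S0 / h ^ 2, fun u z hu p hp => ?_⟩
  set φ : ℝ × ℝ → ℝ := fun q => (k * u q + 3 / 4) + (-1 / R ^ 2) * sqd z q with hφdef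
  set η : ℝ × ℝ → ℝ := fun q => rexp (K * φ q) - 1 with hηdef
  have hsmφ : ∀ q, sqd z q ≤ R ^ 2 → Sm φ q := by
    intro q hq
    have h1 : ContDiffAt ℝ ∞ u q := (hu q hq).1.1
    have h2 : ContDiffAt ℝ ∞ (sqd z) q := sm_sqd z q
    simp only [hφdef, Sm]; fun_prop
  have hsmη : ∀ q, sqd z q ≤ R ^ 2 → Sm η q := by
    intro q hq
    have h1 : ContDiffAt ℝ ∞ φ q := hsmφ q hq
    simp only [hηdef, Sm]; fun_prop
  have hφle : ∀ q, sqd z q ≤ R ^ 2 → φ q ≤ 1 - sqd z q / R ^ 2 := by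
    intro q hq
    have h1 := (abs_le.1 (hu q hq).2).2
    have : k * u q ≤ k * M := by gcongr
    simp only [hφdef]
    have e : -1 / R ^ 2 * sqd z q = - (sqd z q / R ^ 2) := by ring
    linarith
  have hφge : ∀ q, sqd z q ≤ R ^ 2 / 4 → 1 / 4 ≤ φ q := by
    intro q hq
    have h1 := (abs_le.1 (hu q (hq.trans (by nlinarith [sq_nonneg R]))).2).1
    have : k * (-M) ≤ k * u q := by gcongr
    have h2 : sqd z q / R ^ 2 ≤ 1 / 4 := by rw [div_le_iff₀ (by positivity)]; linarith
    simp only [hφdef]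
    have e : -1 / R ^ 2 * sqd z q = - (sqd z q / R ^ 2) := by ring
    linarith
  have hηge : ∀ q, sqd z q ≤ R ^ 2 / 4 → h ≤ η q := by
    intro q hq
    simp only [hηdef, hh]
    have := hφge q hq
    gcongr
  have hz4 : sqd z z ≤ R ^ 2 / 4 := by rw [sqd_self]; positivity
  have hη0 : 0 < η z := lt_of_lt_of_le hhp (hηge z hz4)
  obtain ⟨p₁, hp₁, hφ₁, hmax, hle⟩ := exists_isLocalMax_disc (z := z) (R := R) (φ := φ)
    (F := fun q => η q * η q * area u q)
    (fun q hq => (((hsmη q hq).mul (hsmη q hq)).mul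
      (sm_area (hu q hq).1.1)).continuousAt.continuousWithinAt)
    (fun q hq => (hsmφ q hq).continuousAt.continuousWithinAt) hφle hR
    (fun q _ hq => by simp [hηdef, hq]) ((by norm_num : (0 : ℝ) ≤ 1 / 4).trans (hφge z hz4))
    (by have := one_le_area (u := u) (p := z); positivity)
  have hsol := (hu p₁ hp₁).1
  have hη₁ : 0 < η p₁ := by
    have : 1 < rexp (K * φ p₁) := Real.one_lt_exp_iff.2 (by positivity)
    simp only [hηdef]; linarith
  have hsup := hsol.cutoff_nonpos (hsmη p₁ hp₁) hη₁ hmax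
  have hd1 : ∀ y : ℝ, HasDerivAt (fun y => rexp (K * y) - 1) (K * rexp (K * y)) y := fun y => by
    simpa using (hasDerivAt_mul_exp 1 K y).sub_const 1
  have hd2 : ∀ y : ℝ, HasDerivAt (fun y => K * rexp (K * y)) (K ^ 2 * rexp (K * y)) y := fun y => by
    simpa [sq] using hasDerivAt_mul_exp K K y
  have hsm := hsmφ p₁ hp₁
  have hLη := LL_comp (a := 1 + pdt u p₁ ^ 2) (b := -(pdx u p₁ * pdt u p₁)) (d := 1 + pdx u p₁ ^ 2)
    (φ := fun y => rexp (K * y) - 1) (φ' := fun y => K * rexp (K * y))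
    (Eventually.of_forall hd1) (hd2 (φ p₁)) hsm
  have hηt : pdt η p₁ = K * rexp (K * φ p₁) * pdt φ p₁ := pd_comp (hd1 (φ p₁)) hsm.diff
  have hLη' : LL (1 + pdt u p₁ ^ 2) (-(pdx u p₁ * pdt u p₁)) (1 + pdx u p₁ ^ 2) η p₁ = _ := hLη
  rw [hLη', hηt] at hsup
  have hsmu : Sm u p₁ := hsol.1
  have hku : Sm (fun q => k * u q) p₁ := contDiffAt_const.mul hsmu
  have hku' : Sm (fun q => k * u q + 3 / 4) p₁ := hku.add contDiffAt_const
  have hsq : Sm (fun q => (-1 / R ^ 2) * sqd z q) p₁ := contDiffAt_const.mul (sm_sqd z p₁)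
  have hφd : ∀ e, pd e φ p₁ = k * pd e u p₁ + (-1 / R ^ 2) * pd e (sqd z) p₁ := by
    intro e
    simp only [hφdef]
    rw [pd_add hku'.diff hsq.diff, pd_add hku.diff (differentiableAt_const _), pd_const,
      pd_const_mul _ hsmu.diff, pd_const_mul _ (sm_sqd z p₁).diff]; ring
  have hLφ : LL (1 + pdt u p₁ ^ 2) (-(pdx u p₁ * pdt u p₁)) (1 + pdx u p₁ ^ 2) φ p₁
      = k * LL (1 + pdt u p₁ ^ 2) (-(pdx u p₁ * pdt u p₁)) (1 + pdx u p₁ ^ 2) u p₁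
        + (-1 / R ^ 2) * (2 * (1 + pdt u p₁ ^ 2) + 2 * (1 + pdx u p₁ ^ 2)) := by
    simp only [hφdef]
    rw [LL_add hku' hsq, LL_add hku contDiffAt_const, LL_const, LL_const_mul _ hsmu,
      LL_const_mul _ (sm_sqd z p₁)]
    congr 2
    · ring
    · simp only [LL, pdx_eq, pdt_eq, pdpd_sqd]; ring
  have hφx : pdx φ p₁ = k * pdx u p₁ + (-1 / R ^ 2) * (2 * (p₁.1 - z.1)) := by
    have := hφd (1, 0); rw [pd_sqd] at this; simpa [pdx_eq] using this
  have hφt : pdt φ p₁ = k * pdt u p₁ + (-1 / R ^ 2) * (2 * (p₁.2 - z.2)) := by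
    have := hφd (0, 1); rw [pd_sqd] at this; simpa [pdt_eq] using this
  have heq := hsol.eq
  have hbound : area u p₁ ≤ S0 := by
    have hexp := Real.exp_pos (K * φ p₁)
    have hsq' : (p₁.1 - z.1) ^ 2 + (p₁.2 - z.2) ^ 2 ≤ R ^ 2 := hp₁
    rw [hLφ] at hsup
    simp only [GG, hφx, hφt] at hsup
    unfold area at *
    generalize LL (1 + pdt u p₁ ^ 2) (-(pdx u p₁ * pdt u p₁)) (1 + pdx u p₁ ^ 2) u p₁ = Lu at *
    generalize pdx u p₁ = P at *
    generalize pdt u p₁ = Q at *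
    generalize p₁.1 - z.1 = X at *
    generalize p₁.2 - z.2 = T at *
    generalize rexp (K * φ p₁) = E at *
    clear hLη hLη' hmax hle hφd hφx hφt hLφ
    have hLu : Lu = - (c * Q * (1 + P ^ 2 + Q ^ 2)) := by linarith
    subst hLu
    exact gradient_bound_aux hkp hR hC1 hC1p hK hKp hS0 hexp hsq' hsup
  have hφ1 : φ p₁ ≤ 1 := (hφle p₁ hp₁).trans (by
    have := sqd_nonneg z p₁
    have : 0 ≤ sqd z p₁ / R ^ 2 := by positivity
    linarith)
  have hηle : η p₁ ≤ rexp K := by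
    have : rexp (K * φ p₁) ≤ rexp K := Real.exp_le_exp.2 (by nlinarith)
    simp only [hηdef]; linarith
  have hpR : sqd z p ≤ R ^ 2 := hp.trans (by nlinarith [sq_nonneg R])
  have hfin := hle p hpR ((by norm_num : (0 : ℝ) ≤ 1 / 4).trans (hφge p hp))
  have hS := one_le_area (u := u) (p := p)
  have hS1 := one_le_area (u := u) (p := p₁)
  rw [le_div_iff₀ (by positivity)]
  have hge := hηge p hp
  calc area u p * h ^ 2 ≤ area u p * η p ^ 2 := by gcongr
    _ = η p * η p * area u p := by ring
    _ ≤ η p₁ * η p₁ * area u p₁ := hfin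
    _ ≤ rexp K * rexp K * S0 := by gcongr
    _ = rexp K ^ 2 * S0 := by ring

end

/-! ### Interior energy estimate for the gradient -/

section Energy

open MeasureTheory

/-- The closed square with centre `z` and half side `r`. -/
def Sq (z : ℝ × ℝ) (r : ℝ) : Set (ℝ × ℝ) := Icc (z.1 - r, z.2 - r) (z.1 + r, z.2 + r)

lemma mem_Sq {z p : ℝ × ℝ} {r : ℝ} : p ∈ Sq z r ↔ |p.1 - z.1| ≤ r ∧ |p.2 - z.2| ≤ r := by
  simp only [Sq, mem_Icc, Prod.le_def, abs_le]
  constructor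
  · rintro ⟨⟨h1, h2⟩, h3, h4⟩
    exact ⟨⟨by linarith, by linarith⟩, by linarith, by linarith⟩
  · rintro ⟨⟨h1, h2⟩, h3, h4⟩
    exact ⟨⟨by linarith, by linarith⟩, by linarith, by linarith⟩

lemma Sq_mono {z : ℝ × ℝ} {r s : ℝ} (h : r ≤ s) : Sq z r ⊆ Sq z s := fun p hp => by
  rw [mem_Sq] at *; exact ⟨hp.1.trans h, hp.2.trans h⟩

lemma isCompact_Sq (z : ℝ × ℝ) (r : ℝ) : IsCompact (Sq z r) := isCompact_Icc

lemma measurableSet_Sq (z : ℝ × ℝ) (r : ℝ) : MeasurableSet (Sq z r) := measurableSet_Icc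

/-- Squared norm of the Hessian. -/
noncomputable def hs (u : ℝ × ℝ → ℝ) (p : ℝ × ℝ) : ℝ :=
  pdx (pdx u) p ^ 2 + 2 * pdx (pdt u) p ^ 2 + pdt (pdt u) p ^ 2

lemma hs_nonneg (u : ℝ × ℝ → ℝ) (p : ℝ × ℝ) : 0 ≤ hs u p := by unfold hs; positivity

lemma Sm.hs {u : ℝ × ℝ → ℝ} {p : ℝ × ℝ} (h : Sm u p) : Sm (hs u) p := by
  have h1 : ContDiffAt ℝ ∞ (_root_.pdx (_root_.pdx u)) p := h.pdx.pdx
  have h2 : ContDiffAt ℝ ∞ (_root_.pdx (_root_.pdt u)) p := h.pdt.pdx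
  have h3 : ContDiffAt ℝ ∞ (_root_.pdt (_root_.pdt u)) p := h.pdt.pdt
  show ContDiffAt ℝ ∞ (fun p => TranslatorAux.hs u p) p
  unfold TranslatorAux.hs; fun_prop

lemma hessian_bound {c p q r s τ : ℝ}
    (h : (1 + q ^ 2) * r + 2 * (-(p * q)) * s + (1 + p ^ 2) * τ + c * q * (1 + p ^ 2 + q ^ 2) = 0) :
    r ^ 2 + 2 * s ^ 2 + τ ^ 2
      ≤ (c * q * (1 + p ^ 2 + q ^ 2)) ^ 2 - 2 * (1 + p ^ 2 + q ^ 2) * (r * τ - s ^ 2) := by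
  have h0 : c * q * (1 + p ^ 2 + q ^ 2)
    = -((1 + q ^ 2) * r + 2 * (-(p * q)) * s + (1 + p ^ 2) * τ) := by linarith
  have h1 : (c * q * (1 + p ^ 2 + q ^ 2)) ^ 2 - 2 * (1 + p ^ 2 + q ^ 2) * (r * τ - s ^ 2)
      = r ^ 2 + 2 * s ^ 2 + τ ^ 2 + (2 * ((q * r - p * s) ^ 2 + (q * s - p * τ) ^ 2)
        + (q ^ 2 * r - 2 * p * q * s + p ^ 2 * τ) ^ 2) := by
    rw [h0]; ring
  rw [h1]
  have : 0 ≤ 2 * ((q * r - p * s) ^ 2 + (q * s - p * τ) ^ 2)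
        + (q ^ 2 * r - 2 * p * q * s + p ^ 2 * τ) ^ 2 := by positivity
  linarith

lemma energy_pointwise {c p q r s τ G χ χx χt ρ : ℝ}
    (h : (1 + q ^ 2) * r + 2 * (-(p * q)) * s + (1 + p ^ 2) * τ + c * q * (1 + p ^ 2 + q ^ 2) = 0)
    (hG : 1 + p ^ 2 + q ^ 2 ≤ G) (hχ : χ ^ 2 ≤ ρ ^ 8) (hχ' : χx ^ 2 + χt ^ 2 ≤ 8 * ρ ^ 6) :
    χ ^ 2 * (r ^ 2 + 2 * s ^ 2 + τ ^ 2)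
      ≤ 2 * G * (c ^ 2 * ρ ^ 8 * G ^ 2 + 64 * G ^ 2 * ρ ^ 6)
        - 4 * G * (χ ^ 2 * (r * τ - s ^ 2) + 2 * χ * p * (χx * τ - χt * s)) := by
  obtain ⟨S, hS⟩ : ∃ S, S = 1 + p ^ 2 + q ^ 2 := ⟨_, rfl⟩
  have hb := hessian_bound h
  rw [← hS] at hb hG
  have hS1 : 1 ≤ S := by rw [hS]; nlinarith [sq_nonneg p, sq_nonneg q]
  have hG1 : 1 ≤ G := hS1.trans hG
  have hpS : p ^ 2 ≤ S := by rw [hS]; nlinarith [sq_nonneg q]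
  have hqS : q ^ 2 ≤ S := by rw [hS]; nlinarith [sq_nonneg p]
  set H := r ^ 2 + 2 * s ^ 2 + τ ^ 2 with hH
  have hH0 : 0 ≤ H := by positivity
  set D := r * τ - s ^ 2
  -- divide by the area
  have h1 : H ≤ G * (c ^ 2 * G ^ 2 - 2 * D) := by
    have e : H / S ≤ c ^ 2 * G ^ 2 - 2 * D := by
      rw [div_le_iff₀ (by linarith)]
      refine hb.trans ?_
      have : c ^ 2 * S * (q ^ 2 * S) ≤ c ^ 2 * S * (G * G) := by gcongr; exact hqS.trans hG
      nlinarith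
    have : H / G ≤ H / S := by gcongr
    have := this.trans e
    rwa [div_le_iff₀ (by linarith), mul_comm] at this
  have h2 : χ ^ 2 * H ≤ χ ^ 2 * (G * (c ^ 2 * G ^ 2 - 2 * D)) := by gcongr
  have h3 : χ ^ 2 * (c ^ 2 * G ^ 2) ≤ ρ ^ 8 * (c ^ 2 * G ^ 2) := by gcongr
  have h4 : 8 * G * (χ * p * (χx * τ - χt * s)) ≤ χ ^ 2 * H + 128 * G ^ 3 * ρ ^ 6 := by
    have e1 : 8 * G * (χ * p * (χx * τ - χt * s))
        ≤ χ ^ 2 * (τ ^ 2 + s ^ 2) + 16 * G ^ 2 * p ^ 2 * (χx ^ 2 + χt ^ 2) := by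
      nlinarith [sq_nonneg (χ * τ - 4 * G * p * χx), sq_nonneg (χ * s + 4 * G * p * χt)]
    have e2 : χ ^ 2 * (τ ^ 2 + s ^ 2) ≤ χ ^ 2 * H := by
      gcongr; rw [hH]; nlinarith [sq_nonneg r, sq_nonneg s]
    have e3 : 16 * G ^ 2 * p ^ 2 * (χx ^ 2 + χt ^ 2) ≤ 16 * G ^ 2 * G * (8 * ρ ^ 6) := by
      gcongr; exact hpS.trans hG
    linarith
  have h3' := mul_le_mul_of_nonneg_left h3 (by linarith : 0 ≤ G)
  linarith

lemma integral_div_eq_zero {z : ℝ × ℝ} {ρ : ℝ} (hρ : 0 < ρ) {f g : ℝ × ℝ → ℝ}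
    (hf : ∀ p ∈ Sq z ρ, Sm f p) (hg : ∀ p ∈ Sq z ρ, Sm g p)
    (hf0 : ∀ p, (p.1 - z.1) ^ 2 = ρ ^ 2 → f p = 0)
    (hg0 : ∀ p, (p.2 - z.2) ^ 2 = ρ ^ 2 → g p = 0) :
    ∫ p in Sq z ρ, (pdx f p + pdt g p) = 0 := by
  have hle : (z.1 - ρ, z.2 - ρ) ≤ (z.1 + ρ, z.2 + ρ) := by
    constructor <;> simp <;> linarith
  have hsub : Ioo (z.1 - ρ) (z.1 + ρ) ×ˢ Ioo (z.2 - ρ) (z.2 + ρ) ⊆ Sq z ρ := by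
    rw [Sq, ← Icc_prod_Icc]; exact prod_mono Ioo_subset_Icc_self Ioo_subset_Icc_self
  have := integral_divergence_prod_Icc_of_hasFDerivAt_of_le f g (fderiv ℝ f) (fderiv ℝ g)
    (z.1 - ρ, z.2 - ρ) (z.1 + ρ, z.2 + ρ) hle
    (fun p hp => (hf p hp).continuousAt.continuousWithinAt)
    (fun p hp => (hg p hp).continuousAt.continuousWithinAt)
    (fun p hp => (hf p (hsub hp)).diff.hasFDerivAt)
    (fun p hp => (hg p (hsub hp)).diff.hasFDerivAt)
    (ContinuousOn.integrableOn_compact isCompact_Icc fun p hp =>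
      ((hf p hp).pdx.continuousAt.add (hg p hp).pdt.continuousAt).continuousWithinAt)
  refine Eq.trans this ?_
  have e1 : ∀ x, g (x, z.2 + ρ) = 0 := fun x => hg0 _ (by simp)
  have e2 : ∀ x, g (x, z.2 - ρ) = 0 := fun x => hg0 _ (by simp)
  have e3 : ∀ x, f (z.1 + ρ, x) = 0 := fun x => hf0 _ (by simp)
  have e4 : ∀ x, f (z.1 - ρ, x) = 0 := fun x => hf0 _ (by simp)
  simp [e1, e2, e3, e4]

/-- Cutoff function on a square. -/
noncomputable def cut (z : ℝ × ℝ) (ρ : ℝ) (p : ℝ × ℝ) : ℝ :=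
  (ρ ^ 2 + (-1) * (p.1 - z.1) ^ 2) * (ρ ^ 2 + (-1) * (p.2 - z.2) ^ 2)

lemma sm_cut (z : ℝ × ℝ) (ρ : ℝ) (p : ℝ × ℝ) : Sm (cut z ρ) p := by
  unfold cut Sm; fun_prop

lemma pd_cut (z : ℝ × ℝ) (ρ : ℝ) (p e : ℝ × ℝ) : pd e (cut z ρ) p =
    -2 * e.1 * (p.1 - z.1) * (ρ ^ 2 - (p.2 - z.2) ^ 2)
    - 2 * e.2 * (p.2 - z.2) * (ρ ^ 2 - (p.1 - z.1) ^ 2) := by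
  have h1 : DifferentiableAt ℝ (fun q : ℝ × ℝ => q.1 + -z.1) p := by fun_prop
  have h2 : DifferentiableAt ℝ (fun q : ℝ × ℝ => q.2 + -z.2) p := by fun_prop
  have e1 : pd e (fun q : ℝ × ℝ => q.1 + -z.1) p = e.1 := by
    rw [pd_add (f := fun q : ℝ × ℝ => q.1) (by fun_prop) (by fun_prop), pd_const, pd_fst]; ring
  have e2 : pd e (fun q : ℝ × ℝ => q.2 + -z.2) p = e.2 := by
    rw [pd_add (f := fun q : ℝ × ℝ => q.2) (by fun_prop) (by fun_prop), pd_const, pd_snd]; ring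
  have h3 := (h1.fun_pow 2).const_mul (-1)
  have h4 := (h2.fun_pow 2).const_mul (-1)
  simp only [sub_eq_add_neg]
  show pd e (fun q => (ρ ^ 2 + (-1) * (q.1 + -z.1) ^ 2) * (ρ ^ 2 + (-1) * (q.2 + -z.2) ^ 2)) p = _
  rw [pd_mul ((differentiableAt_const _).fun_add h3) ((differentiableAt_const _).fun_add h4),
    pd_add (differentiableAt_const _) h3, pd_add (differentiableAt_const _) h4, pd_const,
    pd_const_mul _ (h1.fun_pow 2), pd_const_mul _ (h2.fun_pow 2), pd_sq h1, pd_sq h2, e1, e2]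
  ring

/-- Interior energy estimate for the Hessian of a translator graph. -/
lemma energy_estimate (c G : ℝ) {ρ : ℝ} (hρ : 0 < ρ) :
    ∃ E, ∀ (u : ℝ × ℝ → ℝ) (z : ℝ × ℝ), (∀ p ∈ Sq z ρ, Sol c u p ∧ area u p ≤ G) →
      ∫ p in Sq z (ρ / 2), hs u p ≤ E := by
  obtain ⟨C, hC⟩ : ∃ C, C = 2 * G * (c ^ 2 * ρ ^ 8 * G ^ 2 + 64 * G ^ 2 * ρ ^ 6) := ⟨_, rfl⟩
  have hμ : (0 : ℝ) < 81 / 256 * ρ ^ 8 := by positivity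
  refine ⟨C * (volume.real (Sq (0 : ℝ × ℝ) ρ)) / (81 / 256 * ρ ^ 8), fun u z hu => ?_⟩
  have hvol : volume.real (Sq z ρ) = volume.real (Sq (0 : ℝ × ℝ) ρ) := by
    simp [Sq, ← Icc_prod_Icc, Measure.volume_eq_prod, measureReal_def, Measure.prod_prod]
  set χ := cut z ρ with hχdef
  have hsmχ : ∀ p, Sm χ p := sm_cut z ρ
  set f : ℝ × ℝ → ℝ := fun p => (χ p * χ p) * (pdx u p * pdt (pdt u) p) with hf
  set g : ℝ × ℝ → ℝ := fun p => (-1) * ((χ p * χ p) * (pdx u p * pdx (pdt u) p)) with hg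
  have hsmu : ∀ p ∈ Sq z ρ, Sm u p := fun p hp => (hu p hp).1.1
  have hsmf : ∀ p ∈ Sq z ρ, Sm f p := fun p hp =>
    ((hsmχ p).mul (hsmχ p)).mul ((hsmu p hp).pdx.mul (hsmu p hp).pdt.pdt)
  have hsmg0 : ∀ p ∈ Sq z ρ, Sm (fun p => (χ p * χ p) * (pdx u p * pdx (pdt u) p)) p := fun p hp =>
    ((hsmχ p).mul (hsmχ p)).mul ((hsmu p hp).pdx.mul (hsmu p hp).pdt.pdx)
  have hsmg : ∀ p ∈ Sq z ρ, Sm g p := fun p hp => contDiffAt_const.mul (hsmg0 p hp)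
  have hdiv := integral_div_eq_zero hρ hsmf hsmg
    (fun p hp => by simp [hf, hχdef, cut, hp]) (fun p hp => by simp [hg, hχdef, cut, hp])
  have hval : ∀ p ∈ Sq z ρ, pdx f p + pdt g p
      = χ p ^ 2 * (pdx (pdx u) p * pdt (pdt u) p - pdx (pdt u) p ^ 2)
        + 2 * χ p * pdx u p * (pdx χ p * pdt (pdt u) p - pdt χ p * pdx (pdt u) p) := by
    intro p hp
    have hχ := (hsmχ p).diff
    have hx : DifferentiableAt ℝ (pdx u) p := Sm.diff (hsmu p hp).pdx
    have htt : DifferentiableAt ℝ (pdt (pdt u)) p := Sm.diff (hsmu p hp).pdt.pdt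
    have hxt : DifferentiableAt ℝ (pdx (pdt u)) p := Sm.diff (hsmu p hp).pdt.pdx
    have c1 : pdt (pdx u) p = pdx (pdt u) p := pd_comm (hsmu p hp)
    have c2 : pdt (pdx (pdt u)) p = pdx (pdt (pdt u)) p := pd_comm (hsmu p hp).pdt
    rw [pdx_eq f, pdt_eq g, hg, pd_const_mul _ (hsmg0 p hp).diff, hf,
      pd_mul (hχ.fun_mul hχ) (hx.fun_mul htt), pd_mul hχ hχ, pd_mul hx htt,
      pd_mul (hχ.fun_mul hχ) (hx.fun_mul hxt), pd_mul hχ hχ, pd_mul hx hxt]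
    simp only [← pdx_eq, ← pdt_eq, c1, c2]
    ring
  have h_int : IntegrableOn (fun p => χ p ^ 2 * hs u p) (Sq z ρ) :=
    ContinuousOn.integrableOn_compact (isCompact_Sq z ρ) fun p hp =>
      (((hsmχ p).continuousAt.pow 2).mul (hsmu p hp).hs.continuousAt).continuousWithinAt
  have h_int2 : IntegrableOn (fun p => pdx f p + pdt g p) (Sq z ρ) :=
    ContinuousOn.integrableOn_compact (isCompact_Sq z ρ) fun p hp =>
      ((hsmf p hp).pdx.continuousAt.add (hsmg p hp).pdt.continuousAt).continuousWithinAt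
  have hconst : IntegrableOn (fun _ => C) (Sq z ρ) :=
    integrableOn_const (isCompact_Sq z ρ).measure_lt_top.ne
  have hpt : ∀ p ∈ Sq z ρ, χ p ^ 2 * hs u p ≤ C - 4 * G * (pdx f p + pdt g p) := by
    intro p hp
    rw [hval p hp, hC]
    obtain ⟨hp1, hp2⟩ := mem_Sq.1 hp
    have hp1 : (p.1 - z.1) ^ 2 ≤ ρ ^ 2 := sq_le_sq' (abs_le.1 hp1).1 (abs_le.1 hp1).2
    have hp2 : (p.2 - z.2) ^ 2 ≤ ρ ^ 2 := sq_le_sq' (abs_le.1 hp2).1 (abs_le.1 hp2).2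
    have a1 : 0 ≤ (p.1 - z.1) ^ 2 := sq_nonneg _
    have a2 : 0 ≤ (p.2 - z.2) ^ 2 := sq_nonneg _
    have hA : (ρ ^ 2 - (p.1 - z.1) ^ 2) ^ 2 ≤ (ρ ^ 2) ^ 2 := by gcongr; linarith
    have hB : (ρ ^ 2 - (p.2 - z.2) ^ 2) ^ 2 ≤ (ρ ^ 2) ^ 2 := by gcongr; linarith
    refine energy_pointwise (hu p hp).1.eq (hu p hp).2 ?_ ?_
    · calc χ p ^ 2 = (ρ ^ 2 - (p.1 - z.1) ^ 2) ^ 2 * (ρ ^ 2 - (p.2 - z.2) ^ 2) ^ 2 := by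
            simp only [hχdef, cut]; ring
        _ ≤ (ρ ^ 2) ^ 2 * (ρ ^ 2) ^ 2 := by gcongr
        _ = ρ ^ 8 := by ring
    · rw [pdx_eq, pdt_eq, pd_cut, pd_cut]
      calc _ = 4 * ((p.1 - z.1) ^ 2 * (ρ ^ 2 - (p.2 - z.2) ^ 2) ^ 2)
            + 4 * ((p.2 - z.2) ^ 2 * (ρ ^ 2 - (p.1 - z.1) ^ 2) ^ 2) := by ring
        _ ≤ 4 * (ρ ^ 2 * (ρ ^ 2) ^ 2) + 4 * (ρ ^ 2 * (ρ ^ 2) ^ 2) := by gcongr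
        _ = 8 * ρ ^ 6 := by ring
  have hI : ∫ p in Sq z ρ, χ p ^ 2 * hs u p ≤ C * volume.real (Sq z ρ) := by
    refine (setIntegral_mono_on h_int (hconst.sub (h_int2.const_mul (4 * G)))
      (measurableSet_Sq z ρ) hpt).trans (le_of_eq ?_)
    have := integral_sub hconst (h_int2.const_mul (4 * G))
    simp only [Pi.sub_apply]
    rw [this, integral_const_mul, hdiv]
    simp [mul_comm]
  have hhalf : 81 / 256 * ρ ^ 8 * ∫ p in Sq z (ρ / 2), hs u p ≤ ∫ p in Sq z ρ, χ p ^ 2 * hs u p := by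
    have hsub : Sq z (ρ / 2) ⊆ Sq z ρ := Sq_mono (by linarith)
    rw [← integral_const_mul]
    refine (setIntegral_mono_on ?_ (h_int.mono_set hsub) (measurableSet_Sq z _) ?_).trans
      (setIntegral_mono_set h_int (Eventually.of_forall fun p =>
        mul_nonneg (sq_nonneg _) (hs_nonneg u p)) hsub.eventuallyLE)
    · exact ContinuousOn.integrableOn_compact (isCompact_Sq z _) fun p hp =>
        (continuousAt_const.mul (hsmu p (hsub hp)).hs.continuousAt).continuousWithinAt
    · intro p hp
      refine mul_le_mul_of_nonneg_right ?_ (hs_nonneg u p)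
      obtain ⟨hp1, hp2⟩ := mem_Sq.1 hp
      have hp1 : (p.1 - z.1) ^ 2 ≤ (ρ / 2) ^ 2 := sq_le_sq' (abs_le.1 hp1).1 (abs_le.1 hp1).2
      have hp2 : (p.2 - z.2) ^ 2 ≤ (ρ / 2) ^ 2 := sq_le_sq' (abs_le.1 hp2).1 (abs_le.1 hp2).2
      have hA : 3 / 4 * ρ ^ 2 ≤ ρ ^ 2 + (-1) * (p.1 - z.1) ^ 2 := by linarith
      have hB : 3 / 4 * ρ ^ 2 ≤ ρ ^ 2 + (-1) * (p.2 - z.2) ^ 2 := by linarith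
      calc 81 / 256 * ρ ^ 8 = ((3 / 4 * ρ ^ 2) * (3 / 4 * ρ ^ 2)) ^ 2 := by ring
        _ ≤ ((ρ ^ 2 + (-1) * (p.1 - z.1) ^ 2) * (ρ ^ 2 + (-1) * (p.2 - z.2) ^ 2)) ^ 2 := by
            gcongr
            exact (by positivity : 0 ≤ 3 / 4 * ρ ^ 2).trans hA
        _ = χ p ^ 2 := rfl
  rw [le_div_iff₀ hμ, mul_comm]
  exact hhalf.trans (hvol ▸ hI)

end Energy

/-! ### Maximum principle and oscillation of the gradient on squares -/

section Osc

open MeasureTheory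

lemma Sq_mem_nhds {z q : ℝ × ℝ} {t : ℝ} (h1 : |q.1 - z.1| < t) (h2 : |q.2 - z.2| < t) :
    Sq z t ∈ 𝓝 q := by
  have : IsOpen {p : ℝ × ℝ | |p.1 - z.1| < t ∧ |p.2 - z.2| < t} := by
    exact (isOpen_lt (f := fun p : ℝ × ℝ => |p.1 - z.1|) (by fun_prop) continuous_const).inter
      (isOpen_lt (f := fun p : ℝ × ℝ => |p.2 - z.2|) (by fun_prop) continuous_const)
  exact mem_of_superset (this.mem_nhds ⟨h1, h2⟩) fun p hp => mem_Sq.2 ⟨hp.1.le, hp.2.le⟩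

variable {c : ℝ} {u : ℝ × ℝ → ℝ} {z : ℝ × ℝ} {t : ℝ}

lemma max_principle_square (ht : 0 ≤ t) (hu : ∀ q ∈ Sq z t, Sol c u q) (e : ℝ × ℝ) {m : ℝ}
    (hm : ∀ q ∈ Sq z t, (|q.1 - z.1| = t ∨ |q.2 - z.2| = t) → pd e u q ≤ m) :
    ∀ q ∈ Sq z t, pd e u q ≤ m := by
  have hsm : ∀ q ∈ Sq z t, Sm (pd e u) q := fun q hq => (hu q hq).1.pd
  obtain ⟨B, hB⟩ : ∃ B : ℝ × ℝ → ℝ, B = fun q => -2 * pdt u q * pdx (pdt u) q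
      + 2 * pdx u q * pdt (pdt u) q + 2 * c * pdx u q * pdt u q := ⟨_, rfl⟩
  have hBc : ContinuousOn B (Sq z t) := fun q hq => by
    have h1 := ((hu q hq).1.pdx).continuousAt
    have h2 := ((hu q hq).1.pdt).continuousAt
    have h3 := ((hu q hq).1.pdt.pdx).continuousAt
    have h4 := ((hu q hq).1.pdt.pdt).continuousAt
    rw [hB]
    exact ContinuousAt.continuousWithinAt (by fun_prop)
  obtain ⟨N, hN⟩ := (isCompact_Sq z t).exists_bound_of_continuousOn hBc
  obtain ⟨K, hK⟩ : ∃ K, K = |N| + 1 := ⟨_, rfl⟩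
  have hKp : 0 < K := by rw [hK]; positivity
  have hd1 : ∀ y : ℝ, HasDerivAt (fun y => rexp (K * y)) (K * rexp (K * y)) y := fun y => by
    simpa using hasDerivAt_mul_exp 1 K y
  have hd2 : ∀ y : ℝ, HasDerivAt (fun y => K * rexp (K * y)) (K ^ 2 * rexp (K * y)) y :=
    fun y => by simpa [sq] using hasDerivAt_mul_exp K K y
  have hs : ∀ q : ℝ × ℝ, Sm (fun q : ℝ × ℝ => q.1) q := fun q => contDiffAt_fst
  have hsE : ∀ q : ℝ × ℝ, Sm (fun q : ℝ × ℝ => rexp (K * q.1)) q := fun q => by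
    simp only [Sm]; fun_prop
  have key : ∀ ε > 0, ∀ q ∈ Sq z t, pd e u q + ε * rexp (K * q.1)
      ≤ m + ε * rexp (K * (z.1 + t)) := by
    intro ε hε
    have hsF : ∀ q ∈ Sq z t, Sm (fun q => pd e u q + ε * rexp (K * q.1)) q := fun q hq =>
      (hsm q hq).add (contDiffAt_const.mul (hsE q))
    obtain ⟨p, hp, hmax⟩ := (isCompact_Sq z t).exists_isMaxOn
      ⟨z, mem_Sq.2 (by simpa using ht)⟩
      (fun q hq => (hsF q hq).continuousAt.continuousWithinAt)
    obtain ⟨hp1, hp2⟩ := mem_Sq.1 hp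
    by_cases hbd : |p.1 - z.1| = t ∨ |p.2 - z.2| = t
    · intro q hq
      refine (hmax hq).trans (add_le_add (hm p hp hbd) ?_)
      have : p.1 ≤ z.1 + t := by linarith [(abs_le.1 hp1).2]
      gcongr
    · exfalso
      push Not at hbd
      have hloc : IsLocalMax (fun q => pd e u q + ε * rexp (K * q.1)) p :=
        hmax.isLocalMax (Sq_mem_nhds (lt_of_le_of_ne hp1 hbd.1) (lt_of_le_of_ne hp2 hbd.2))
      have hsol := hu p hp
      have hd : ∀ v : ℝ × ℝ, pd v (pd e u) p = -(ε * (K * rexp (K * p.1) * v.1)) := by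
        intro v
        have := pd_eq_zero_of_isLocalMax (e := v) hloc
        rw [pd_add (hsm p hp).diff ((hsE p).diff.const_mul ε), pd_const_mul _ (hsE p).diff,
          pd_comp (f := fun q : ℝ × ℝ => q.1) (φ := fun y => rexp (K * y)) (hd1 p.1) (hs p).diff,
          pd_fst] at this
        linarith
      have hle := LL_nonpos_of_isLocalMax (coef_pos (pdt u p))
        (coef_det (pdx u p) (pdt u p)) (hsF p hp) hloc
      rw [LL_add (hsm p hp) (contDiffAt_const.mul (hsE p)), LL_const_mul _ (hsE p),
        LL_comp (φ := fun y => rexp (K * y)) (φ' := fun y => K * rexp (K * y))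
          (Eventually.of_forall hd1) (hd2 p.1) (hs p)] at hle
      have hL0 : ∀ a b d : ℝ, LL a b d (fun q : ℝ × ℝ => q.1) p = 0 := by
        intro a b d
        have : ∀ v, pd v (fun q : ℝ × ℝ => q.1) = fun _ => v.1 := fun v => by ext q; exact pd_fst
        simp [LL, pdx_eq, pdt_eq, this, pd_const]
      have hG0 : ∀ a b d : ℝ, GG a b d (fun q : ℝ × ℝ => q.1) (fun q : ℝ × ℝ => q.1) p = a := by
        intro a b d
        simp [GG, pdx_eq, pdt_eq, pd_fst]
      rw [hL0, hG0] at hle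
      have heq := hsol.pd_eq e
      have e1 : pd e (pdt u) p = 0 := by
        rw [pdt_eq, pd_comm hsol.1, hd]; simp
      have e2 : pd e (pdx u) p = -(ε * (K * rexp (K * p.1))) := by
        rw [pdx_eq, pd_comm hsol.1, hd]; simp
      rw [e1, e2] at heq
      have hBN : |B p| ≤ N := hN p hp
      have hBK : -B p < K := by
        rw [hK]; linarith [neg_abs_le (B p), le_abs_self N]
      have hE := Real.exp_pos (K * p.1)
      have hfin : 0 < ε * (K * rexp (K * p.1)) * (B p + K * (1 + pdt u p ^ 2)) := by
        apply mul_pos (by positivity)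
        have : 0 ≤ K * pdt u p ^ 2 := by positivity
        linarith
      refine absurd hle (not_le.2 (hfin.trans_eq ?_))
      rw [hB]
      linear_combination -heq
  intro q hq
  refine le_of_forall_pos_le_add fun δ hδ => ?_
  have hE := Real.exp_pos (K * (z.1 + t))
  have h := key (δ / rexp (K * (z.1 + t))) (by positivity) q hq
  rw [div_mul_cancel₀ _ hE.ne'] at h
  have : 0 < δ / rexp (K * (z.1 + t)) * rexp (K * q.1) := by positivity
  linarith

lemma max_principle_square_abs (ht : 0 ≤ t) (hu : ∀ q ∈ Sq z t, Sol c u q) (e : ℝ × ℝ) {m l : ℝ}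
    (hm : ∀ q ∈ Sq z t, (|q.1 - z.1| = t ∨ |q.2 - z.2| = t) → |pd e u q - m| ≤ l) :
    ∀ q ∈ Sq z t, |pd e u q - m| ≤ l := by
  intro q hq
  have hneg : ∀ q, pd (-e) u q = -pd e u q := fun q => by simp [pd]
  have h1 := max_principle_square ht hu e (m := m + l)
    (fun q hq hb => by linarith [(abs_le.1 (hm q hq hb)).2]) q hq
  have h2 := max_principle_square ht hu (-e) (m := -m + l)
    (fun q hq hb => by rw [hneg]; linarith [(abs_le.1 (hm q hq hb)).1]) q hq
  rw [hneg] at h2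
  exact abs_le.2 ⟨by linarith, by linarith⟩

lemma abs_sub_le_integral {φ φ' B : ℝ → ℝ} {x y a b : ℝ} (hx : x ∈ Icc a b) (hy : y ∈ Icc a b)
    (hφ : ∀ s ∈ Icc a b, HasDerivAt φ (φ' s) s) (hB : ∀ s ∈ Icc a b, |φ' s| ≤ B s)
    (hBc : Continuous B) (hB0 : ∀ s, 0 ≤ B s) : |φ x - φ y| ≤ ∫ s in a..b, B s := by
  wlog h : y ≤ x generalizing x y
  · rw [abs_sub_comm]; exact this hy hx (le_of_not_ge h)
  have hsub : Icc y x ⊆ Icc a b := Icc_subset_Icc hy.1 hx.2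
  refine (norm_sub_le_integral_of_norm_deriv_le_of_le h
    (fun s hs => (hφ s (hsub hs)).continuousAt.continuousWithinAt)
    (fun s hs => (hφ s (hsub (Ioo_subset_Icc_self hs))).differentiableAt.differentiableWithinAt)
    (Eventually.of_forall fun s hs => ?_) (hBc.intervalIntegrable _ _)).trans
    (intervalIntegral.integral_mono_interval hy.1 h hx.2 (Eventually.of_forall hB0)
      (hBc.intervalIntegrable _ _))
  have hs := hsub (Ioo_subset_Icc_self hs)
  rw [(hφ s hs).deriv]
  exact hB s hs

variable {w D : ℝ × ℝ → ℝ} {r : ℝ}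

lemma abs_sub_le_integral_fst {x x' y a b : ℝ} (hx : x ∈ Icc a b) (hx' : x' ∈ Icc a b)
    (hD : Continuous D) (hD0 : ∀ q, 0 ≤ D q)
    (hw : ∀ s ∈ Icc a b, DifferentiableAt ℝ w (s, y) ∧ |pdx w (s, y)| ≤ D (s, y)) :
    |w (x, y) - w (x', y)| ≤ ∫ s in a..b, D (s, y) :=
  abs_sub_le_integral (φ := fun s => w (s, y)) (φ' := fun s => pdx w (s, y)) hx hx'
    (fun s hs => (hw s hs).1.hasFDerivAt.comp_hasDerivAt s
      ((hasDerivAt_id s).prodMk (hasDerivAt_const s y)))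
    (fun s hs => (hw s hs).2) (by fun_prop) (fun s => hD0 _)

lemma abs_sub_le_integral_snd {x y y' a b : ℝ} (hy : y ∈ Icc a b) (hy' : y' ∈ Icc a b)
    (hD : Continuous D) (hD0 : ∀ q, 0 ≤ D q)
    (hw : ∀ s ∈ Icc a b, DifferentiableAt ℝ w (x, s) ∧ |pdt w (x, s)| ≤ D (x, s)) :
    |w (x, y) - w (x, y')| ≤ ∫ s in a..b, D (x, s) :=
  abs_sub_le_integral (φ := fun s => w (x, s)) (φ' := fun s => pdt w (x, s)) hy hy'
    (fun s hs => (hw s hs).1.hasFDerivAt.comp_hasDerivAt s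
      ((hasDerivAt_const s x).prodMk (hasDerivAt_id s)))
    (fun s hs => (hw s hs).2) (by fun_prop) (fun s => hD0 _)

/-- Integral of `D` over the four lines carrying the sides of the square of half side `t`. -/
noncomputable def sides (D : ℝ × ℝ → ℝ) (z : ℝ × ℝ) (r t : ℝ) : ℝ :=
  ((∫ y in (z.2 - 2 * r)..(z.2 + 2 * r), D (z.1 + t, y))
    + ∫ y in (z.2 - 2 * r)..(z.2 + 2 * r), D (z.1 - t, y))
  + ((∫ x in (z.1 - 2 * r)..(z.1 + 2 * r), D (x, z.2 + t))
    + ∫ x in (z.1 - 2 * r)..(z.1 + 2 * r), D (x, z.2 - t))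

lemma boundary_osc (hr : 0 < r) (ht : t ∈ Icc r (2 * r)) (hD : Continuous D) (hD0 : ∀ q, 0 ≤ D q)
    (hw : ∀ q ∈ Sq z (2 * r), DifferentiableAt ℝ w q ∧ |pdx w q| ≤ D q ∧ |pdt w q| ≤ D q)
    {q : ℝ × ℝ} (hq : q ∈ Sq z t) (hb : |q.1 - z.1| = t ∨ |q.2 - z.2| = t) :
    |w q - w (z.1 + t, z.2 + t)| ≤ sides D z r t := by
  obtain ⟨x, y⟩ := q
  obtain ⟨hx, hy⟩ := mem_Sq.1 hq
  simp only at hx hy hb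
  rw [abs_le] at hx hy
  obtain ⟨ht1, ht2⟩ := ht
  have hrr : 0 < 2 * r := by linarith
  have nn1 : ∀ x, 0 ≤ ∫ y in (z.2 - 2 * r)..(z.2 + 2 * r), D (x, y) := fun x =>
    intervalIntegral.integral_nonneg (by linarith) fun _ _ => hD0 _
  have nn2 : ∀ y, 0 ≤ ∫ x in (z.1 - 2 * r)..(z.1 + 2 * r), D (x, y) := fun y =>
    intervalIntegral.integral_nonneg (by linarith) fun _ _ => hD0 _
  have H : ∀ {x x' y}, |x - z.1| ≤ t → |x' - z.1| ≤ t → |y - z.2| ≤ t →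
      |w (x, y) - w (x', y)| ≤ ∫ s in (z.1 - 2 * r)..(z.1 + 2 * r), D (s, y) := by
    intro x x' y h1 h2 h3
    rw [abs_le] at h1 h2 h3
    refine abs_sub_le_integral_fst ⟨by linarith, by linarith⟩ ⟨by linarith, by linarith⟩ hD hD0
      fun s hs => ?_
    have := hw (s, y) (mem_Sq.2 ⟨abs_le.2 ⟨by linarith [hs.1], by linarith [hs.2]⟩,
      abs_le.2 ⟨by dsimp only; linarith, by dsimp only; linarith⟩⟩)
    exact ⟨this.1, this.2.1⟩
  have V : ∀ {x y y'}, |x - z.1| ≤ t → |y - z.2| ≤ t → |y' - z.2| ≤ t →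
      |w (x, y) - w (x, y')| ≤ ∫ s in (z.2 - 2 * r)..(z.2 + 2 * r), D (x, s) := by
    intro x y y' h1 h2 h3
    rw [abs_le] at h1 h2 h3
    refine abs_sub_le_integral_snd ⟨by linarith, by linarith⟩ ⟨by linarith, by linarith⟩ hD hD0
      fun s hs => ?_
    have := hw (x, s) (mem_Sq.2 ⟨abs_le.2 ⟨by dsimp only; linarith, by dsimp only; linarith⟩,
      abs_le.2 ⟨by linarith [hs.1], by linarith [hs.2]⟩⟩)
    exact ⟨this.1, this.2.2⟩
  have ht0 : 0 ≤ t := by linarith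
  have hxx : |x - z.1| ≤ t := abs_le.2 hx
  have hyy : |y - z.2| ≤ t := abs_le.2 hy
  have a1 : |z.1 + t - z.1| ≤ t := by simp [abs_of_nonneg ht0]
  have a2 : |z.1 - t - z.1| ≤ t := by simp [abs_of_nonneg ht0]
  have a3 : |z.2 + t - z.2| ≤ t := by simp [abs_of_nonneg ht0]
  have a4 : |z.2 - t - z.2| ≤ t := by simp [abs_of_nonneg ht0]
  have n1 := nn1 (z.1 + t)
  have n2 := nn1 (z.1 - t)
  have n3 := nn2 (z.2 + t)
  have n4 := nn2 (z.2 - t)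
  unfold sides
  rcases hb with hb | hb
  · rcases (abs_eq ht0).1 hb with h | h
    · obtain rfl : x = z.1 + t := by linarith
      linarith [V hxx hyy a3]
    · obtain rfl : x = z.1 - t := by linarith
      linarith [V hxx hyy a3, H hxx a1 a3, abs_sub_le (w (z.1 - t, y)) (w (z.1 - t, z.2 + t))
        (w (z.1 + t, z.2 + t))]
  · rcases (abs_eq ht0).1 hb with h | h
    · obtain rfl : y = z.2 + t := by linarith
      linarith [H hxx a1 hyy]
    · obtain rfl : y = z.2 - t := by linarith
      linarith [H hxx a1 hyy, V a1 hyy a3, abs_sub_le (w (x, z.2 - t)) (w (z.1 + t, z.2 - t))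
        (w (z.1 + t, z.2 + t))]

lemma integral_sides_le (hr : 0 < r) (hD : Continuous D) (hD0 : ∀ q, 0 ≤ D q) :
    ∫ t in r..(2 * r), sides D z r t ≤ 4 * ∫ p in Sq z (2 * r) \ Sq z r, D p := by
  have h_int : IntegrableOn D (Sq z (2 * r)) :=
    hD.continuousOn.integrableOn_compact (isCompact_Sq _ _)
  have h_intA : IntegrableOn D (Sq z (2 * r) \ Sq z r) := h_int.mono_set sdiff_subset
  have hrect : ∀ {a b a' b' : ℝ}, a ≤ b → a' ≤ b' →
      Ioo a b ×ˢ Ioo a' b' ⊆ Sq z (2 * r) \ Sq z r →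
      ∫ x in a..b, ∫ y in a'..b', D (x, y) ≤ ∫ p in Sq z (2 * r) \ Sq z r, D p := by
    intro a b a' b' h h' hsub
    simp only [intervalIntegral.integral_of_le h, intervalIntegral.integral_of_le h',
      integral_Ioc_eq_integral_Ioo]
    rw [← setIntegral_prod D (h_intA.mono_set hsub)]
    exact setIntegral_mono_set h_intA (Eventually.of_forall hD0) hsub.eventuallyLE
  have hrect' : ∀ {a b a' b' : ℝ}, a ≤ b → a' ≤ b' →
      Ioo a b ×ˢ Ioo a' b' ⊆ Sq z (2 * r) \ Sq z r →
      ∫ y in a'..b', ∫ x in a..b, D (x, y) ≤ ∫ p in Sq z (2 * r) \ Sq z r, D p := by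
    intro a b a' b' h h' hsub
    have e : ∫ y in a'..b', ∫ x in a..b, D (x, y) = ∫ x in a..b, ∫ y in a'..b', D (x, y) := by
      simp only [intervalIntegral.integral_of_le h, intervalIntegral.integral_of_le h',
        integral_Ioc_eq_integral_Ioo]
      have hi : IntegrableOn D (Ioo a b ×ˢ Ioo a' b') := h_intA.mono_set hsub
      rw [← setIntegral_prod D hi, ← setIntegral_prod_swap]
      exact (setIntegral_prod (fun q : ℝ × ℝ => D q.swap) hi.swap).symm
    rw [e]; exact hrect h h' hsub
  have cV : Continuous fun x => ∫ y in (z.2 - 2 * r)..(z.2 + 2 * r), D (x, y) :=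
    intervalIntegral.continuous_parametric_intervalIntegral_of_continuous'
      (f := fun x y => D (x, y)) hD _ _
  have cH : Continuous fun y => ∫ x in (z.1 - 2 * r)..(z.1 + 2 * r), D (x, y) :=
    intervalIntegral.continuous_parametric_intervalIntegral_of_continuous'
      (f := fun y x => D (x, y)) (by simp only [Function.uncurry_def]; fun_prop) _ _
  have c1 : Continuous fun t => ∫ y in (z.2 - 2 * r)..(z.2 + 2 * r), D (z.1 + t, y) :=
    cV.comp (by fun_prop : Continuous fun t => z.1 + t)
  have c2 : Continuous fun t => ∫ y in (z.2 - 2 * r)..(z.2 + 2 * r), D (z.1 - t, y) :=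
    cV.comp (by fun_prop : Continuous fun t => z.1 - t)
  have c3 : Continuous fun t => ∫ x in (z.1 - 2 * r)..(z.1 + 2 * r), D (x, z.2 + t) :=
    cH.comp (by fun_prop : Continuous fun t => z.2 + t)
  have c4 : Continuous fun t => ∫ x in (z.1 - 2 * r)..(z.1 + 2 * r), D (x, z.2 - t) :=
    cH.comp (by fun_prop : Continuous fun t => z.2 - t)
  unfold sides
  rw [intervalIntegral.integral_add ((c1.fun_add c2).intervalIntegrable _ _)
    ((c3.fun_add c4).intervalIntegrable _ _), intervalIntegral.integral_add
    (c1.intervalIntegrable _ _) (c2.intervalIntegrable _ _), intervalIntegral.integral_add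
    (c3.intervalIntegrable _ _) (c4.intervalIntegrable _ _),
    intervalIntegral.integral_comp_add_left
      (fun x => ∫ y in (z.2 - 2 * r)..(z.2 + 2 * r), D (x, y)),
    intervalIntegral.integral_comp_sub_left
      (fun x => ∫ y in (z.2 - 2 * r)..(z.2 + 2 * r), D (x, y)),
    intervalIntegral.integral_comp_add_left
      (fun y => ∫ x in (z.1 - 2 * r)..(z.1 + 2 * r), D (x, y)),
    intervalIntegral.integral_comp_sub_left
      (fun y => ∫ x in (z.1 - 2 * r)..(z.1 + 2 * r), D (x, y))]
  have sub : ∀ {a b a' b' : ℝ}, (∀ x ∈ Ioo a b, ∀ y ∈ Ioo a' b',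
      (|x - z.1| ≤ 2 * r ∧ |y - z.2| ≤ 2 * r) ∧ ¬ (|x - z.1| ≤ r ∧ |y - z.2| ≤ r)) →
      Ioo a b ×ˢ Ioo a' b' ⊆ Sq z (2 * r) \ Sq z r := by
    intro a b a' b' h q hq
    have := h q.1 hq.1 q.2 hq.2
    exact ⟨mem_Sq.2 this.1, fun h => this.2 (mem_Sq.1 h)⟩
  have i1 := hrect (a := z.1 + r) (b := z.1 + 2 * r) (a' := z.2 - 2 * r) (b' := z.2 + 2 * r)
    (by linarith) (by linarith) (sub fun x hx y hy => ⟨⟨abs_le.2 ⟨by linarith [hx.1], by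
      linarith [hx.2]⟩, abs_le.2 ⟨by linarith [hy.1], by linarith [hy.2]⟩⟩, fun h => by
        linarith [hx.1, (abs_le.1 h.1).2]⟩)
  have i2 := hrect (a := z.1 - 2 * r) (b := z.1 - r) (a' := z.2 - 2 * r) (b' := z.2 + 2 * r)
    (by linarith) (by linarith) (sub fun x hx y hy => ⟨⟨abs_le.2 ⟨by linarith [hx.1], by
      linarith [hx.2]⟩, abs_le.2 ⟨by linarith [hy.1], by linarith [hy.2]⟩⟩, fun h => by
        linarith [hx.2, (abs_le.1 h.1).1]⟩)
  have i3 := hrect' (a := z.1 - 2 * r) (b := z.1 + 2 * r) (a' := z.2 + r) (b' := z.2 + 2 * r)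
    (by linarith) (by linarith) (sub fun x hx y hy => ⟨⟨abs_le.2 ⟨by linarith [hx.1], by
      linarith [hx.2]⟩, abs_le.2 ⟨by linarith [hy.1], by linarith [hy.2]⟩⟩, fun h => by
        linarith [hy.1, (abs_le.1 h.2).2]⟩)
  have i4 := hrect' (a := z.1 - 2 * r) (b := z.1 + 2 * r) (a' := z.2 - 2 * r) (b' := z.2 - r)
    (by linarith) (by linarith) (sub fun x hx y hy => ⟨⟨abs_le.2 ⟨by linarith [hx.1], by
      linarith [hx.2]⟩, abs_le.2 ⟨by linarith [hy.1], by linarith [hy.2]⟩⟩, fun h => by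
        linarith [hy.2, (abs_le.1 h.2).1]⟩)
  linarith

lemma continuous_sides (hD : Continuous D) : Continuous (sides D z r) := by
  have cV : Continuous fun x => ∫ y in (z.2 - 2 * r)..(z.2 + 2 * r), D (x, y) :=
    intervalIntegral.continuous_parametric_intervalIntegral_of_continuous'
      (f := fun x y => D (x, y)) hD _ _
  have cH : Continuous fun y => ∫ x in (z.1 - 2 * r)..(z.1 + 2 * r), D (x, y) :=
    intervalIntegral.continuous_parametric_intervalIntegral_of_continuous'
      (f := fun y x => D (x, y)) (by simp only [Function.uncurry_def]; fun_prop) _ _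
  exact ((cV.comp (by fun_prop : Continuous fun t => z.1 + t)).fun_add
    (cV.comp (by fun_prop : Continuous fun t => z.1 - t))).fun_add
    ((cH.comp (by fun_prop : Continuous fun t => z.2 + t)).fun_add
    (cH.comp (by fun_prop : Continuous fun t => z.2 - t)))

/-- Projection onto the square of half side `r`. -/
noncomputable def clamp (z : ℝ × ℝ) (r : ℝ) (q : ℝ × ℝ) : ℝ × ℝ :=
  (max (z.1 - r) (min (z.1 + r) q.1), max (z.2 - r) (min (z.2 + r) q.2))

lemma continuous_clamp (z : ℝ × ℝ) (r : ℝ) : Continuous (clamp z r) := by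
  unfold clamp; fun_prop

lemma clamp_mem (hr : 0 ≤ r) (q : ℝ × ℝ) : clamp z r q ∈ Sq z r := by
  have h : ∀ x y : ℝ, |max (x - r) (min (x + r) y) - x| ≤ r := fun x y => by
    rw [abs_le]
    constructor
    · linarith [le_max_left (x - r) (min (x + r) y)]
    · have : max (x - r) (min (x + r) y) ≤ x + r := max_le (by linarith) (min_le_left _ _)
      linarith
  exact mem_Sq.2 ⟨h _ _, h _ _⟩

lemma clamp_eq {q : ℝ × ℝ} (hq : q ∈ Sq z r) : clamp z r q = q := by
  obtain ⟨h1, h2⟩ := mem_Sq.1 hq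
  rw [abs_le] at h1 h2
  ext
  · simp only [clamp]; rw [min_eq_right (by linarith), max_eq_right (by linarith)]
  · simp only [clamp]; rw [min_eq_right (by linarith), max_eq_right (by linarith)]

lemma osc_le (hr : 0 < r) (hu : ∀ q ∈ Sq z (2 * r), Sol c u q) {κ : ℝ} (hκ : 0 < κ)
    (e : ℝ × ℝ) (he : e = (1, 0) ∨ e = (0, 1)) {p p' : ℝ × ℝ} (hp : p ∈ Sq z r)
    (hp' : p' ∈ Sq z r) :
    r * |pd e u p - pd e u p'| ≤ 8 * ∫ q in Sq z (2 * r) \ Sq z r, (κ * hs u q + 1 / κ) := by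
  obtain ⟨D, hDdef⟩ : ∃ D : ℝ × ℝ → ℝ, D = fun q => κ * hs u (clamp z (2 * r) q) + 1 / κ := ⟨_, rfl⟩
  have hDeq : ∀ q ∈ Sq z (2 * r), D q = κ * hs u q + 1 / κ := fun q hq => by
    rw [hDdef]; simp only [clamp_eq hq]
  have hD0 : ∀ q, 0 ≤ D q := fun q => by
    have := hs_nonneg u (clamp z (2 * r) q)
    rw [hDdef]; positivity
  have hDc : Continuous D := by
    have h1 : ContinuousOn (hs u) (Sq z (2 * r)) := fun q hq =>
      ((hu q hq).1.hs).continuousAt.continuousWithinAt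
    have h2 : Continuous fun q => hs u (clamp z (2 * r) q) :=
      h1.comp_continuous (continuous_clamp z _) (clamp_mem (by linarith))
    rw [hDdef]; fun_prop
  have sqb : ∀ {x : ℝ} {q}, x ^ 2 ≤ hs u q → |x| ≤ κ * hs u q + 1 / κ := by
    intro x q h
    have h1 : κ * x ^ 2 ≤ κ * hs u q := by gcongr
    have h2 : |x| ≤ κ * x ^ 2 + 1 / κ := by
      rw [← sq_abs]
      have : κ * |x| ^ 2 + 1 / κ - |x| = κ * (|x| - 1 / (2 * κ)) ^ 2 + 3 / (4 * κ) := by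
        field_simp; ring
      have : 0 ≤ κ * (|x| - 1 / (2 * κ)) ^ 2 + 3 / (4 * κ) := by positivity
      linarith
    linarith
  have hw : ∀ q ∈ Sq z (2 * r), DifferentiableAt ℝ (pd e u) q ∧ |pdx (pd e u) q| ≤ D q
      ∧ |pdt (pd e u) q| ≤ D q := by
    intro q hq
    have hsq := (hu q hq).1
    refine ⟨hsq.pd.diff, ?_, ?_⟩ <;> rw [hDeq q hq] <;> apply sqb <;> unfold hs <;>
      rcases he with rfl | rfl <;> simp only [pdx_eq, pdt_eq]
    · nlinarith [sq_nonneg (pd (1, 0) (pd (0, 1) u) q), sq_nonneg (pd (0, 1) (pd (0, 1) u) q)]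
    · nlinarith [sq_nonneg (pd (1, 0) (pd (1, 0) u) q), sq_nonneg (pd (0, 1) (pd (0, 1) u) q),
        sq_nonneg (pd (1, 0) (pd (0, 1) u) q)]
    · rw [pd_comm hsq]
      nlinarith [sq_nonneg (pd (1, 0) (pd (1, 0) u) q), sq_nonneg (pd (0, 1) (pd (0, 1) u) q),
        sq_nonneg (pd (1, 0) (pd (0, 1) u) q)]
    · nlinarith [sq_nonneg (pd (1, 0) (pd (1, 0) u) q), sq_nonneg (pd (1, 0) (pd (0, 1) u) q)]
  have hpt : ∀ t ∈ Icc r (2 * r), |pd e u p - pd e u p'| ≤ 2 * sides D z r t := by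
    intro t ht
    have hsub := Sq_mono (z := z) ht.2
    have hb := max_principle_square_abs (by linarith [ht.1] : 0 ≤ t)
      (fun q hq => hu q (hsub hq)) e (m := pd e u (z.1 + t, z.2 + t)) (l := sides D z r t)
      (fun q hq hbd => boundary_osc hr ht hDc hD0 hw hq hbd)
    have h1 := hb p (Sq_mono ht.1 hp)
    have h2 := hb p' (Sq_mono ht.1 hp')
    rw [abs_le] at h1 h2 ⊢
    constructor <;> linarith
  have h_int := intervalIntegral.integral_mono_on (by linarith : r ≤ 2 * r)
    (f := fun _ => |pd e u p - pd e u p'|) (g := fun t => 2 * sides D z r t) (μ := volume)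
    (continuous_const.intervalIntegrable _ _)
    ((continuous_sides hDc).const_mul 2 |>.intervalIntegrable _ _) hpt
  rw [intervalIntegral.integral_const, intervalIntegral.integral_const_mul, smul_eq_mul] at h_int
  have hle := integral_sides_le (z := z) hr hDc hD0
  rw [setIntegral_congr_fun ((measurableSet_Sq z (2 * r)).diff (measurableSet_Sq z r))
    (fun q hq => hDeq q hq.1)] at hle
  linarith

lemma volume_Sq (hr : 0 ≤ r) : volume.real (Sq z r) = 4 * r ^ 2 := by
  unfold Sq
  rw [← Icc_prod_Icc, Measure.volume_eq_prod, measureReal_prod_prod]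
  simp only [Real.volume_real_Icc]
  rw [max_eq_left (by linarith), max_eq_left (by linarith)]
  ring

lemma osc_le' (hr : 0 < r) (hu : ∀ q ∈ Sq z (2 * r), Sol c u q) {δ : ℝ} (hδ : 0 < δ)
    (e : ℝ × ℝ) (he : e = (1, 0) ∨ e = (0, 1)) {p p' : ℝ × ℝ} (hp : p ∈ Sq z r)
    (hp' : p' ∈ Sq z r) :
    |pd e u p - pd e u p'| ≤
      8 * (1 / δ * ((∫ q in Sq z (2 * r), hs u q) - ∫ q in Sq z r, hs u q) + 16 * δ) := by
  have h := osc_le hr hu (div_pos hr hδ) e he hp hp'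
  have hc : ContinuousOn (hs u) (Sq z (2 * r)) := fun q hq =>
      ((hu q hq).1.hs).continuousAt.continuousWithinAt
  have hi : IntegrableOn (hs u) (Sq z (2 * r)) := hc.integrableOn_compact (isCompact_Sq _ _)
  have hsub : Sq z r ⊆ Sq z (2 * r) := Sq_mono (by linarith)
  have hiA : IntegrableOn (hs u) (Sq z (2 * r) \ Sq z r) := hi.mono_set sdiff_subset
  have hfin : volume (Sq z (2 * r) \ Sq z r) ≠ ⊤ :=
    ((measure_mono sdiff_subset).trans_lt (isCompact_Sq z (2 * r)).measure_lt_top).ne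
  rw [integral_add (hiA.const_mul _) (integrableOn_const hfin), integral_const_mul,
    setIntegral_const, setIntegral_sdiff (measurableSet_Sq z r) hi hsub] at h
  have hv : volume.real (Sq z (2 * r) \ Sq z r) ≤ 16 * r ^ 2 := by
    have := volume_Sq (z := z) (r := 2 * r) (by linarith)
    have h2 : volume.real (Sq z (2 * r) \ Sq z r) ≤ volume.real (Sq z (2 * r)) :=
      measureReal_mono sdiff_subset (isCompact_Sq z (2 * r)).measure_lt_top.ne
    linarith
  rw [smul_eq_mul] at h
  have hv2 : volume.real (Sq z (2 * r) \ Sq z r) * (1 / (r / δ)) ≤ 16 * r ^ 2 * (1 / (r / δ)) := by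
    gcongr
  have e1 : 16 * r ^ 2 * (1 / (r / δ)) = r * (16 * δ) := by field_simp
  refine le_of_mul_le_mul_left ?_ hr
  refine h.trans ?_
  have e2 : r * (8 * (1 / δ * ((∫ q in Sq z (2 * r), hs u q) - ∫ q in Sq z r, hs u q) + 16 * δ))
    = 8 * (r / δ * ((∫ q in Sq z (2 * r), hs u q) - ∫ q in Sq z r, hs u q) + r * (16 * δ)) := by
    ring
  rw [e2]
  linarith

lemma osc_small (c G : ℝ) {ρ ε : ℝ} (hρ : 0 < ρ) (hε : 0 < ε) :
    ∃ r > 0, ∀ u : ℝ × ℝ → ℝ, ∀ z : ℝ × ℝ, (∀ p ∈ Sq z ρ, Sol c u p ∧ area u p ≤ G) →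
      ∀ p ∈ Sq z r, ∀ e : ℝ × ℝ, e = (1, 0) ∨ e = (0, 1) → |pd e u p - pd e u z| ≤ ε := by
  obtain ⟨E, hE⟩ := energy_estimate c G hρ
  obtain ⟨δ, hδ⟩ : ∃ δ, δ = ε / 256 := ⟨_, rfl⟩
  have hδ0 : 0 < δ := by rw [hδ]; positivity
  obtain ⟨J, hJ⟩ := exists_nat_gt (|E| * 16 / (δ * ε))
  obtain ⟨R, hR⟩ : ∃ R : ℕ → ℝ, R = fun j => ρ / 2 * (1 / 2) ^ j := ⟨_, rfl⟩
  have hR0 : ∀ j, 0 < R j := fun j => by rw [hR]; positivity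
  have hR2 : ∀ j, 2 * R (j + 1) = R j := fun j => by rw [hR]; simp only [pow_succ]; ring
  have hRle : ∀ j, R j ≤ ρ / 2 := fun j => by
    rw [hR]
    have : (1 / 2 : ℝ) ^ j ≤ 1 := pow_le_one₀ (by norm_num) (by norm_num)
    nlinarith
  have hRanti : ∀ {j k}, j ≤ k → R k ≤ R j := fun {j k} h => by
    rw [hR]
    have : (1 / 2 : ℝ) ^ k ≤ (1 / 2) ^ j := pow_le_pow_of_le_one (by norm_num) (by norm_num) h
    simp only; gcongr
  refine ⟨R (J + 1), hR0 _, fun u z hu p hp e he => ?_⟩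
  have hEu := hE u z hu
  have hc : ContinuousOn (hs u) (Sq z ρ) := fun q hq =>
      ((hu q hq).1.1.hs).continuousAt.continuousWithinAt
  have hJ0 : 0 < J := by
    have : (0 : ℝ) < J := lt_of_le_of_lt (by positivity) hJ
    exact_mod_cast this
  -- telescoping
  obtain ⟨F, hF⟩ : ∃ F : ℕ → ℝ, F = fun j => ∫ q in Sq z (R j), hs u q := ⟨_, rfl⟩
  have hF0 : ∀ j, 0 ≤ F j := fun j => by
    rw [hF]; exact integral_nonneg fun q => hs_nonneg u q
  have hFE : F 0 ≤ |E| := by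
    have : R 0 = ρ / 2 := by rw [hR]; simp
    rw [hF]; simp only [this]; exact hEu.trans (le_abs_self E)
  have htel : ∑ j ∈ Finset.range J, (F j - F (j + 1)) = F 0 - F J := Finset.sum_range_sub' F J
  obtain ⟨j, hj, hjle⟩ : ∃ j ∈ Finset.range J, F j - F (j + 1) ≤ |E| / J := by
    apply Finset.exists_le_of_sum_le (by simpa using hJ0.ne')
    rw [htel, Finset.sum_const, Finset.card_range, nsmul_eq_mul]
    rw [mul_div_cancel₀ _ (by positivity)]
    linarith [hF0 J]
  have hjJ : j + 1 ≤ J + 1 := by have := Finset.mem_range.1 hj; omega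
  have hsol : ∀ q ∈ Sq z (2 * R (j + 1)), Sol c u q := fun q hq =>
    (hu q (Sq_mono (by rw [hR2]; linarith [hRle j]) hq)).1
  have hz : z ∈ Sq z (R (j + 1)) := mem_Sq.2 (by simpa using (hR0 (j + 1)).le)
  have h := osc_le' (hR0 (j + 1)) hsol hδ0 e he (Sq_mono (hRanti hjJ) hp) hz
  rw [hR2] at h
  have h1 : (∫ q in Sq z (R j), hs u q) - ∫ q in Sq z (R (j + 1)), hs u q ≤ |E| / J := by
    rw [hF] at hjle; exact hjle
  have h2 : |E| / J ≤ δ * ε / 16 := by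
    rw [div_lt_iff₀ (by positivity)] at hJ
    rw [div_le_iff₀ (by positivity)]
    linarith
  have h3 : 1 / δ * ((∫ q in Sq z (R j), hs u q) - ∫ q in Sq z (R (j + 1)), hs u q) ≤
      1 / δ * (δ * ε / 16) := by gcongr; exact h1.trans h2
  have h4 : 1 / δ * (δ * ε / 16) = ε / 16 := by field_simp
  rw [h4] at h3
  linarith

end Osc

/-! ### Bernstein estimate for systems with quadratic growth and small oscillation -/

section Bernstein

variable {f g : ℝ × ℝ → ℝ} {p e e' : ℝ × ℝ} {a b d Λ : ℝ}

/-- Ellipticity with lower constant `1` and coefficients bounded by `Λ`. -/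
structure Ell (Λ a b d : ℝ) : Prop where
  low : ∀ x y : ℝ, x ^ 2 + y ^ 2 ≤ a * x ^ 2 + 2 * b * x * y + d * y ^ 2
  ha : |a| ≤ Λ
  hb : |b| ≤ Λ
  hd : |d| ≤ Λ

lemma Ell.pos (h : Ell Λ a b d) : 0 < a := by
  have := h.low 1 0; linarith

lemma Ell.det (h : Ell Λ a b d) : 0 ≤ a * d - b ^ 2 := by
  have h1 := h.low (-b) a
  have h2 := h.pos
  have : 0 ≤ a * (a * d - b ^ 2) := by nlinarith [sq_nonneg a, sq_nonneg b]
  exact nonneg_of_mul_nonneg_right this h2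

lemma Ell.one_le (h : Ell Λ a b d) : 1 ≤ Λ := by
  have := h.low 1 0
  linarith [le_abs_self a, h.ha]

lemma Ell.GG_self (h : Ell Λ a b d) : pdx f p ^ 2 + pdt f p ^ 2 ≤ GG a b d f f p := by
  have := h.low (pdx f p) (pdt f p)
  unfold GG; linarith

lemma Ell.GG_abs (h : Ell Λ a b d) {x y : ℝ} (hfx : |pdx f p| ≤ x) (hft : |pdt f p| ≤ x)
    (hgx : |pdx g p| ≤ y) (hgt : |pdt g p| ≤ y) : |GG a b d f g p| ≤ 4 * Λ * x * y := by
  have hx : 0 ≤ x := (abs_nonneg _).trans hfx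
  have hy : 0 ≤ y := (abs_nonneg _).trans hgx
  have hΛ : 0 ≤ Λ := by linarith [h.one_le]
  have key : ∀ k s t : ℝ, |k| ≤ Λ → |s| ≤ x → |t| ≤ y → |k * (s * t)| ≤ Λ * x * y := by
    intro k s t h1 h2 h3
    rw [abs_mul, abs_mul, mul_assoc]
    gcongr
  have k1 := abs_le.1 (key a _ _ h.ha hfx hgx)
  have k2 := abs_le.1 (key b _ _ h.hb hfx hgt)
  have k3 := abs_le.1 (key b _ _ h.hb hft hgx)
  have k4 := abs_le.1 (key d _ _ h.hd hft hgt)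
  unfold GG
  rw [abs_le]
  constructor <;> nlinarith [k1.1, k1.2]

/-- The two coordinate directions. -/
def dir (k : Bool) : ℝ × ℝ := bif k then (0, 1) else (1, 0)

variable {ι : Type*}

/-- The family of first derivatives of a family. -/
noncomputable def dz (z : ι → ℝ × ℝ → ℝ) (j : ι × Bool) : ℝ × ℝ → ℝ := pd (dir j.2) (z j.1)

lemma sm_dz {z : ι → ℝ × ℝ → ℝ} (h : ∀ i, Sm (z i) p) (j : ι × Bool) : Sm (dz z j) p := (h j.1).pd

variable [Fintype ι]

/-- Sum of squares of a family of functions. -/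
noncomputable def ss (z : ι → ℝ × ℝ → ℝ) (p : ℝ × ℝ) : ℝ := ∑ i, z i p * z i p

/-- Sum of squares of the gradients of a family of functions. -/
noncomputable def gs (z : ι → ℝ × ℝ → ℝ) (p : ℝ × ℝ) : ℝ :=
  ∑ i, (pdx (z i) p ^ 2 + pdt (z i) p ^ 2)

variable {z : ι → ℝ × ℝ → ℝ}

lemma gs_eq : gs z = ss (dz z) := by
  ext p
  simp only [gs, ss, Fintype.sum_prod_type, Fintype.sum_bool, dz, dir, pdx_eq, pdt_eq, cond_true,
    cond_false]
  exact Finset.sum_congr rfl fun i _ => by ring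

lemma ss_nonneg : 0 ≤ ss z p := Finset.sum_nonneg fun _ _ => mul_self_nonneg _

lemma gs_nonneg : 0 ≤ gs z p := by rw [gs_eq]; exact ss_nonneg

lemma abs_le_of_ss {s : ℝ} (hs : 0 ≤ s) (h : ss z p ≤ s ^ 2) (i : ι) : |z i p| ≤ s := by
  refine abs_le_of_sq_le_sq (le_trans ?_ h) hs
  rw [sq]
  exact Finset.single_le_sum (f := fun i => z i p * z i p) (fun _ _ => mul_self_nonneg _)
    (Finset.mem_univ i)

lemma sm_ss (hz : ∀ i, Sm (z i) p) : Sm (ss z) p :=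
  ContDiffAt.sum fun i _ => (hz i).mul (hz i)

lemma pd_ss (hz : ∀ i, Sm (z i) p) : pd e (ss z) p = 2 * ∑ i, z i p * pd e (z i) p := by
  unfold ss
  rw [pd_sum _ fun i _ => Sm.diff ((hz i).mul (hz i)), Finset.mul_sum]
  refine Finset.sum_congr rfl fun i _ => ?_
  rw [pd_mul (hz i).diff (hz i).diff]; ring

lemma LL_ss (hz : ∀ i, Sm (z i) p) : LL a b d (ss z) p
    = ∑ i, (2 * (z i p * LL a b d (z i) p) + 2 * GG a b d (z i) (z i) p) := by
  unfold ss
  rw [LL_sum _ fun i _ => (hz i).mul (hz i)]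
  refine Finset.sum_congr rfl fun i _ => ?_
  rw [LL_mul (hz i) (hz i)]; ring

lemma Ell.LL_ss_ge (h : Ell Λ a b d) (hz : ∀ i, Sm (z i) p) {s B : ℝ} (hs : 0 ≤ s)
    (hss : ss z p ≤ s ^ 2) (hB : ∀ i, |LL a b d (z i) p| ≤ B) :
    2 * gs z p - 2 * Fintype.card ι * (s * B) ≤ LL a b d (ss z) p := by
  rw [LL_ss hz]
  have : ∀ i ∈ Finset.univ, 2 * (pdx (z i) p ^ 2 + pdt (z i) p ^ 2) - 2 * (s * B)
      ≤ 2 * (z i p * LL a b d (z i) p) + 2 * GG a b d (z i) (z i) p := by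
    intro i _
    have h1 := h.GG_self (f := z i) (p := p)
    have h2 : |z i p * LL a b d (z i) p| ≤ s * B := by
      rw [abs_mul]
      exact mul_le_mul (abs_le_of_ss hs hss i) (hB i) (abs_nonneg _) hs
    linarith [(abs_le.1 h2).1]
  refine le_trans (le_of_eq ?_) (Finset.sum_le_sum this)
  rw [Finset.sum_sub_distrib, ← Finset.mul_sum, Finset.sum_const, Finset.card_univ, nsmul_eq_mul]
  unfold gs; ring

lemma abs_pd_ss (hz : ∀ i, Sm (z i) p) {s r : ℝ} (hs : 0 ≤ s) (hr : 0 ≤ r)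
    (hss : ss z p ≤ s ^ 2) (hgs : gs z p ≤ r ^ 2) (k : Bool) :
    |pd (dir k) (ss z) p| ≤ 2 * s * r := by
  rw [pd_ss hz]
  have hC := Finset.sum_mul_sq_le_sq_mul_sq Finset.univ (fun i => z i p)
    (fun i => pd (dir k) (z i) p)
  have h1 : ∑ i, z i p ^ 2 ≤ s ^ 2 := by
    refine le_trans (le_of_eq ?_) hss
    exact Finset.sum_congr rfl fun i _ => by ring
  have h2 : ∑ i, pd (dir k) (z i) p ^ 2 ≤ r ^ 2 := by
    refine le_trans (Finset.sum_le_sum fun i _ => ?_) hgs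
    cases k
    · exact le_add_of_nonneg_right (sq_nonneg _)
    · exact le_add_of_nonneg_left (sq_nonneg _)
  have h3 : (∑ i, z i p * pd (dir k) (z i) p) ^ 2 ≤ (s * r) ^ 2 := by
    rw [mul_pow]
    exact hC.trans (mul_le_mul h1 h2 (Finset.sum_nonneg fun i _ => sq_nonneg _) (sq_nonneg _))
  have h4 := abs_le_of_sq_le_sq h3 (by positivity)
  rw [abs_mul, abs_of_pos (by norm_num : (0 : ℝ) < 2)]
  linarith

lemma bernstein_algebra {ε N C C2 K M s r Z LZ LQ G : ℝ} (hΛ : 1 ≤ Λ) (hε : 0 < ε) (hN : 0 ≤ N)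
    (hC : 0 ≤ C) (hC2 : 0 ≤ C2) (hM : M = 1024 * Λ ^ 2) (hK : K = M * ε ^ 2)
    (h1 : 2 * N * ε * C ≤ 1 / 2) (h2 : (M + 1) * ε ^ 2 * (4 * N * C) ≤ 1 / 8)
    (h3 : ((M + 1) * ε ^ 2 * (4 * N * C)) ^ 2 ≤ K / 4)
    (hs : 0 ≤ s) (hr : 0 ≤ r) (hZ : 0 ≤ Z) (hZ2 : Z ≤ ε ^ 2)
    (hLZ : 2 * s ^ 2 - 2 * N * (ε * (C * (C2 + s ^ 2))) ≤ LZ)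
    (hLQ : 2 * r ^ 2 - 2 * (N * 2) * (s * (C * (C2 + s ^ 3 + (C2 + s) * r))) ≤ LQ)
    (hG : |G| ≤ 4 * Λ * (2 * ε * s) * (2 * s * r)) :
    s ^ 4 / 2 - ((C2 + C2 ^ 2) ^ 2 / 2 + C2) ≤ (K + Z) * LQ + s ^ 2 * LZ + 2 * G := by
  obtain ⟨β, hβ⟩ : ∃ β, β = (M + 1) * ε ^ 2 * (4 * N * C) := ⟨_, rfl⟩
  have hM0 : 0 < M := by rw [hM]; positivity
  have hK0 : 0 < K := by rw [hK]; positivity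
  have hβ0 : 0 ≤ β := by rw [hβ]; positivity
  rw [← hβ] at h2 h3
  have a1 : (K + Z) * LQ ≥ 2 * K * r ^ 2 - β * (C2 * s + s ^ 4 + C2 * s * r + s ^ 2 * r) := by
    obtain ⟨X, hX⟩ : ∃ X, X = C2 * s + s ^ 4 + C2 * s * r + s ^ 2 * r := ⟨_, rfl⟩
    have hX0 : 0 ≤ X := by rw [hX]; positivity
    have e1 : 2 * r ^ 2 - 2 * (N * 2) * (s * (C * (C2 + s ^ 3 + (C2 + s) * r)))
      = 2 * r ^ 2 - 4 * N * C * X := by rw [hX]; ring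
    rw [e1] at hLQ
    have e2 : (K + Z) * (2 * r ^ 2 - 4 * N * C * X) ≤ (K + Z) * LQ := by gcongr
    have e3 : (K + Z) * (4 * N * C * X) ≤ (M + 1) * ε ^ 2 * (4 * N * C * X) := by
      gcongr; rw [hK]; linarith
    have e4 : 0 ≤ Z * r ^ 2 := by positivity
    rw [← hX, hβ]
    linarith
  have a2 : s ^ 2 * LZ ≥ 3 / 2 * s ^ 4 - C2 / 2 * s ^ 2 := by
    have e1 : 2 * N * ε * C * (C2 + s ^ 2) ≤ 1 / 2 * (C2 + s ^ 2) := by gcongr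
    have e2 : s ^ 2 * (3 / 2 * s ^ 2 - C2 / 2) ≤ s ^ 2 * LZ := by gcongr; linarith
    linarith
  have a3 : 2 * G ≥ - (K * r ^ 2) - s ^ 4 / 4 := by
    have e1 := (abs_le.1 hG).1
    have e2 : K = (32 * Λ * ε) ^ 2 := by rw [hK, hM]; ring
    rw [e2]
    linarith [sq_nonneg (32 * Λ * ε * r - s ^ 2 / 2)]
  have a4 : β * (s ^ 2 * r) ≤ K * r ^ 2 / 2 + s ^ 4 / 8 := by
    have e1 : β ^ 2 * s ^ 4 ≤ K / 4 * s ^ 4 := by gcongr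
    have e2 : 0 ≤ (K * r - β * s ^ 2) ^ 2 := sq_nonneg _
    have e3 : K * (β * (s ^ 2 * r)) ≤ K * (K * r ^ 2 / 2 + s ^ 4 / 8) := by linarith
    exact le_of_mul_le_mul_left e3 hK0
  have a5 : β * (C2 * s * r) ≤ K * r ^ 2 / 2 + C2 ^ 2 * s ^ 2 / 8 := by
    have e1 : β ^ 2 * (C2 ^ 2 * s ^ 2) ≤ K / 4 * (C2 ^ 2 * s ^ 2) := by gcongr
    have e2 : 0 ≤ (K * r - β * (C2 * s)) ^ 2 := sq_nonneg _
    have e3 : K * (β * (C2 * s * r)) ≤ K * (K * r ^ 2 / 2 + C2 ^ 2 * s ^ 2 / 8) := by linarith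
    exact le_of_mul_le_mul_left e3 hK0
  have a6 : β * s ^ 4 ≤ 1 / 8 * s ^ 4 := by gcongr
  have a7 : β * (C2 * s) ≤ 1 / 8 * (C2 * (s ^ 2 + 1)) := by
    gcongr; nlinarith [sq_nonneg (s - 1)]
  linarith [sq_nonneg (s ^ 2 - (C2 + C2 ^ 2)), mul_nonneg hC2 (sq_nonneg s),
    mul_nonneg (sq_nonneg C2) (sq_nonneg s)]

/-- Inequality at an interior maximum of a localized function. -/
lemma Ell.cutoff_nonpos (h : Ell Λ a b d) {η H : ℝ × ℝ → ℝ} (hη : Sm η p) (hH : Sm H p)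
    (hpos : 0 < η p) (hmax : IsLocalMax (fun q => η q * η q * H q) p) :
    η p ^ 2 * LL a b d H p + 2 * H p * (η p * LL a b d η p) - 6 * H p * GG a b d η η p ≤ 0 := by
  have hηη : Sm (fun q => η q * η q) p := hη.mul hη
  have hle := LL_nonpos_of_isLocalMax h.pos h.det (hηη.mul hH) hmax
  rw [LL_mul hηη hH, LL_mul hη hη] at hle
  have hd : ∀ e, η p * pd e H p = -2 * H p * pd e η p := by
    intro e
    have := pd_eq_zero_of_isLocalMax (e := e) hmax
    rw [pd_mul hηη.diff hH.diff, pd_mul hη.diff hη.diff] at this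
    have h2 : η p * (η p * pd e H p + 2 * H p * pd e η p) = 0 := by linarith
    rcases mul_eq_zero.1 h2 with h3 | h3
    · exact absurd h3 hpos.ne'
    · linarith
  have hG : GG a b d (fun q => η q * η q) H p = -4 * H p * GG a b d η η p := by
    have hx := hd (1, 0)
    have ht := hd (0, 1)
    simp only [GG, pdx_eq, pdt_eq, pd_mul hη.diff hη.diff]
    linear_combination (2 * a * pd (1, 0) η p + 2 * b * pd (0, 1) η p) * hx
      + (2 * d * pd (0, 1) η p + 2 * b * pd (1, 0) η p) * ht
  rw [hG] at hle
  linarith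

end Bernstein

section BernsteinMain

variable {a b d Λ : ℝ}

lemma quad_bound {T A B : ℝ} (hA : 0 ≤ A) (hB : 0 ≤ B) (h : T ^ 2 / 2 ≤ A * T + B) :
    T ≤ 2 * A + 2 * B + 1 := by
  by_contra! h1
  nlinarith [mul_pos (by linarith : 0 < T) (by linarith : 0 < T - (2 * A + 2 * B + 1)),
    mul_nonneg hB (by linarith : 0 ≤ T - 1)]

lemma bernstein_const {Λ C N : ℝ} (hΛ : 1 ≤ Λ) (hC : 0 ≤ C) (hN : 0 ≤ N) :
    ∃ ε₀ > 0, ∀ ε, 0 < ε → ε ≤ ε₀ → ∀ M, M = 1024 * Λ ^ 2 →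
      2 * N * ε * C ≤ 1 / 2 ∧ (M + 1) * ε ^ 2 * (4 * N * C) ≤ 1 / 8 ∧
      ((M + 1) * ε ^ 2 * (4 * N * C)) ^ 2 ≤ M * ε ^ 2 / 4 := by
  obtain ⟨κ, hκ⟩ : ∃ κ, κ = (1024 * Λ ^ 2 + 1) * (4 * N * C) + 1 := ⟨_, rfl⟩
  have hκ1 : 1 ≤ κ := by rw [hκ]; linarith [show 0 ≤ (1024 * Λ ^ 2 + 1) * (4 * N * C) by positivity]
  refine ⟨1 / (8 * κ), by positivity, fun ε hε hε0 M hM => ?_⟩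
  have hεκ : ε * κ ≤ 1 / 8 := by
    rw [le_div_iff₀ (by positivity)] at hε0; linarith
  have hε1 : ε ≤ 1 := by nlinarith
  have hM1 : 1 ≤ M := by rw [hM]; nlinarith
  have h0 : 0 ≤ (M + 1) * (4 * N * C) := by positivity
  have hle : (M + 1) * (4 * N * C) ≤ κ := by rw [hκ, hM]; linarith
  have h1 : ε * ((M + 1) * (4 * N * C)) ≤ 1 / 8 := le_trans (by gcongr) hεκ
  refine ⟨?_, ?_, ?_⟩
  · have : 0 ≤ ε * (M * (4 * N * C)) := by positivity
    linarith
  · have : ε * (ε * ((M + 1) * (4 * N * C))) ≤ 1 * (1 / 8) := by gcongr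
    linarith
  · have h2 : (ε * ((M + 1) * (4 * N * C))) ^ 2 ≤ (1 / 8) ^ 2 := by gcongr
    have h3 : ε ^ 2 * (ε * ((M + 1) * (4 * N * C))) ^ 2 ≤ ε ^ 2 * (1 / 8) ^ 2 := by gcongr
    have h4 : ε ^ 2 * 1 ≤ ε ^ 2 * M := by gcongr
    linarith [sq_nonneg ε]

variable {ι : Type*} [Fintype ι]

/-- Structure conditions for the Bernstein estimate at a point. -/
structure BernsteinCond (Λ C C2 ε a b d : ℝ) (z : ι → ℝ × ℝ → ℝ) (p : ℝ × ℝ) : Prop where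
  ell : Ell Λ a b d
  sm : ∀ i, Sm (z i) p
  small : ss z p ≤ ε ^ 2
  le₁ : ∀ i, |LL a b d (z i) p| ≤ C * (C2 + gs z p)
  le₂ : ∀ j, |LL a b d (dz z j) p| ≤
    C * (C2 + √(gs z p) ^ 3 + (C2 + √(gs z p)) * √(gs (dz z) p))

variable {z : ι → ℝ × ℝ → ℝ} {p : ℝ × ℝ}

/-- The auxiliary function of the Bernstein argument. -/
noncomputable def bH (K : ℝ) (z : ι → ℝ × ℝ → ℝ) (p : ℝ × ℝ) : ℝ :=
  (ss z p + K) * ss (dz z) p + 1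

lemma sm_bH {K : ℝ} (h : ∀ i, Sm (z i) p) : Sm (bH K z) p :=
  (((sm_ss h).add contDiffAt_const).mul (sm_ss (sm_dz h))).add contDiffAt_const

lemma LL_bH {K : ℝ} (h : ∀ i, Sm (z i) p) : LL a b d (bH K z) p
    = (K + ss z p) * LL a b d (ss (dz z)) p + ss (dz z) p * LL a b d (ss z) p
      + 2 * GG a b d (ss z) (ss (dz z)) p := by
  have h1 : Sm (fun q => ss z q + K) p := (sm_ss h).add contDiffAt_const
  have h2 := sm_ss (sm_dz h)
  have hd : ∀ e, pd e (fun q => ss z q + K) p = pd e (ss z) p := fun e => by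
    rw [pd_add (sm_ss h).diff (differentiableAt_const _), pd_const, add_zero]
  unfold bH
  rw [LL_add (h1.mul h2) contDiffAt_const, LL_const, LL_mul h1 h2,
    LL_add (sm_ss h) contDiffAt_const, LL_const]
  simp only [GG, pdx_eq, pdt_eq, hd]
  ring

lemma BernsteinCond.LL_bH_ge {C C2 ε K M : ℝ} (h : BernsteinCond Λ C C2 ε a b d z p)
    (hε : 0 < ε) (hC : 0 ≤ C) (hC2 : 0 ≤ C2) (hM : M = 1024 * Λ ^ 2) (hK : K = M * ε ^ 2)
    (h1 : 2 * (Fintype.card ι : ℝ) * ε * C ≤ 1 / 2)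
    (h2 : (M + 1) * ε ^ 2 * (4 * (Fintype.card ι : ℝ) * C) ≤ 1 / 8)
    (h3 : ((M + 1) * ε ^ 2 * (4 * (Fintype.card ι : ℝ) * C)) ^ 2 ≤ K / 4) :
    ss (dz z) p ^ 2 / 2 - ((C2 + C2 ^ 2) ^ 2 / 2 + C2) ≤ LL a b d (bH K z) p := by
  obtain ⟨s, hs⟩ : ∃ s, s = √(gs z p) := ⟨_, rfl⟩
  obtain ⟨r, hr⟩ : ∃ r, r = √(gs (dz z) p) := ⟨_, rfl⟩
  have hs0 : 0 ≤ s := hs ▸ Real.sqrt_nonneg _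
  have hr0 : 0 ≤ r := hr ▸ Real.sqrt_nonneg _
  have hgs : gs z p = s ^ 2 := by rw [hs, Real.sq_sqrt gs_nonneg]
  have hgr : gs (dz z) p = r ^ 2 := by rw [hr, Real.sq_sqrt gs_nonneg]
  have hsd : ss (dz z) p = s ^ 2 := by rw [← gs_eq, hgs]
  have hl1 := h.le₁
  have hl2 := h.le₂
  rw [← hs, ← hr] at hl2
  rw [hgs] at hl1
  have hLZ := h.ell.LL_ss_ge h.sm hε.le h.small hl1
  have hLQ := h.ell.LL_ss_ge (sm_dz h.sm) hs0 hsd.le hl2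
  have hG := h.ell.GG_abs (f := ss z) (g := ss (dz z)) (p := p)
    (abs_pd_ss h.sm hε.le hs0 h.small hgs.le false) (abs_pd_ss h.sm hε.le hs0 h.small hgs.le true)
    (abs_pd_ss (sm_dz h.sm) hs0 hr0 hsd.le hgr.le false)
    (abs_pd_ss (sm_dz h.sm) hs0 hr0 hsd.le hgr.le true)
  rw [hgs] at hLZ
  rw [hgr, Fintype.card_prod, Fintype.card_bool] at hLQ
  push_cast at hLQ
  have := bernstein_algebra h.ell.one_le hε (Nat.cast_nonneg _) hC hC2 hM hK h1 h2 h3 hs0 hr0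
    ss_nonneg h.small hLZ hLQ hG
  rw [LL_bH h.sm, hsd]
  linarith

set_option maxHeartbeats 1000000 in
/-- Interior gradient bound for families of small functions satisfying a system with quadratic
growth. -/
theorem bernstein (ι : Type*) [Fintype ι] {C : ℝ} (hΛ : 1 ≤ Λ) (hC : 0 ≤ C) :
    ∃ ε₀ > 0, ∀ ε, 0 < ε → ε ≤ ε₀ → ∀ C2 ≥ 0, ∀ R > 0, ∃ B, ∀ (α β δ : ℝ × ℝ → ℝ)
      (z : ι → ℝ × ℝ → ℝ) (z₀ : ℝ × ℝ),
      (∀ p, sqd z₀ p ≤ R ^ 2 → BernsteinCond Λ C C2 ε (α p) (β p) (δ p) z p) →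
      ∀ p, sqd z₀ p ≤ R ^ 2 / 4 → gs z p ≤ B := by
  obtain ⟨ε₀, hε₀, hconst⟩ := bernstein_const hΛ hC (Nat.cast_nonneg (Fintype.card ι))
  refine ⟨ε₀, hε₀, fun ε hε hεε C2 hC2 R hR => ?_⟩
  obtain ⟨M, hM⟩ : ∃ M, M = 1024 * Λ ^ 2 := ⟨_, rfl⟩
  obtain ⟨K, hK⟩ : ∃ K, K = M * ε ^ 2 := ⟨_, rfl⟩
  have hM0 : 0 < M := by rw [hM]; positivity
  have hK0 : 0 < K := by rw [hK]; positivity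
  obtain ⟨h1, h2, h3⟩ := hconst ε hε hεε M hM
  rw [← hK] at h3
  obtain ⟨A₀, hA₀⟩ : ∃ A₀, A₀ = ε ^ 2 + K := ⟨_, rfl⟩
  obtain ⟨C6, hC6⟩ : ∃ C6, C6 = (C2 + C2 ^ 2) ^ 2 / 2 + C2 := ⟨_, rfl⟩
  obtain ⟨C7, hC7⟩ : ∃ C7, C7 = 104 * Λ / R ^ 2 := ⟨_, rfl⟩
  have hA0 : 0 < A₀ := by rw [hA₀]; positivity
  have hC60 : 0 ≤ C6 := by rw [hC6]; positivity
  have hC70 : 0 ≤ C7 := by rw [hC7]; positivity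
  obtain ⟨T₀, hT₀⟩ : ∃ T₀, T₀ = 2 * (C7 * A₀) + 2 * (C6 + C7) + 1 := ⟨_, rfl⟩
  refine ⟨(A₀ * T₀ + 1) * 16 / (9 * K), fun α β δ z z₀ hz p hp => ?_⟩
  set η : ℝ × ℝ → ℝ := fun q => 1 + (-1 / R ^ 2) * sqd z₀ q with hηdef
  have hηeq : ∀ q, η q = 1 - sqd z₀ q / R ^ 2 := fun q => by simp only [hηdef]; ring
  have hsq : ∀ q, Sm (fun q => (-1 / R ^ 2) * sqd z₀ q) q := fun q =>
    contDiffAt_const.mul (sm_sqd z₀ q)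
  have hsη : ∀ q, Sm η q := fun q => contDiffAt_const.add (hsq q)
  have hη34 : ∀ q, sqd z₀ q ≤ R ^ 2 / 4 → 3 / 4 ≤ η q := by
    intro q hq
    have : sqd z₀ q / R ^ 2 ≤ 1 / 4 := by rw [div_le_iff₀ (by positivity)]; linarith
    rw [hηeq]; linarith
  have hη1 : ∀ q, η q ≤ 1 := fun q => by
    have := sqd_nonneg z₀ q
    have : 0 ≤ sqd z₀ q / R ^ 2 := by positivity
    rw [hηeq]; linarith
  have hsd0 : ∀ q, 0 ≤ ss (dz z) q := fun q => ss_nonneg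
  have hs0 : ∀ q, 0 ≤ ss z q := fun q => ss_nonneg
  have hH1 : ∀ q, 1 ≤ bH K z q := fun q => by
    have h1 := hsd0 q
    have h2 := hs0 q
    have : 0 ≤ (ss z q + K) * ss (dz z) q := by positivity
    unfold bH; linarith
  have hz0 : sqd z₀ z₀ ≤ R ^ 2 / 4 := by rw [sqd_self]; positivity
  obtain ⟨q, hq, hηq, hmax, hle⟩ := exists_isLocalMax_disc (z := z₀) (R := R) (φ := η)
    (F := fun q => η q * η q * bH K z q)
    (fun q hq => (((hsη q).mul (hsη q)).mul (sm_bH (hz q hq).sm)).continuousAt.continuousWithinAt)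
    (fun q _ => (hsη q).continuousAt.continuousWithinAt) (fun q _ => (hηeq q).le) hR
    (fun q _ hq => by simp [hq]) (by linarith [hη34 z₀ hz0])
    (by have := hη34 z₀ hz0; have := hH1 z₀; positivity)
  have hc := hz q hq
  have hLH := hc.LL_bH_ge hε hC hC2 hM hK h1 h2 h3
  have hcut := hc.ell.cutoff_nonpos (hsη q) (sm_bH (K := K) hc.sm) hηq hmax
  have hLη : -(4 * Λ / R ^ 2) ≤ LL (α q) (β q) (δ q) η q := by
    simp only [hηdef]
    rw [LL_add contDiffAt_const (hsq q), LL_const, LL_const_mul _ (sm_sqd z₀ q)]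
    have e : LL (α q) (β q) (δ q) (sqd z₀) q = 2 * α q + 2 * δ q := by
      simp only [LL, pdx_eq, pdt_eq, pdpd_sqd]; ring
    rw [e]
    have h1 := (le_abs_self _).trans hc.ell.ha
    have h2 := (le_abs_self _).trans hc.ell.hd
    have : (2 * α q + 2 * δ q) / R ^ 2 ≤ 4 * Λ / R ^ 2 := by gcongr; linarith
    have e2 : 0 + -1 / R ^ 2 * (2 * α q + 2 * δ q) = -((2 * α q + 2 * δ q) / R ^ 2) := by ring
    rw [e2]; linarith
  have hdη : ∀ e, pd e η q = (-1 / R ^ 2) * pd e (sqd z₀) q := fun e => by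
    simp only [hηdef]
    rw [pd_add (differentiableAt_const _) (hsq q).diff, pd_const,
      pd_const_mul _ (sm_sqd z₀ q).diff, zero_add]
  have hsqq : (q.1 - z₀.1) ^ 2 + (q.2 - z₀.2) ^ 2 ≤ R ^ 2 := hq
  have hx1 : |q.1 - z₀.1| ≤ R := abs_le_of_sq_le_sq (by nlinarith [sq_nonneg (q.2 - z₀.2)]) hR.le
  have hx2 : |q.2 - z₀.2| ≤ R := abs_le_of_sq_le_sq (by nlinarith [sq_nonneg (q.1 - z₀.1)]) hR.le
  have hbd : ∀ x : ℝ, |x| ≤ R → |(-1 / R ^ 2) * (2 * x)| ≤ 2 / R := by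
    intro x hx
    rw [abs_mul, abs_div, abs_neg, abs_one, abs_mul, abs_of_pos (by positivity : 0 < R ^ 2), abs_two]
    calc 1 / R ^ 2 * (2 * |x|) ≤ 1 / R ^ 2 * (2 * R) := by gcongr
      _ = 2 / R := by field_simp
  have hGη := hc.ell.GG_abs (f := η) (g := η) (p := q) (x := 2 / R) (y := 2 / R)
    (by rw [pdx_eq, hdη, pd_sqd]; simpa using hbd _ hx1)
    (by rw [pdt_eq, hdη, pd_sqd]; simpa using hbd _ hx2)
    (by rw [pdx_eq, hdη, pd_sqd]; simpa using hbd _ hx1)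
    (by rw [pdt_eq, hdη, pd_sqd]; simpa using hbd _ hx2)
  have hGη' : GG (α q) (β q) (δ q) η η q ≤ 16 * Λ / R ^ 2 := by
    refine ((le_abs_self _).trans hGη).trans (le_of_eq ?_); field_simp; ring
  have hH := hH1 q
  have hη := hη1 q
  have hHle : bH K z q ≤ A₀ * ss (dz z) q + 1 := by
    have := hsd0 q
    have := hc.small
    unfold bH; rw [hA₀]; gcongr
  have hmain : η q ^ 2 * (ss (dz z) q ^ 2 / 2 - C6) ≤ C7 * bH K z q := by
    have e1 : η q ^ 2 * (ss (dz z) q ^ 2 / 2 - C6) ≤ η q ^ 2 * LL (α q) (β q) (δ q) (bH K z) q := by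
      gcongr; rw [hC6]; exact hLH
    have hΛR : 0 ≤ 4 * Λ / R ^ 2 := by positivity
    have e2 : -(4 * Λ / R ^ 2) ≤ η q * LL (α q) (β q) (δ q) η q := by
      linarith [mul_le_mul_of_nonneg_left hLη hηq.le,
        mul_nonneg (by linarith : 0 ≤ 1 - η q) hΛR]
    have e3 : 2 * bH K z q * -(4 * Λ / R ^ 2) ≤
      2 * bH K z q * (η q * LL (α q) (β q) (δ q) η q) := by gcongr
    have e4 : 6 * bH K z q * GG (α q) (β q) (δ q) η η q ≤ 6 * bH K z q * (16 * Λ / R ^ 2) := by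
      gcongr
    have e5 : C7 * bH K z q = 2 * bH K z q * (4 * Λ / R ^ 2) + 6 * bH K z q * (16 * Λ / R ^ 2) := by
      rw [hC7]; ring
    linarith
  have hη2 : η q ^ 2 ≤ 1 := by nlinarith
  have hT : η q ^ 2 * ss (dz z) q ≤ T₀ := by
    rw [hT₀]
    apply quad_bound (by positivity) (by positivity)
    have e1 : η q ^ 2 * (η q ^ 2 * (ss (dz z) q ^ 2 / 2 - C6))
      ≤ η q ^ 2 * (C7 * (A₀ * ss (dz z) q + 1))  :=
      mul_le_mul_of_nonneg_left (hmain.trans (mul_le_mul_of_nonneg_left hHle hC70)) (sq_nonneg _)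
    have e2 : η q ^ 2 * (η q ^ 2 * C6) ≤ 1 * (1 * C6) := by gcongr
    have e3 : η q ^ 2 * C7 ≤ 1 * C7 := by gcongr
    linarith
  have hfin := hle p (hp.trans (by nlinarith [sq_nonneg R])) (by linarith [hη34 p hp])
  have hp34 := hη34 p hp
  rw [gs_eq, le_div_iff₀ (by positivity)]
  have f1 : η q * η q * bH K z q ≤ A₀ * T₀ + 1 := by
    have : η q * η q * bH K z q ≤ η q * η q * (A₀ * ss (dz z) q + 1) := by gcongr
    have : A₀ * (η q ^ 2 * ss (dz z) q) ≤ A₀ * T₀ := by gcongr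
    linarith
  have f2 : 3 / 4 * (3 / 4) * (K * ss (dz z) p) ≤ η p * η p * bH K z p := by
    have h1 := hsd0 p
    have h2 := hs0 p
    have : K * ss (dz z) p ≤ bH K z p := by
      have : 0 ≤ ss z p * ss (dz z) p := by positivity
      unfold bH; linarith
    have : 0 ≤ bH K z p := by linarith [hH1 p]
    gcongr
  linarith

end BernsteinMain

/-! ### Iterated derivatives and weighted differential polynomials -/

section Jets

variable {u : ℝ × ℝ → ℝ} {p : ℝ × ℝ} {c : ℝ}

/-- The iterated partial derivative along a word of coordinate directions. -/
noncomputable def J : List Bool → (ℝ × ℝ → ℝ) → ℝ × ℝ → ℝ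
  | [], u => u
  | k :: w, u => pd (dir k) (J w u)

lemma Sm.J (h : Sm u p) : ∀ w, Sm (J w u) p
  | [] => h
  | _ :: w => (Sm.J h w).pd

/-- Differential polynomials in jets of order at most `N`, where jets of order `m + i` count
with weight `i` and the total weight is at most `k`. -/
inductive Wt (m N : ℕ) : ℕ → ((ℝ × ℝ → ℝ) → ℝ × ℝ → ℝ) → Prop
  | const (k : ℕ) (a : ℝ) : Wt m N k (fun _ _ => a)
  | jet (k : ℕ) (w : List Bool) (hN : w.length ≤ N) (hk : w.length ≤ m + k) :
      Wt m N k (fun u p => J w u p)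
  | add {k : ℕ} {F G : (ℝ × ℝ → ℝ) → ℝ × ℝ → ℝ} (hF : Wt m N k F) (hG : Wt m N k G) :
      Wt m N k (fun u p => F u p + G u p)
  | mul {k i j : ℕ} {F G : (ℝ × ℝ → ℝ) → ℝ × ℝ → ℝ} (hF : Wt m N i F) (hG : Wt m N j G)
      (h : i + j ≤ k) : Wt m N k (fun u p => F u p * G u p)

variable {m N k : ℕ} {F : (ℝ × ℝ → ℝ) → ℝ × ℝ → ℝ}

lemma Wt.sm (hF : Wt m N k F) (h : Sm u p) : Sm (F u) p := by
  induction hF with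
  | const => exact contDiffAt_const
  | jet _ w => exact Sm.J h w
  | add _ _ h1 h2 => exact ContDiffAt.add h1 h2
  | mul _ _ _ h1 h2 => exact ContDiffAt.mul h1 h2

lemma Wt.mono_order (hF : Wt m N k F) {N' : ℕ} (hN : N ≤ N') : Wt m N' k F := by
  induction hF with
  | const => exact .const _ _
  | jet k w h1 h2 => exact .jet k w (h1.trans hN) h2
  | add _ _ h1 h2 => exact .add h1 h2
  | mul _ _ h h1 h2 => exact .mul h1 h2 h

lemma Wt.mono_weight (hF : Wt m N k F) {k' : ℕ} (hk : k ≤ k') : Wt m N k' F := by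
  induction hF generalizing k' with
  | const => exact .const _ _
  | jet k w h1 h2 => exact .jet _ w h1 (by omega)
  | add _ _ h1 h2 => exact .add (h1 hk) (h2 hk)
  | mul h3 h4 h _ _ => exact .mul h3 h4 (h.trans hk)

lemma Wt.weight_zero (hF : Wt m N k F) : Wt N N 0 F := by
  induction hF with
  | const => exact .const _ _
  | jet k w h1 h2 => exact .jet _ w h1 h1
  | add _ _ h1 h2 => exact .add h1 h2
  | mul _ _ _ h1 h2 => exact .mul h1 h2 le_rfl

lemma Wt.deriv (hF : Wt m N k F) (l : Bool) :
    ∃ F', Wt m (N + 1) (k + 1) F' ∧ ∀ u p, Sm u p → pd (dir l) (F u) p = F' u p := by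
  induction hF with
  | const k a => exact ⟨_, .const _ 0, fun u p _ => pd_const a⟩
  | jet k w h1 h2 =>
    exact ⟨_, .jet _ (l :: w) (by simpa using h1) (by simp; omega), fun u p _ => rfl⟩
  | add hF hG h1 h2 =>
    obtain ⟨F', hF', e1⟩ := h1
    obtain ⟨G', hG', e2⟩ := h2
    refine ⟨_, .add hF' hG', fun u p h => ?_⟩
    rw [← e1 u p h, ← e2 u p h]
    exact pd_add (Sm.diff (hF.sm h)) (Sm.diff (hG.sm h))
  | mul hF hG h h1 h2 =>
    obtain ⟨F', hF', e1⟩ := h1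
    obtain ⟨G', hG', e2⟩ := h2
    refine ⟨_, .add (.mul (hF.mono_order (Nat.le_succ _)) hG' (by omega))
      (.mul hF' (hG.mono_order (Nat.le_succ _)) (by omega)), fun u p h => ?_⟩
    rw [← e1 u p h, ← e2 u p h]
    exact pd_mul (Sm.diff (hF.sm h)) (Sm.diff (hG.sm h))

/-- The second order part of the translator operator at `u`, applied to `w`. -/
noncomputable def Lu (u w : ℝ × ℝ → ℝ) (p : ℝ × ℝ) : ℝ :=
  LL (1 + pdt u p ^ 2) (-(pdx u p * pdt u p)) (1 + pdx u p ^ 2) w p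

lemma pd_Lu {w : ℝ × ℝ → ℝ} (hu : Sm u p) (hw : Sm w p) (e : ℝ × ℝ) :
    pd e (Lu u w) p = Lu u (pd e w) p + (2 * pdt u p * pd e (pdt u) p * pdx (pdx w) p
      - 2 * (pdx u p * pd e (pdt u) p + pd e (pdx u) p * pdt u p) * pdx (pdt w) p
      + 2 * pdx u p * pd e (pdx u) p * pdt (pdt w) p) := by
  have hx : DifferentiableAt ℝ (pdx u) p := Sm.diff hu.pdx
  have ht : DifferentiableAt ℝ (pdt u) p := Sm.diff hu.pdt
  have dA : DifferentiableAt ℝ (fun y => 1 + pdt u y ^ 2) p := by fun_prop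
  have dC : DifferentiableAt ℝ (fun y => 1 + pdx u y ^ 2) p := by fun_prop
  have dB : DifferentiableAt ℝ (fun y => (-(pdx u y * pdt u y))) p := by fun_prop
  have hB : pd e (fun y => (-(pdx u y * pdt u y))) p
      = - (pdx u p * pd e (pdt u) p + pd e (pdx u) p * pdt u p) := by
    have := pd_const_mul (e := e) (-1) (hx.fun_mul ht)
    simp only [neg_mul, one_mul] at this
    rw [this, pd_mul hx ht]
  have := pd_LL_var (e := e) dA dB dC hw
  rw [hB, pd_one_add_sq ht, pd_one_add_sq hx] at this
  unfold Lu
  rw [this]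
  ring

/-- `F` expresses the translator operator applied to the jet `w`. -/
def IsRem (c : ℝ) (w : List Bool) (F : (ℝ × ℝ → ℝ) → ℝ × ℝ → ℝ) : Prop :=
  ∀ u p, (∀ᶠ y in 𝓝 p, Sol c u y) → Lu u (J w u) p = F u p

lemma exists_isRem_cons {w : List Bool} (hR : IsRem c w F) (hF : Wt m N k F) (l : Bool)
    {i j : ℕ} (hm : 1 ≤ m) (hN : w.length + 1 ≤ N) (hN1 : 1 ≤ N) (hi : 2 ≤ m + i)
    (hj : w.length + 2 ≤ m + j) (hij : i + j ≤ k + 1) :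
    ∃ F', Wt m (N + 1) (k + 1) F' ∧ IsRem c (l :: w) F' := by
  obtain ⟨F', hF', e⟩ := hF.deriv l
  have j1 : ∀ a, Wt m (N + 1) 0 (fun u p => J [a] u p) := fun a =>
    .jet 0 [a] (by simp) (by simpa)
  have j2 : ∀ a b, Wt m (N + 1) i (fun u p => J [a, b] u p) := fun a b =>
    .jet i [a, b] (by simp; omega) (by simpa)
  have j3 : ∀ a b, Wt m (N + 1) j (fun u p => J (a :: b :: w) u p) := fun a b =>
    .jet j _ (by simp; omega) (by simpa)
  have T : ∀ (r : ℝ) (a b b' d d' : Bool), Wt m (N + 1) (k + 1)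
      (fun u p => r * (J [a] u p * (J [b, b'] u p * J (d :: d' :: w) u p))) := fun r a b b' d d' =>
    .mul (.const 0 r) (.mul (k := k + 1) (j1 a) (.mul (j2 b b') (j3 d d') hij) (by omega))
      (by omega)
  refine ⟨_, .add hF' (.add (.add (T (-2) true l true false false)
    (T 2 false l true false true)) (.add (T 2 true l false false true)
    (T (-2) false l false true true))), fun u p h => ?_⟩
  have hs : Sm u p := h.self_of_nhds.1
  have h1 := pd_Lu hs (hs.J w) (dir l)
  have h2 : pd (dir l) (Lu u (J w u)) p = pd (dir l) (F u) p := by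
    apply pd_congr
    filter_upwards [eventually_eventually_nhds.2 h] with y hy
    exact hR u y hy
  rw [h2, e u p hs] at h1
  simp only [J, pdx_eq, pdt_eq, dir, cond_true, cond_false] at h1 ⊢
  linear_combination -h1

lemma exists_isRem_singleton (c : ℝ) (l : Bool) : ∃ F, Wt 1 2 2 F ∧ IsRem c [l] F := by
  have j1 : ∀ a, Wt 1 2 0 (fun u p => J [a] u p) := fun a => .jet 0 [a] (by simp) (by simp)
  have j2 : ∀ a b, Wt 1 2 1 (fun u p => J [a, b] u p) := fun a b =>
    .jet 1 [a, b] (by simp) (by simp)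
  have T : ∀ (r : ℝ) (a b b' d d' : Bool), Wt 1 2 2
      (fun u p => r * (J [a] u p * (J [b, b'] u p * J [d, d'] u p))) := fun r a b b' d d' =>
    .mul (.const 0 r) (.mul (k := 2) (j1 a) (.mul (k := 2) (j2 b b') (j2 d d') le_rfl) le_rfl)
      le_rfl
  have S : ∀ (r : ℝ) (a a' b b' : Bool), Wt 1 2 2
      (fun u p => r * ((J [a] u p * J [a'] u p) * J [b, b'] u p)) := fun r a a' b b' =>
    .mul (.const 0 r) (.mul (k := 2) (.mul (k := 0) (j1 a) (j1 a') le_rfl) (j2 b b') (by simp))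
      le_rfl
  have U : Wt 1 2 2 (fun u p => -c * J [l, true] u p) :=
    .mul (.const 0 _) (j2 l true) (by simp)
  refine ⟨_, .add (.add (.add (T (-2) true l true false false)
    (T 2 false l true false true)) (.add (T 2 true l false false true)
    (T (-2) false l false true true))) (.add U (.add (.add (S (-c) false false l true)
    (S (-3 * c) true true l true)) (S (-2 * c) true false l false))), fun u p h => ?_⟩
  have h1 := h.self_of_nhds.pd_eq (dir l)
  simp only [Lu, J, pdx_eq, pdt_eq, dir, cond_true, cond_false] at h1 ⊢
  linear_combination h1

lemma exists_isRem (c : ℝ) (w : List Bool) (hw : 1 ≤ w.length) (i : ℕ) (hi : 2 ≤ w.length + i) :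
    ∃ F, Wt w.length (w.length + 1) (i + 1) F ∧ IsRem c w F := by
  induction w generalizing i with
  | nil => simp at hw
  | cons l w ih =>
    rcases w with - | ⟨l', w⟩
    · obtain ⟨F, hF, h⟩ := exists_isRem_singleton c l
      exact ⟨F, hF.mono_weight (by simp at hi; omega), h⟩
    · obtain ⟨F, hF, h⟩ := ih (by simp) 1 (by simp)
      obtain ⟨F', hF', h'⟩ := exists_isRem_cons (i := 0) (j := 1) h hF.weight_zero l (by simp)
        (by simp) (by simp) (by simp) (by simp) (by simp)
      exact ⟨F', hF'.mono_weight (by omega), h'⟩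

lemma exists_isRem_cons_of_length (c : ℝ) (w : List Bool) (l : Bool) (hw : 1 ≤ w.length) (i : ℕ)
    (hi : 2 ≤ w.length + i) :
    ∃ F, Wt w.length (w.length + 2) (i + 2) F ∧ IsRem c (l :: w) F := by
  obtain ⟨F, hF, h⟩ := exists_isRem c w hw i hi
  exact exists_isRem_cons (i := i) (j := 2) h hF l hw le_rfl (by omega) hi le_rfl le_rfl

/-- The growth function controlling differential polynomials of weight at most three. -/
noncomputable def gro (k : ℕ) (s r : ℝ) : ℝ :=
  (1 + s) ^ k + (if 2 ≤ k then (1 + s) ^ (k - 2) * r else 0)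

variable {s r : ℝ}

lemma one_le_gro (hs : 0 ≤ s) (hr : 0 ≤ r) (k : ℕ) : 1 ≤ gro k s r := by
  have h1 : 1 ≤ (1 + s) ^ k := one_le_pow₀ (by linarith)
  unfold gro
  split_ifs
  · have : 0 ≤ (1 + s) ^ (k - 2) * r := by positivity
    linarith
  · linarith

lemma le_gro_one (hs : 0 ≤ s) (hr : 0 ≤ r) {k : ℕ} (hk : 1 ≤ k) : s ≤ gro k s r := by
  have h1 : 1 + s ≤ (1 + s) ^ k := le_self_pow₀ (by linarith) (by omega)
  unfold gro
  split_ifs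
  · have : 0 ≤ (1 + s) ^ (k - 2) * r := by positivity
    linarith
  · linarith

lemma le_gro_two (hs : 0 ≤ s) (hr : 0 ≤ r) {k : ℕ} (hk : 2 ≤ k) : r ≤ gro k s r := by
  have h1 : 1 ≤ (1 + s) ^ (k - 2) := one_le_pow₀ (by linarith)
  have h2 : 0 ≤ (1 + s) ^ k := by positivity
  unfold gro
  rw [if_pos hk]
  have : 1 * r ≤ (1 + s) ^ (k - 2) * r := by gcongr
  linarith

lemma gro_mul_le (hs : 0 ≤ s) (hr : 0 ≤ r) {i j k : ℕ} (h : i + j ≤ k) (hk : k ≤ 3) :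
    gro i s r * gro j s r ≤ gro k s r := by
  have : 0 ≤ s * r := by positivity
  have : 0 ≤ s ^ 2 := by positivity
  have : 0 ≤ s ^ 3 := by positivity
  have hi : i ≤ 3 := by omega
  have hj : j ≤ 3 := by omega
  interval_cases k <;> interval_cases i <;> interval_cases j <;>
    first | omega | (simp [gro] <;> nlinarith)

lemma Wt.bound (hF : Wt m N k F) (hk : k ≤ 3) (hN : N ≤ m + 2) (M : ℝ) :
    ∃ C ≥ 0, ∀ u p s r, 0 ≤ s → 0 ≤ r → (∀ w : List Bool, w.length ≤ m → |J w u p| ≤ M) →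
      (∀ w : List Bool, w.length = m + 1 → w.length ≤ N → |J w u p| ≤ s) →
      (∀ w : List Bool, w.length = m + 2 → w.length ≤ N → |J w u p| ≤ r) →
      |F u p| ≤ C * gro k s r := by
  induction hF with
  | const k a =>
    refine ⟨|a|, abs_nonneg a, fun u p s r hs hr _ _ _ => ?_⟩
    exact le_mul_of_one_le_right (abs_nonneg a) (one_le_gro hs hr k)
  | jet k w hN' hkw =>
    refine ⟨|M| + 1, by positivity, fun u p s r hs hr h0 h1 h2 => ?_⟩
    have hg := one_le_gro hs hr k
    have hMg : 0 ≤ |M| * gro k s r := by positivity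
    rcases le_or_gt w.length m with h | h
    · have := h0 w h
      have h3 : |M| * 1 ≤ |M| * gro k s r := by gcongr
      linarith [le_abs_self M]
    · rcases eq_or_ne w.length (m + 1) with h' | h'
      · linarith [h1 w h' hN', le_gro_one hs hr (show 1 ≤ k by omega)]
      · linarith [h2 w (by omega) hN', le_gro_two hs hr (show 2 ≤ k by omega)]
  | add _ _ h1 h2 =>
    obtain ⟨C, hC, e1⟩ := h1 hk
    obtain ⟨D, hD, e2⟩ := h2 hk
    refine ⟨C + D, by positivity, fun u p s r hs hr a b d => ?_⟩
    refine (abs_add_le _ _).trans ?_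
    linarith [e1 u p s r hs hr a b d, e2 u p s r hs hr a b d]
  | @mul k i j F G _ _ h h1 h2 =>
    obtain ⟨C, hC, e1⟩ := h1 (by omega)
    obtain ⟨D, hD, e2⟩ := h2 (by omega)
    refine ⟨C * D, by positivity, fun u p s r hs hr a b d => ?_⟩
    rw [abs_mul]
    calc _ ≤ _ := mul_le_mul (e1 u p s r hs hr a b d) (e2 u p s r hs hr a b d) (abs_nonneg _)
          (mul_nonneg hC (zero_le_one.trans (one_le_gro hs hr i)))
      _ = C * D * (gro i s r * gro j s r) := by ring
      _ ≤ _ := by gcongr; exact gro_mul_le hs hr h hk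

end Jets

/-! ### Interior estimates for derivatives of all orders -/

section Bootstrap

variable {u : ℝ × ℝ → ℝ} {p : ℝ × ℝ} {c : ℝ} {m : ℕ}

/-- The affinely rescaled family of all jets of order `m`. -/
noncomputable def jetFam (m : ℕ) (u : ℝ × ℝ → ℝ) (μ : ℝ) (κ : List Bool → ℝ)
    (w : List.Vector Bool m) : ℝ × ℝ → ℝ := fun p => μ * J w.1 u p + κ w.1

variable {μ : ℝ} {κ : List Bool → ℝ}

lemma sm_jetFam (h : Sm u p) (w : List.Vector Bool m) : Sm (jetFam m u μ κ w) p :=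
  ContDiffAt.add (ContDiffAt.mul contDiffAt_const (h.J w.1)) contDiffAt_const

lemma dz_jetFam (h : Sm u p) (j : List.Vector Bool m × Bool) :
    dz (jetFam m u μ κ) j p = μ * J (j.2 :: j.1.1) u p := by
  have h1 : DifferentiableAt ℝ (J j.1.1 u) p := Sm.diff (h.J _)
  unfold dz jetFam
  rw [pd_add (h1.const_mul μ) (differentiableAt_const _), pd_const, pd_const_mul μ h1]
  simp [J]

lemma Lu_jetFam (h : Sm u p) (w : List.Vector Bool m) :
    Lu u (jetFam m u μ κ w) p = μ * Lu u (J w.1 u) p := by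
  have h1 : Sm (fun p => μ * J w.1 u p) p := ContDiffAt.mul contDiffAt_const (h.J w.1)
  unfold Lu jetFam
  rw [LL_add h1 contDiffAt_const, LL_const, LL_const_mul μ (h.J _), add_zero]

lemma abs_jet_le_of_gs (hμ : 0 < μ) (h : Sm u p) {w : List Bool} (hw : w.length = m + 1) :
    |J w u p| ≤ √(gs (jetFam m u μ κ) p) / μ := by
  rcases w with - | ⟨k, w⟩
  · simp at hw
  have hg := gs_nonneg (z := jetFam m u μ κ) (p := p)
  have := abs_le_of_ss (z := dz (jetFam m u μ κ)) (p := p) (sqrt_nonneg _)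
    (by rw [sq_sqrt hg, ← gs_eq]) (⟨w, by simpa using hw⟩, k)
  rw [dz_jetFam h, abs_mul, abs_of_pos hμ] at this
  rw [le_div_iff₀ hμ]
  linarith

lemma dz_jetFam_ev (h : ∀ᶠ y in 𝓝 p, Sm u y) (j : List.Vector Bool m × Bool) :
    dz (jetFam m u μ κ) j =ᶠ[𝓝 p] fun q => μ * J (j.2 :: j.1.1) u q := by
  filter_upwards [h] with q hq using dz_jetFam hq j

lemma abs_jet_le_of_gs_dz (hμ : 0 < μ) (h : ∀ᶠ y in 𝓝 p, Sm u y) {w : List Bool}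
    (hw : w.length = m + 2) : |J w u p| ≤ √(gs (dz (jetFam m u μ κ)) p) / μ := by
  rcases w with - | ⟨l, - | ⟨k, w⟩⟩
  · simp at hw
  · simp at hw
  have hg := gs_nonneg (z := dz (jetFam m u μ κ)) (p := p)
  have := abs_le_of_ss (z := dz (dz (jetFam m u μ κ))) (p := p) (sqrt_nonneg _)
    (by rw [sq_sqrt hg, ← gs_eq]) ((⟨w, by simpa using hw⟩, k), l)
  have e : dz (dz (jetFam m u μ κ)) ((⟨w, by simpa using hw⟩, k), l) p
      = μ * J (l :: k :: w) u p :=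
    (pd_congr (dz_jetFam_ev h (⟨w, by simpa using hw⟩, k))).trans
      (pd_const_mul μ (Sm.diff (h.self_of_nhds.J _)))
  rw [e, abs_mul, abs_of_pos hμ] at this
  rw [le_div_iff₀ hμ]
  linarith

lemma Lu_dz_jetFam (h : ∀ᶠ y in 𝓝 p, Sm u y) (j : List.Vector Bool m × Bool) :
    Lu u (dz (jetFam m u μ κ) j) p = μ * Lu u (J (j.2 :: j.1.1) u) p := by
  have h1 := dz_jetFam_ev (μ := μ) (κ := κ) h j
  unfold Lu
  rw [← LL_const_mul μ (h.self_of_nhds.J _)]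
  simp only [LL, pdx_eq, pdt_eq, pd_congr (pd_congr_ev h1)]

lemma exists_uniform {ι : Type*} [Finite ι] {P : ι → ℝ → Prop} (h : ∀ i, ∃ C ≥ 0, P i C)
    (hP : ∀ i C D, C ≤ D → P i C → P i D) : ∃ C ≥ 0, ∀ i, P i C := by
  have := Fintype.ofFinite ι
  choose C hC h using h
  exact ⟨∑ i, C i, Finset.sum_nonneg fun i _ => hC i, fun i => hP i _ _
    (Finset.single_le_sum (f := C) (fun j _ => hC j) (Finset.mem_univ i)) (h i)⟩

lemma exists_jetFam_bounds (c : ℝ) (hm : 1 ≤ m) {i : ℕ} (hi : 2 ≤ m + i) (hi1 : i ≤ 1) (M : ℝ) :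
    ∃ C ≥ 0, ∀ u p μ κ, 0 < μ → (∀ᶠ y in 𝓝 p, Sol c u y) →
      (∀ w : List Bool, w.length ≤ m → |J w u p| ≤ M) →
      (∀ w, |Lu u (jetFam m u μ κ w) p|
        ≤ μ * (C * gro (i + 1) (√(gs (jetFam m u μ κ) p) / μ) 0)) ∧
      ∀ j, |Lu u (dz (jetFam m u μ κ) j) p|
        ≤ μ * (C * gro (i + 2) (√(gs (jetFam m u μ κ) p) / μ)
          (√(gs (dz (jetFam m u μ κ)) p) / μ)) := by
  have h1 : ∀ w : List.Vector Bool m, ∃ C ≥ 0, ∀ u p s, 0 ≤ s → (∀ᶠ y in 𝓝 p, Sol c u y) →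
      (∀ w : List Bool, w.length ≤ m → |J w u p| ≤ M) →
      (∀ w : List Bool, w.length = m + 1 → |J w u p| ≤ s) →
      |Lu u (J w.1 u) p| ≤ C * gro (i + 1) s 0 := by
    rintro ⟨w, rfl⟩
    obtain ⟨F, hF, hR⟩ := exists_isRem c w hm i hi
    obtain ⟨C, hC, h⟩ := hF.bound (by omega) (by omega) M
    refine ⟨C, hC, fun u p s hs hsol h0 h1 => ?_⟩
    rw [hR u p hsol]
    exact h u p s 0 hs le_rfl h0 (fun w hw _ => h1 w hw) (fun w hw hw' => by omega)
  have h2 : ∀ j : List.Vector Bool m × Bool, ∃ C ≥ 0, ∀ u p s r, 0 ≤ s → 0 ≤ r →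
      (∀ᶠ y in 𝓝 p, Sol c u y) →
      (∀ w : List Bool, w.length ≤ m → |J w u p| ≤ M) →
      (∀ w : List Bool, w.length = m + 1 → |J w u p| ≤ s) →
      (∀ w : List Bool, w.length = m + 2 → |J w u p| ≤ r) →
      |Lu u (J (j.2 :: j.1.1) u) p| ≤ C * gro (i + 2) s r := by
    rintro ⟨⟨w, rfl⟩, l⟩
    obtain ⟨F, hF, hR⟩ := exists_isRem_cons_of_length c w l hm i hi
    obtain ⟨C, hC, h⟩ := hF.bound (by omega) (by omega) M
    refine ⟨C, hC, fun u p s r hs hr hsol h0 h1 h2 => ?_⟩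
    rw [hR u p hsol]
    exact h u p s r hs hr h0 (fun w hw _ => h1 w hw) (fun w hw _ => h2 w hw)
  obtain ⟨C, hC, h1⟩ := exists_uniform h1 fun w C D hCD h u p s hs a b d =>
    (h u p s hs a b d).trans (by
      have := one_le_gro hs le_rfl (i + 1)
      gcongr)
  obtain ⟨D, hD, h2⟩ := exists_uniform h2 fun w C D hCD h u p s r hs hr a b d e =>
    (h u p s r hs hr a b d e).trans (by
      have := one_le_gro hs hr (i + 2)
      gcongr)
  refine ⟨C + D, by positivity, fun u p μ κ hμ hsol h0 => ?_⟩
  have hsm : ∀ᶠ y in 𝓝 p, Sm u y := hsol.mono fun y hy => hy.1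
  have hs : 0 ≤ √(gs (jetFam m u μ κ) p) / μ := by positivity
  have hr : 0 ≤ √(gs (dz (jetFam m u μ κ)) p) / μ := by positivity
  refine ⟨fun w => ?_, fun j => ?_⟩
  · rw [Lu_jetFam hsm.self_of_nhds, abs_mul, abs_of_pos hμ]
    have := one_le_gro hs le_rfl (i + 1)
    have h3 := h1 w u p _ hs hsol h0 fun w hw => abs_jet_le_of_gs hμ hsm.self_of_nhds hw
    gcongr
    refine h3.trans ?_
    gcongr
    linarith
  · rw [Lu_dz_jetFam hsm, abs_mul, abs_of_pos hμ]
    have := one_le_gro hs hr (i + 2)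
    have h3 := h2 j u p _ _ hs hr hsol h0
      (fun w hw => abs_jet_le_of_gs hμ hsm.self_of_nhds hw)
      fun w hw => abs_jet_le_of_gs_dz hμ hsm hw
    gcongr
    refine h3.trans ?_
    gcongr
    linarith

lemma ss_le_sq {ι : Type*} [Fintype ι] {z : ι → ℝ × ℝ → ℝ} {ε : ℝ} (hε : 0 < ε)
    (h : ∀ i, |z i p| ≤ ε / (Fintype.card ι + 1)) : ss z p ≤ ε ^ 2 := by
  set N : ℝ := (Fintype.card ι : ℝ) with hN
  have hN0 : 0 ≤ N := by positivity
  have h1 : ss z p ≤ ∑ _i : ι, (ε / (N + 1)) ^ 2 := by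
    refine Finset.sum_le_sum fun i _ => ?_
    rw [← sq, ← sq_abs]
    gcongr
    exact h i
  rw [Finset.sum_const, Finset.card_univ, nsmul_eq_mul, ← hN] at h1
  refine h1.trans ?_
  rw [div_pow, ← mul_div_assoc, div_le_iff₀ (by positivity)]
  have : 0 ≤ ε ^ 2 * (N ^ 2 + N + 1) := by positivity
  linarith

lemma ell_of_jets {M : ℝ} (h : ∀ w : List Bool, w.length ≤ 1 → |J w u p| ≤ M) :
    Ell (1 + 2 * M ^ 2) (1 + pdt u p ^ 2) (-(pdx u p * pdt u p)) (1 + pdx u p ^ 2) ∧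
      area u p ≤ 1 + 2 * M ^ 2 := by
  have h1 : |pdx u p| ≤ M := h [false] le_rfl
  have h2 : |pdt u p| ≤ M := h [true] le_rfl
  have h3 : pdx u p ^ 2 ≤ M ^ 2 := by rw [← sq_abs]; gcongr
  have h4 : pdt u p ^ 2 ≤ M ^ 2 := by rw [← sq_abs]; gcongr
  refine ⟨⟨fun x y => ?_, ?_, ?_, ?_⟩, by unfold area; linarith⟩
  · linarith [sq_nonneg (pdt u p * x - pdx u p * y)]
  · rw [abs_of_pos (by positivity)]; linarith [sq_nonneg M]
  · rw [abs_neg, abs_mul]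
    have : |pdx u p| * |pdt u p| ≤ M * M := by gcongr; exact (abs_nonneg _).trans h1
    linarith [sq_nonneg M]
  · rw [abs_of_pos (by positivity)]; linarith [sq_nonneg M]

lemma gro_growth_one {g h : ℝ} (hg : 0 ≤ g) (hh : 0 ≤ h) :
    gro 2 g 0 ≤ 4 * (1 + g ^ 2) ∧ gro 3 g h ≤ 4 * (1 + g ^ 3 + (1 + g) * h) := by
  have h1 : 0 ≤ (g - 1) ^ 2 * (g + 1) := by positivity
  have h2 : 0 ≤ g * h := by positivity
  constructor
  · simp [gro]; linarith [sq_nonneg (g - 1)]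
  · simp [gro]; linarith

lemma gro_growth {C μ : ℝ} (hC : 0 ≤ C) (hμ : 0 < μ) : ∃ C2 ≥ 0, ∀ g h : ℝ, 0 ≤ g → 0 ≤ h →
    μ * (C * gro 1 (g / μ) 0) ≤ C2 + g ^ 2 ∧
    μ * (C * gro 2 (g / μ) (h / μ)) ≤ C2 + g ^ 3 + (C2 + g) * h := by
  have hK : 0 ≤ 2 * C / μ := by positivity
  refine ⟨μ * C + C ^ 2 + C + 2 * C * μ + (2 * C / μ) ^ 3, by positivity, fun g h hg hh => ?_⟩
  have e1 : μ * (C * gro 1 (g / μ) 0) = μ * C + C * g := by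
    simp [gro]; field_simp
  have e2 : μ * (C * gro 2 (g / μ) (h / μ)) = C * μ + 2 * C * g + (C / μ) * g ^ 2 + C * h := by
    simp [gro]; field_simp; ring
  have k3 : (2 * C / μ) * g ^ 2 ≤ (2 * C / μ) ^ 3 + g ^ 3 := by
    rcases le_total g (2 * C / μ) with hgK | hgK
    · have : (2 * C / μ) * g ^ 2 ≤ (2 * C / μ) * (2 * C / μ) ^ 2 := by gcongr
      have : 0 ≤ g ^ 3 := by positivity
      linarith
    · have : (2 * C / μ) * g ^ 2 ≤ g * g ^ 2 := by gcongr
      have : 0 ≤ (2 * C / μ) ^ 3 := by positivity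
      linarith
  have k4 : 2 * C * g ≤ C * μ + (C / μ) * g ^ 2 := by
    have : 0 ≤ C / μ * (g - μ) ^ 2 := by positivity
    have e : C / μ * (g - μ) ^ 2 = C / μ * g ^ 2 - 2 * C * g + C * μ := by field_simp; ring
    linarith
  have k5 : 2 * C / μ * g ^ 2 = 2 * (C / μ * g ^ 2) := by ring
  have p1 : 0 ≤ C * μ := by positivity
  have p2 : 0 ≤ C ^ 2 := by positivity
  have p3 : 0 ≤ (2 * C / μ) ^ 3 := by positivity
  have p4 : 0 ≤ (μ * C + C ^ 2 + 2 * C * μ + (2 * C / μ) ^ 3 + g) * h := by positivity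
  rw [e1, e2]
  constructor
  · linarith [sq_nonneg (g - C), sq_nonneg g]
  · linarith

lemma jet_le_of_bernstein {B R : ℝ} {z₀ : ℝ × ℝ} (hμ : 0 < μ) (h : Sm u p)
    (hB : ∀ p, sqd z₀ p ≤ R ^ 2 / 4 → gs (jetFam m u μ κ) p ≤ B) (hp : sqd z₀ p ≤ (R / 2) ^ 2)
    {w : List Bool} (hw : w.length = m + 1) : |J w u p| ≤ √B / μ := by
  refine (abs_jet_le_of_gs (κ := κ) hμ h hw).trans ?_
  gcongr
  exact hB p (hp.trans (by rw [div_pow]; norm_num))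

lemma mem_Sq_of_sqd_le {z₀ : ℝ × ℝ} {R : ℝ} (hR : 0 ≤ R) (h : sqd z₀ p ≤ R ^ 2) : p ∈ Sq z₀ R := by
  unfold sqd at h
  rw [mem_Sq]
  exact ⟨abs_le_of_sq_le_sq (by linarith [sq_nonneg (p.2 - z₀.2)]) hR,
    abs_le_of_sq_le_sq (by linarith [sq_nonneg (p.1 - z₀.1)]) hR⟩

lemma sqd_le_of_mem_Sq {z₀ : ℝ × ℝ} {R : ℝ} (h : p ∈ Sq z₀ R) : sqd z₀ p ≤ 2 * R ^ 2 := by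
  rw [mem_Sq] at h
  have h1 : (p.1 - z₀.1) ^ 2 ≤ R ^ 2 := by rw [← sq_abs]; gcongr; exact h.1
  have h2 : (p.2 - z₀.2) ^ 2 ≤ R ^ 2 := by rw [← sq_abs]; gcongr; exact h.2
  unfold sqd; linarith

lemma exists_second_bound (c M : ℝ) {ρ : ℝ} (hρ : 0 < ρ) :
    ∃ r > 0, ∃ B, ∀ u z₀, (∀ p, sqd z₀ p ≤ ρ ^ 2 → (∀ᶠ y in 𝓝 p, Sol c u y) ∧
      ∀ w : List Bool, w.length ≤ 1 → |J w u p| ≤ M) →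
      ∀ p, sqd z₀ p ≤ r ^ 2 → ∀ w : List Bool, w.length = 2 → |J w u p| ≤ B := by
  obtain ⟨C, hC, hb⟩ := exists_jetFam_bounds (m := 1) c le_rfl (i := 1) le_rfl le_rfl M
  have hΛ : 1 ≤ 1 + 2 * M ^ 2 := by linarith [sq_nonneg M]
  obtain ⟨ε, hε, hbern⟩ := bernstein (List.Vector Bool 1) hΛ (C := 4 * C) (by positivity)
  set N : ℝ := (Fintype.card (List.Vector Bool 1) : ℝ)
  have hN : 0 ≤ N := by positivity
  obtain ⟨r, hr, hosc⟩ := osc_small c (1 + 2 * M ^ 2) (ρ := ρ / 2) (ε := ε / (N + 1))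
    (by positivity) (by positivity)
  set R := min ρ r
  have hR : 0 < R := lt_min hρ hr
  obtain ⟨B, hB⟩ := hbern ε hε le_rfl 1 zero_le_one R hR
  refine ⟨R / 2, by positivity, √B / 1, fun u z₀ hu p hp w hw => ?_⟩
  have hRρ : R ^ 2 ≤ ρ ^ 2 := by gcongr; exact min_le_left _ _
  refine jet_le_of_bernstein (κ := fun w => -J w u z₀) one_pos ?_
    (hB (fun q => 1 + pdt u q ^ 2) (fun q => -(pdx u q * pdt u q)) (fun q => 1 + pdx u q ^ 2)
      _ z₀ ?_) hp hw
  · refine (hu p (hp.trans (le_trans ?_ hRρ))).1.self_of_nhds.1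
    gcongr; linarith
  · intro q hq
    obtain ⟨hs, hj⟩ := hu q (hq.trans hRρ)
    obtain ⟨b1, b2⟩ := hb u q 1 (fun w => -J w u z₀) one_pos hs hj
    have hg := gs_nonneg (z := jetFam 1 u 1 (fun w => -J w u z₀)) (p := q)
    obtain ⟨g1, -⟩ := gro_growth_one (sqrt_nonneg (gs (jetFam 1 u 1 (fun w => -J w u z₀)) q)) le_rfl
    obtain ⟨-, g2⟩ := gro_growth_one (sqrt_nonneg (gs (jetFam 1 u 1 (fun w => -J w u z₀)) q))
      (sqrt_nonneg (gs (dz (jetFam 1 u 1 (fun w => -J w u z₀))) q))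
    rw [sq_sqrt hg] at g1
    refine ⟨(ell_of_jets hj).1, sm_jetFam hs.self_of_nhds.1, ss_le_sq hε ?_, fun i => ?_, fun j => ?_⟩
    · rintro ⟨w, hw⟩
      obtain ⟨k, rfl⟩ := List.length_eq_one_iff.1 hw
      have := hosc u z₀ (fun y hy => ?_) q (Sq_mono (min_le_right _ _)
        (mem_Sq_of_sqd_le hR.le hq)) (dir k) (by cases k <;> simp [dir])
      · simp only [jetFam, J, one_mul, ← sub_eq_add_neg]; exact this
      · have hy := hu y ((sqd_le_of_mem_Sq hy).trans (by
          rw [div_pow]; linarith [sq_nonneg ρ]))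
        exact ⟨hy.1.self_of_nhds, (ell_of_jets hy.2).2⟩
    · refine (b1 i).trans ?_
      rw [one_mul, div_one, mul_right_comm]
      have := mul_le_mul_of_nonneg_left g1 hC
      linarith
    · refine (b2 j).trans ?_
      rw [one_mul, div_one, div_one]
      have := mul_le_mul_of_nonneg_left g2 hC
      linarith

lemma exists_higher_bound (c M : ℝ) (hm : 2 ≤ m) {ρ : ℝ} (hρ : 0 < ρ) :
    ∃ r > 0, ∃ B, ∀ u z₀, (∀ p, sqd z₀ p ≤ ρ ^ 2 → (∀ᶠ y in 𝓝 p, Sol c u y) ∧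
      ∀ w : List Bool, w.length ≤ m → |J w u p| ≤ M) →
      ∀ p, sqd z₀ p ≤ r ^ 2 → ∀ w : List Bool, w.length = m + 1 → |J w u p| ≤ B := by
  obtain ⟨C, hC, hb⟩ := exists_jetFam_bounds (m := m) c (by omega) (i := 0) hm zero_le_one M
  have hΛ : 1 ≤ 1 + 2 * M ^ 2 := by linarith [sq_nonneg M]
  obtain ⟨ε, hε, hbern⟩ := bernstein (List.Vector Bool m) hΛ (C := 1) zero_le_one
  set N : ℝ := (Fintype.card (List.Vector Bool m) : ℝ)
  have hN : 0 ≤ N := by positivity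
  obtain ⟨μ, hμ⟩ : ∃ μ, μ = ε / (N + 1) / (|M| + 1) := ⟨_, rfl⟩
  have hμ0 : 0 < μ := by rw [hμ]; positivity
  obtain ⟨C2, hC2, hgr⟩ := gro_growth hC hμ0
  obtain ⟨B, hB⟩ := hbern ε hε le_rfl C2 hC2 ρ hρ
  refine ⟨ρ / 2, by positivity, √B / μ, fun u z₀ hu p hp w hw => ?_⟩
  refine jet_le_of_bernstein (κ := fun w => 0) hμ0 ?_
    (hB (fun q => 1 + pdt u q ^ 2) (fun q => -(pdx u q * pdt u q)) (fun q => 1 + pdx u q ^ 2)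
      _ z₀ ?_) hp hw
  · refine (hu p (hp.trans ?_)).1.self_of_nhds.1
    gcongr; linarith
  · intro q hq
    obtain ⟨hs, hj⟩ := hu q hq
    obtain ⟨b1, b2⟩ := hb u q μ (fun w => 0) hμ0 hs hj
    have hg := gs_nonneg (z := jetFam m u μ (fun w => 0)) (p := q)
    obtain ⟨g1, g2⟩ := hgr _ _ (sqrt_nonneg (gs (jetFam m u μ (fun w => 0)) q))
      (sqrt_nonneg (gs (dz (jetFam m u μ (fun w => 0))) q))
    rw [sq_sqrt hg] at g1
    refine ⟨(ell_of_jets fun w hw => hj w (by omega)).1, sm_jetFam hs.self_of_nhds.1,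
      ss_le_sq hε ?_, fun i => ?_, fun j => ?_⟩
    · rintro ⟨w, hw⟩
      have := hj w hw.le
      simp only [jetFam, add_zero, abs_mul, abs_of_pos hμ0]
      calc μ * |J w u q| ≤ μ * (|M| + 1) := by gcongr; linarith [le_abs_self M]
        _ = _ := by rw [hμ]; field_simp; rfl
    · refine (b1 i).trans ?_
      rw [one_mul]; exact g1
    · refine (b2 j).trans ?_
      rw [one_mul]; exact g2

end Bootstrap

/-! ### Local bounds for all jets and compactness -/

section Compactness

variable {c : ℝ} {Ω : Set (ℝ × ℝ)} {u : ℕ → ℝ × ℝ → ℝ} {p : ℝ × ℝ}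

lemma sm_of_translator {v : ℝ × ℝ → ℝ} (hΩ : IsOpen Ω) (h : IsSmoothTranslator c Ω v)
    (hp : p ∈ Ω) : Sm v p := h.1.contDiffAt (hΩ.mem_nhds hp)

lemma sol_of_translator {v : ℝ × ℝ → ℝ} (hΩ : IsOpen Ω) (h : IsSmoothTranslator c Ω v)
    (hp : p ∈ Ω) : Sol c v p := by
  refine ⟨sm_of_translator hΩ h hp, ?_⟩
  filter_upwards [hΩ.mem_nhds hp] with y hy
  rw [← h.2 y hy]
  unfold LL; ring

lemma disc_mem_nhds (z : ℝ × ℝ) {r : ℝ} (hr : 0 < r) : ∀ᶠ p in 𝓝 z, sqd z p ≤ r ^ 2 := by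
  have h := (continuous_sqd z).tendsto z
  rw [sqd_self] at h
  exact h.eventually (ge_mem_nhds (by positivity))

lemma exists_disc_of_eventually {z : ℝ × ℝ} {P : ℝ × ℝ → Prop} (h : ∀ᶠ p in 𝓝 z, P p) :
    ∃ ρ > 0, ∀ p, sqd z p ≤ ρ ^ 2 → P p := by
  obtain ⟨ρ, hρ, h⟩ := Metric.nhds_basis_closedBall.eventually_iff.1 h
  refine ⟨ρ, hρ, fun p hp => h ?_⟩
  have := mem_Sq.1 (mem_Sq_of_sqd_le hρ.le hp)
  rw [Metric.mem_closedBall, Prod.dist_eq, max_le_iff, Real.dist_eq, Real.dist_eq]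
  exact this

lemma exists_local_jet_bound (hΩ : IsOpen Ω) (hu : ∀ n, IsSmoothTranslator c Ω (u n))
    (hloc : ∀ p ∈ Ω, ∃ M, ∀ᶠ q in 𝓝 p, ∀ n, |u n q| ≤ M) (m : ℕ) : ∀ p ∈ Ω, ∃ M,
    ∀ᶠ q in 𝓝 p, ∀ n, ∀ w : List Bool, w.length ≤ m → |J w (u n) q| ≤ M := by
  have extend : ∀ m, (∀ p ∈ Ω, ∃ M, ∀ᶠ q in 𝓝 p, ∀ n, ∀ w : List Bool, w.length ≤ m →
      |J w (u n) q| ≤ M) → (∀ p ∈ Ω, ∃ M, ∀ᶠ q in 𝓝 p, ∀ n, ∀ w : List Bool,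
      w.length = m + 1 → |J w (u n) q| ≤ M) → ∀ p ∈ Ω, ∃ M, ∀ᶠ q in 𝓝 p, ∀ n,
      ∀ w : List Bool, w.length ≤ m + 1 → |J w (u n) q| ≤ M := by
    intro m h1 h2 p hp
    obtain ⟨A, hA⟩ := h1 p hp
    obtain ⟨B, hB⟩ := h2 p hp
    refine ⟨max A B, ?_⟩
    filter_upwards [hA, hB] with q hA hB n w hw
    rcases Nat.le_or_eq_of_le_succ hw with h | h
    · exact (hA n w h).trans (le_max_left _ _)
    · exact (hB n w h).trans (le_max_right _ _)
  have hsol : ∀ p ∈ Ω, ∀ᶠ q in 𝓝 p, ∀ n, ∀ᶠ y in 𝓝 q, Sol c (u n) y := by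
    intro p hp
    filter_upwards [hΩ.mem_nhds hp] with q hq n
    filter_upwards [hΩ.mem_nhds hq] with y hy using sol_of_translator hΩ (hu n) hy
  induction m with
  | zero =>
    intro p hp
    obtain ⟨M, hM⟩ := hloc p hp
    refine ⟨M, ?_⟩
    filter_upwards [hM] with q hq n w hw
    rw [List.length_eq_zero_iff.1 (Nat.le_zero.1 hw)]
    exact hq n
  | succ m ih =>
    refine extend m ih fun p hp => ?_
    obtain ⟨M, hM⟩ := ih p hp
    obtain ⟨ρ, hρ, hd⟩ := exists_disc_of_eventually ((hsol p hp).and hM)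
    obtain ⟨r, hr, B, hB⟩ : ∃ r > 0, ∃ B, ∀ n, ∀ q, sqd p q ≤ r ^ 2 → ∀ w : List Bool,
        w.length = m + 1 → |J w (u n) q| ≤ B := by
      rcases m with - | - | m
      · obtain ⟨G, hG⟩ := gradient_estimate c (M := |M| + 1) (by positivity) hρ
        refine ⟨ρ / 2, by positivity, √G, fun n q hq w hw => ?_⟩
        have := hG (u n) p (fun y hy => ⟨((hd y hy).1 n).self_of_nhds,
          ((hd y hy).2 n [] le_rfl).trans (by linarith [le_abs_self M])⟩) q
          (hq.trans (by rw [div_pow]; norm_num))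
        refine abs_le_sqrt (le_trans ?_ this)
        unfold area
        obtain ⟨k, rfl⟩ := List.length_eq_one_iff.1 hw
        cases k
        · change pdx (u n) q ^ 2 ≤ _
          linarith [sq_nonneg (pdt (u n) q)]
        · change pdt (u n) q ^ 2 ≤ _
          linarith [sq_nonneg (pdx (u n) q)]
      · obtain ⟨r, hr, B, hB⟩ := exists_second_bound c M hρ
        exact ⟨r, hr, B, fun n => hB (u n) p fun y hy => ⟨(hd y hy).1 n, (hd y hy).2 n⟩⟩
      · obtain ⟨r, hr, B, hB⟩ := exists_higher_bound (m := m + 2) c M (by omega) hρ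
        exact ⟨r, hr, B, fun n => hB (u n) p fun y hy => ⟨(hd y hy).1 n, (hd y hy).2 n⟩⟩
    refine ⟨B, ?_⟩
    filter_upwards [disc_mem_nhds p hr] with q hq n w hw using hB n q hq w hw

lemma fderiv_eq_pd {f : ℝ × ℝ → ℝ} : fderiv ℝ f p =
    pd (dir false) f p • ContinuousLinearMap.fst ℝ ℝ ℝ
      + pd (dir true) f p • ContinuousLinearMap.snd ℝ ℝ ℝ := by
  ext <;> simp [pd, dir]

lemma norm_fderiv_le {f : ℝ × ℝ → ℝ} {M : ℝ} (h : ∀ k, |pd (dir k) f p| ≤ M) :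
    ‖fderiv ℝ f p‖ ≤ 2 * M := by
  rw [fderiv_eq_pd]
  refine (norm_add_le _ _).trans ?_
  rw [norm_smul, norm_smul, Real.norm_eq_abs, Real.norm_eq_abs]
  have h1 : |pd (dir false) f p| * ‖ContinuousLinearMap.fst ℝ ℝ ℝ‖ ≤ M * 1 :=
    mul_le_mul (h false) (ContinuousLinearMap.norm_fst_le ℝ ℝ ℝ) (norm_nonneg _)
      ((abs_nonneg _).trans (h false))
  have h2 : |pd (dir true) f p| * ‖ContinuousLinearMap.snd ℝ ℝ ℝ‖ ≤ M * 1 :=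
    mul_le_mul (h true) (ContinuousLinearMap.norm_snd_le ℝ ℝ ℝ) (norm_nonneg _)
      ((abs_nonneg _).trans (h true))
  linarith

lemma exists_local_lipschitz (hΩ : IsOpen Ω) (hu : ∀ n, IsSmoothTranslator c Ω (u n))
    (hloc : ∀ p ∈ Ω, ∃ M, ∀ᶠ q in 𝓝 p, ∀ n, |u n q| ≤ M) (w : List Bool) (hp : p ∈ Ω) :
    ∃ L, ∀ᶠ q in 𝓝 p, ∀ n, |J w (u n) q - J w (u n) p| ≤ L * dist q p := by
  obtain ⟨M, hM⟩ := exists_local_jet_bound hΩ hu hloc (w.length + 1) p hp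
  obtain ⟨ρ, hρ, h⟩ := Metric.nhds_basis_ball.eventually_iff.1 (hM.and (hΩ.mem_nhds hp))
  refine ⟨2 * M, ?_⟩
  filter_upwards [Metric.ball_mem_nhds p hρ] with q hq n
  rw [dist_eq_norm, ← Real.norm_eq_abs]
  exact Convex.norm_image_sub_le_of_norm_fderiv_le (𝕜 := ℝ)
    (fun y hy => Sm.diff (Sm.J (sm_of_translator hΩ (hu n) (h hy).2) w))
    (fun y hy => norm_fderiv_le fun k => (h hy).1 n (k :: w) (by simp))
    (convex_ball p ρ) (Metric.mem_ball_self hρ) hq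

lemma exists_isCompact_of_lipschitz {X : Type*} [PseudoMetricSpace X] (f : ℕ → C(X, ℝ))
    (hb : ∀ x, ∃ M, ∀ n, |f n x| ≤ M)
    (hL : ∀ x, ∃ L, ∀ᶠ y in 𝓝 x, ∀ n, |f n y - f n x| ≤ L * dist y x) :
    ∃ S : Set C(X, ℝ), IsCompact S ∧ ∀ n, f n ∈ S := by
  choose M hM using hb
  choose L hL using hL
  choose U hU hUL using fun x => (hL x).exists_mem
  have cont : ∀ g : X → ℝ, (∀ x, ∀ y ∈ U x, |g y - g x| ≤ L x * dist y x) → Continuous g := by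
    intro g hg
    refine continuous_iff_continuousAt.2 fun x => ?_
    have ht : Tendsto (fun y => L x * dist y x) (𝓝 x) (𝓝 0) := by
      have : Continuous fun y => L x * dist y x := by fun_prop
      simpa using this.tendsto x
    refine tendsto_iff_dist_tendsto_zero.2 (squeeze_zero' (Eventually.of_forall fun _ =>
      dist_nonneg) ?_ ht)
    filter_upwards [hU x] with y hy using hg x y hy
  refine ⟨{g | (∀ x, |g x| ≤ M x) ∧ ∀ x, ∀ y ∈ U x, |g y - g x| ≤ L x * dist y x},
    ArzelaAscoli.isCompact_of_equicontinuous _ ?_ ?_, fun n => ⟨fun x => hM x n, fun x y hy =>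
      hUL x y hy n⟩⟩
  · have e : Set.image ContinuousMap.toFun {g : C(X, ℝ) | (∀ x, |g x| ≤ M x) ∧
        ∀ x, ∀ y ∈ U x, |g y - g x| ≤ L x * dist y x}
        = (univ.pi fun x => Icc (-M x) (M x)) ∩
          {g | ∀ x, ∀ y ∈ U x, |g y - g x| ≤ L x * dist y x} := by
      ext g
      constructor
      · rintro ⟨g, ⟨h1, h2⟩, rfl⟩
        exact ⟨fun x _ => abs_le.1 (h1 x), h2⟩
      · rintro ⟨h1, h2⟩
        exact ⟨⟨g, cont g h2⟩, ⟨fun x => abs_le.2 (h1 x trivial), h2⟩, rfl⟩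
    rw [e]
    refine (isCompact_univ_pi fun x => isCompact_Icc).inter_right ?_
    simp only [ofPred_forall]
    refine isClosed_iInter fun x => isClosed_iInter fun y => isClosed_iInter fun _ => ?_
    exact isClosed_le (by fun_prop) continuous_const
  · intro x
    refine Metric.equicontinuousAt_of_continuity_modulus (fun y => L x * dist y x) ?_ _ ?_
    · have : Continuous fun y => L x * dist y x := by fun_prop
      simpa using this.tendsto x
    · filter_upwards [hU x] with y hy g
      rw [dist_comm]
      exact g.2.2 x y hy

lemma exists_subseq_jets (hΩ : IsOpen Ω) (hu : ∀ n, IsSmoothTranslator c Ω (u n))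
    (hloc : ∀ p ∈ Ω, ∃ M, ∀ᶠ q in 𝓝 p, ∀ n, |u n q| ≤ M) :
    ∃ φ : ℕ → ℕ, StrictMono φ ∧ ∃ G : List Bool → ℝ × ℝ → ℝ, (∀ w, ContinuousOn (G w) Ω) ∧
      ∀ w, TendstoLocallyUniformlyOn (fun n => J w (u (φ n))) (G w) atTop Ω := by
  classical
  have : LocallyCompactSpace Ω := hΩ.locallyCompactSpace
  let f : ℕ → List Bool → C(Ω, ℝ) := fun n w => ⟨fun p => J w (u n) p,
    continuousOn_iff_continuous_domRestrict.1 fun p hp =>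
      (Sm.J (sm_of_translator hΩ (hu n) hp) w).continuousAt.continuousWithinAt⟩
  have hS : ∀ w, ∃ S : Set C(Ω, ℝ), IsCompact S ∧ ∀ n, f n w ∈ S := by
    intro w
    refine exists_isCompact_of_lipschitz (fun n => f n w) (fun p => ?_) fun p => ?_
    · obtain ⟨M, hM⟩ := exists_local_jet_bound hΩ hu hloc w.length p p.2
      exact ⟨M, fun n => hM.self_of_nhds n w le_rfl⟩
    · obtain ⟨L, hL⟩ := exists_local_lipschitz hΩ hu hloc w p.2
      exact ⟨L, continuousAt_subtype_val.eventually hL⟩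
  choose S hS hfS using hS
  obtain ⟨g, -, φ, hφ, hg⟩ := (isCompact_univ_pi hS).tendsto_subseq (x := f)
    fun n w _ => hfS w n
  let G : List Bool → ℝ × ℝ → ℝ := fun w p => if h : p ∈ Ω then g w ⟨p, h⟩ else 0
  have hG : ∀ w, G w ∘ Subtype.val = (g w : Ω → ℝ) := by
    intro w; ext p; simp [G]
  refine ⟨φ, hφ, G, fun w => ?_, fun w => ?_⟩
  · rw [continuousOn_iff_continuous_domRestrict]
    change Continuous (G w ∘ Subtype.val)
    rw [hG]; exact (g w).continuous
  · rw [tendstoLocallyUniformlyOn_iff_tendstoLocallyUniformly_comp_coe, hG]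
    exact ContinuousMap.tendsto_iff_tendstoLocallyUniformly.1 (tendsto_pi_nhds.1 hg w)

end Compactness

section Limit

variable {Ω : Set (ℝ × ℝ)} {u : ℕ → ℝ × ℝ → ℝ} {p : ℝ × ℝ} {G : List Bool → ℝ × ℝ → ℝ}

/-- The linear form on the plane with a given pair of components. -/
noncomputable def formOf : ℝ × ℝ →L[ℝ] ℝ × ℝ →L[ℝ] ℝ :=
  (ContinuousLinearMap.fst ℝ ℝ ℝ).smulRight (ContinuousLinearMap.fst ℝ ℝ ℝ)
    + (ContinuousLinearMap.snd ℝ ℝ ℝ).smulRight (ContinuousLinearMap.snd ℝ ℝ ℝ)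

lemma hasFDerivAt_limit (hΩ : IsOpen Ω) (hu : ∀ n, ∀ p ∈ Ω, Sm (u n) p)
    (hG : ∀ w, TendstoLocallyUniformlyOn (fun n => J w (u n)) (G w) atTop Ω)
    (w : List Bool) (hp : p ∈ Ω) :
    HasFDerivAt (G w) (formOf (G (false :: w) p, G (true :: w) p)) p := by
  refine hasFDerivAt_of_tendstoLocallyUniformlyOn (l := atTop)
    (f := fun n => J w (u n)) (f' := fun n q => formOf (J (false :: w) (u n) q, J (true :: w) (u n) q))
    (g' := fun q => formOf (G (false :: w) q, G (true :: w) q)) hΩ ?_ (fun n q hq => ?_)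
    (fun q hq => (hG w).tendsto_at hq) hp
  · have h : TendstoLocallyUniformlyOn
        (fun n q => (J (false :: w) (u n) q, J (true :: w) (u n) q))
        (fun q => (G (false :: w) q, G (true :: w) q)) atTop Ω := by
      rw [Metric.tendstoLocallyUniformlyOn_iff]
      intro ε hε q hq
      obtain ⟨s, hs, h1⟩ := Metric.tendstoLocallyUniformlyOn_iff.1 (hG (false :: w)) ε hε q hq
      obtain ⟨t, ht, h2⟩ := Metric.tendstoLocallyUniformlyOn_iff.1 (hG (true :: w)) ε hε q hq
      refine ⟨s ∩ t, inter_mem hs ht, ?_⟩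
      filter_upwards [h1, h2] with n h1 h2 y hy
      exact max_lt (h1 y hy.1) (h2 y hy.2)
    exact formOf.uniformContinuous.comp_tendstoLocallyUniformlyOn h
  · have h := (Sm.diff (Sm.J (hu n q hq) w)).hasFDerivAt
    rwa [fderiv_eq_pd] at h

lemma pd_limit (hΩ : IsOpen Ω) (hu : ∀ n, ∀ p ∈ Ω, Sm (u n) p)
    (hG : ∀ w, TendstoLocallyUniformlyOn (fun n => J w (u n)) (G w) atTop Ω)
    (w : List Bool) (k : Bool) (hp : p ∈ Ω) : pd (dir k) (G w) p = G (k :: w) p := by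
  unfold pd
  rw [(hasFDerivAt_limit hΩ hu hG w hp).fderiv]
  cases k <;> simp [formOf, dir]

lemma J_limit (hΩ : IsOpen Ω) (hu : ∀ n, ∀ p ∈ Ω, Sm (u n) p)
    (hG : ∀ w, TendstoLocallyUniformlyOn (fun n => J w (u n)) (G w) atTop Ω)
    (w : List Bool) : ∀ p ∈ Ω, J w (G []) p = G w p := by
  induction w with
  | nil => exact fun p _ => rfl
  | cons k w ih =>
    intro p hp
    rw [← pd_limit hΩ hu hG w k hp]
    refine pd_congr ?_
    filter_upwards [hΩ.mem_nhds hp] with q hq using ih q hq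

lemma contDiffOn_limit (hΩ : IsOpen Ω) (hu : ∀ n, ∀ p ∈ Ω, Sm (u n) p)
    (hG : ∀ w, TendstoLocallyUniformlyOn (fun n => J w (u n)) (G w) atTop Ω) (w : List Bool) :
    ContDiffOn ℝ ∞ (G w) Ω := by
  refine contDiffOn_infty.2 fun n => ?_
  induction n generalizing w with
  | zero =>
    exact contDiffOn_zero.2 fun p hp =>
      (hasFDerivAt_limit hΩ hu hG w hp).continuousAt.continuousWithinAt
  | succ n ih =>
    push_cast
    refine (contDiffOn_succ_iff_fderiv_of_isOpen hΩ).2 ⟨fun p hp =>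
      (hasFDerivAt_limit hΩ hu hG w hp).differentiableAt.differentiableWithinAt,
      fun h => absurd h (by simp), ?_⟩
    exact (formOf.contDiff.comp_contDiffOn ((ih (false :: w)).prodMk (ih (true :: w)))).congr
      fun p hp => (hasFDerivAt_limit hΩ hu hG w hp).fderiv

lemma translator_limit {c : ℝ} (hΩ : IsOpen Ω) (hu : ∀ n, IsSmoothTranslator c Ω (u n))
    (hG : ∀ w, TendstoLocallyUniformlyOn (fun n => J w (u n)) (G w) atTop Ω) :
    IsSmoothTranslator c Ω (G []) := by
  have hs : ∀ n, ∀ p ∈ Ω, Sm (u n) p := fun n p hp => sm_of_translator hΩ (hu n) hp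
  refine ⟨contDiffOn_limit hΩ hs hG [], fun p hp => ?_⟩
  have ht : ∀ w, Tendsto (fun n => J w (u n) p) atTop (𝓝 (J w (G []) p)) := fun w => by
    rw [J_limit hΩ hs hG w p hp]; exact (hG w).tendsto_at hp
  have hx : Tendsto (fun n => pdx (u n) p) atTop (𝓝 (pdx (G []) p)) := ht [false]
  have htt : Tendsto (fun n => pdt (u n) p) atTop (𝓝 (pdt (G []) p)) := ht [true]
  have hxx : Tendsto (fun n => pdx (pdx (u n)) p) atTop (𝓝 (pdx (pdx (G [])) p)) :=
    ht [false, false]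
  have hxt : Tendsto (fun n => pdx (pdt (u n)) p) atTop (𝓝 (pdx (pdt (G [])) p)) :=
    ht [false, true]
  have httt : Tendsto (fun n => pdt (pdt (u n)) p) atTop (𝓝 (pdt (pdt (G [])) p)) :=
    ht [true, true]
  refine tendsto_nhds_unique (f := fun n => (1 + pdt (u n) p ^ 2) * pdx (pdx (u n)) p
      - 2 * pdx (u n) p * pdt (u n) p * pdx (pdt (u n)) p
      + (1 + pdx (u n) p ^ 2) * pdt (pdt (u n)) p
      + c * pdt (u n) p * (1 + pdx (u n) p ^ 2 + pdt (u n) p ^ 2)) (l := atTop) ?_ ?_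
  · exact (((((htt.pow 2).const_add 1).mul hxx).sub (((hx.const_mul 2).mul htt).mul hxt)).add
      (((hx.pow 2).const_add 1).mul httt)).add
      ((htt.const_mul c).mul (((hx.pow 2).const_add 1).add (htt.pow 2)))
  · exact tendsto_const_nhds.congr fun n => ((hu n).2 p hp).symm

end Limit

end TranslatorAux

/-- Compactness theorem: a locally bounded sequence of smooth c-translator solutions on an
open set `Ω` has a subsequence converging, together with all first and second partial
derivatives, uniformly on compact subsets of `Ω` to a smooth c-translator solution. -/
theorem translator_compactness (c : ℝ) (Ω : Set (ℝ × ℝ)) (hΩ : IsOpen Ω)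
    (u : ℕ → ℝ × ℝ → ℝ) (hu : ∀ n, IsSmoothTranslator c Ω (u n))
    (hloc : ∀ K : Set (ℝ × ℝ), K ⊆ Ω → IsCompact K →
      ∃ M > 0, ∀ n, ∀ q ∈ K, |u n q| ≤ M) :
    ∃ φ : ℕ → ℕ, StrictMono φ ∧ ∃ v : ℝ × ℝ → ℝ, IsSmoothTranslator c Ω v ∧
      ∀ K : Set (ℝ × ℝ), K ⊆ Ω → IsCompact K →
        TendstoUniformlyOn (fun k => u (φ k)) v atTop K ∧
        TendstoUniformlyOn (fun k => pdx (u (φ k))) (pdx v) atTop K ∧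
        TendstoUniformlyOn (fun k => pdt (u (φ k))) (pdt v) atTop K ∧
        TendstoUniformlyOn (fun k => pdx (pdx (u (φ k)))) (pdx (pdx v)) atTop K ∧
        TendstoUniformlyOn (fun k => pdx (pdt (u (φ k)))) (pdx (pdt v)) atTop K ∧
        TendstoUniformlyOn (fun k => pdt (pdx (u (φ k)))) (pdt (pdx v)) atTop K ∧
        TendstoUniformlyOn (fun k => pdt (pdt (u (φ k)))) (pdt (pdt v)) atTop K := by
  have hb : ∀ p ∈ Ω, ∃ M, ∀ᶠ q in 𝓝 p, ∀ n, |u n q| ≤ M := by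
    intro p hp
    obtain ⟨K, hK, hKΩ, hKc⟩ := local_compact_nhds (hΩ.mem_nhds hp)
    obtain ⟨M, -, hM⟩ := hloc K hKΩ hKc
    refine ⟨M, ?_⟩
    filter_upwards [hK] with q hq n using hM n q hq
  obtain ⟨φ, hφ, G, -, hG⟩ := TranslatorAux.exists_subseq_jets hΩ hu hb
  have hs : ∀ n, ∀ p ∈ Ω, TranslatorAux.Sm (u (φ n)) p :=
    fun n p hp => TranslatorAux.sm_of_translator hΩ (hu (φ n)) hp
  refine ⟨φ, hφ, G [], TranslatorAux.translator_limit (u := fun n => u (φ n)) hΩ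
    (fun n => hu (φ n)) hG, fun K hK hKc => ?_⟩
  have h : ∀ w, TendstoUniformlyOn (fun k => TranslatorAux.J w (u (φ k)))
      (TranslatorAux.J w (G [])) atTop K := fun w =>
    ((tendstoLocallyUniformlyOn_iff_forall_isCompact hΩ).1 (hG w) K hK hKc).congr_right
      fun p hp => (TranslatorAux.J_limit (u := fun n => u (φ n)) hΩ hs hG w p (hK hp)).symm
  exact ⟨h [], h [false], h [true], h [false, false], h [false, true], h [true, false],
    h [true, true]⟩
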